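/- arXiv:1612.09388 — 8 statements merged into one kernel-verified Lean document; each statement's English description precedes it below -/
import Mathlib

section
/- For every odd integer t ≥ 5 there exists m₀ such that for all m ≥ m₀ and all n with 1 ≤ n ≤ m, there exists a non-adaptive (m,n,s,t)-scheme (using the MAJORITY-on-t-bits query function for every element) with s = t·⌈60·m^{2/(t-1)}·n^{1-2/(t-1)}·lg(2m/n)⌉. In particular s_N(m,n,t) = O(t·m^{2/(t-1)}·n^{1-2/(t-1)}·lg(2m/n)). -/
/-- All cells probed by elements of `W`. -/
def probeNbr {m t s : ℕ} (i : Fin m → Fin t → Fin s) (W : Finset (Fin m)) : Finset (Fin s) :=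
  W.biUnion (fun x => Finset.univ.image (i x))

lemma probeNbr_mem {m t s : ℕ} (i : Fin m → Fin t → Fin s) (W : Finset (Fin m)) (v : Fin s) :
    v ∈ probeNbr i W ↔ ∃ x ∈ W, ∃ j, i x j = v := by
  simp [probeNbr]

lemma probe_hall {m t s r : ℕ} (i : Fin m → Fin t → Fin s) (R : Finset (Fin m))
    (H : ∀ W ⊆ R, (r + 1) * W.card ≤ (probeNbr i W).card) :
    ∃ f : R × Fin (r + 1) → Fin s, Function.Injective f ∧ ∀ p, ∃ j, i p.1 j = f p := by
  classical
  have := (Finset.all_card_le_biUnion_card_iff_exists_injective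
    (fun p : R × Fin (r + 1) => Finset.univ.image (i p.1))).1 ?_
  · obtain ⟨f, hf, h⟩ := this
    refine ⟨f, hf, fun p => ?_⟩
    simpa using h p
  · intro A
    set W : Finset (Fin m) := A.image (fun p => (p.1 : Fin m)) with hW
    have h1 : W ⊆ R := by
      intro x hx
      simp only [hW, Finset.mem_image] at hx
      obtain ⟨p, _, rfl⟩ := hx
      exact p.1.2
    have h2 : A.card ≤ W.card * (Finset.univ : Finset (Fin (r + 1))).card := by
      rw [← Finset.card_product]
      refine Finset.card_le_card_of_injOn (fun p => ((p.1 : Fin m), p.2)) ?_ ?_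
      · intro p hp
        simp only [Finset.coe_product, Set.mem_prod, Finset.mem_coe, Finset.mem_univ, and_true, hW]
        exact Finset.mem_image_of_mem _ hp
      · rintro ⟨a, b⟩ _ ⟨a', b'⟩ _ h
        simp only [Prod.mk.injEq] at h ⊢
        exact ⟨Subtype.ext h.1, h.2⟩
    have h3 := H W h1
    have h4 : probeNbr i W = A.biUnion (fun p => Finset.univ.image (i p.1)) := by
      ext v
      simp [probeNbr, hW]
    rw [← h4]
    simp only [Finset.card_univ, Fintype.card_fin] at h2
    nlinarith

lemma probe_card_ge {m t s r : ℕ} (i : Fin m → Fin t → Fin s) (R : Finset (Fin m))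
    (f : R × Fin (r + 1) → Fin s) (hf : Function.Injective f) (h : ∀ p, ∃ j, i p.1 j = f p)
    (u : R) (P : Fin s → Prop) [DecidablePred P] (hP : ∀ a, P (f (u, a))) :
    r + 1 ≤ (Finset.univ.filter (fun j : Fin t => P (i u j))).card := by
  classical
  choose g hg using h
  have : (Finset.univ : Finset (Fin (r + 1))).card ≤
      (Finset.univ.filter (fun j : Fin t => P (i u j))).card := by
    refine Finset.card_le_card_of_injOn (fun a => g (u, a)) ?_ ?_
    · intro a _
      have := hg (u, a)
      simp only [Finset.coe_filter, Finset.mem_univ, true_and, Set.mem_ofPred_eq]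
      simp only at this
      rw [this]
      exact hP a
    · intro a _ b _ hab
      have h1 := hg (u, a)
      have h2 := hg (u, b)
      simp only at hab h1 h2
      rw [hab, h2] at h1
      have := hf h1
      simp only [Prod.mk.injEq, true_and] at this
      exact this.symm
  simpa using this

lemma probe_scheme {m s r n q : ℕ} (i : Fin m → Fin (2 * r + 1) → Fin s) (hn : n ≤ m)
    (P1 : ∀ W : Finset (Fin m), W.card < n + q → (r + 1) * W.card ≤ (probeNbr i W).card)
    (P2 : ∀ W : Finset (Fin m), W.card = n + q → (2 * r + 1) * n + r * q < (probeNbr i W).card)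
    (S : Finset (Fin m)) (hS : S.card ≤ n) :
    ∃ φ : Fin s → Bool, ∀ x,
      2 * r + 1 < 2 * (Finset.univ.filter (fun j => φ (i x j) = true)).card ↔ x ∈ S := by
  classical
  obtain ⟨S', hSS', -, hS'⟩ := Finset.exists_subsuperset_card_eq (Finset.subset_univ S) hS
    (by simpa using hn)
  set T : Finset (Fin m) := (Finset.univ \ S').filter
    (fun y => r + 1 ≤ (Finset.univ.filter (fun j => i y j ∈ probeNbr i S')).card) with hT
  have hTq : T.card < q := by
    by_contra hcon
    push Not at hcon
    obtain ⟨T', hT'T, hT'⟩ := Finset.exists_subset_card_eq hcon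
    have hdis : Disjoint S' T' := by
      rw [Finset.disjoint_left]
      intro x hx hx'
      have := hT'T hx'
      simp only [hT, Finset.mem_filter, Finset.mem_sdiff] at this
      exact this.1.2 hx
    have hc : (S' ∪ T').card = n + q := by
      rw [Finset.card_union_of_disjoint hdis, hS', hT']
    have h1 := P2 _ hc
    have h2 : probeNbr i (S' ∪ T') ⊆ probeNbr i S' ∪ T'.biUnion (fun y =>
        (Finset.univ.filter (fun j => ¬ i y j ∈ probeNbr i S')).image (i y)) := by
      intro v hv
      by_cases hv' : v ∈ probeNbr i S'
      · exact Finset.mem_union_left _ hv'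
      · refine Finset.mem_union_right _ ?_
        obtain ⟨x, hx, j, hj⟩ := (probeNbr_mem _ _ _).1 hv
        rcases Finset.mem_union.1 hx with hx | hx
        · exact absurd ((probeNbr_mem _ _ _).2 ⟨x, hx, j, hj⟩) hv'
        · refine Finset.mem_biUnion.2 ⟨x, hx, Finset.mem_image.2 ⟨j, ?_, hj⟩⟩
          simp only [Finset.mem_filter, Finset.mem_univ, true_and]
          rwa [hj]
    have h3 : (probeNbr i S').card ≤ n * (2 * r + 1) := by
      rw [← hS']
      refine Finset.card_biUnion_le_card_mul _ _ _ fun x _ => ?_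
      exact Finset.card_image_le.trans (by simp)
    have h4 : (T'.biUnion (fun y =>
        (Finset.univ.filter (fun j => ¬ i y j ∈ probeNbr i S')).image (i y))).card ≤ q * r := by
      rw [← hT']
      refine Finset.card_biUnion_le_card_mul _ _ _ fun x hx => ?_
      refine Finset.card_image_le.trans ?_
      have := hT'T hx
      simp only [hT, Finset.mem_filter] at this
      have h5 := Finset.card_filter_add_card_filter_not (s := (Finset.univ : Finset (Fin (2*r+1))))
        (fun j => i x j ∈ probeNbr i S')
      simp only [Finset.card_univ, Fintype.card_fin] at h5
      omega
    have h6 := (Finset.card_le_card h2).trans (Finset.card_union_le _ _)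
    nlinarith
  have hR : ∀ W ⊆ S' ∪ T, (r + 1) * W.card ≤ (probeNbr i W).card := by
    intro W hW
    apply P1
    have := (Finset.card_le_card hW).trans (Finset.card_union_le _ _)
    omega
  obtain ⟨f, hf, hfi⟩ := probe_hall i (S' ∪ T) hR
  refine ⟨fun v => decide (∃ p, (p.1 : Fin m) ∈ S ∧ f p = v), fun x => ?_⟩
  simp only [decide_eq_true_eq]
  constructor
  · intro h
    by_contra hx
    have hle : (Finset.univ.filter
        (fun j => ∃ p, (p.1 : Fin m) ∈ S ∧ f p = i x j)).card ≤ r := by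
      by_cases hxR : x ∈ S' ∪ T
      · have := probe_card_ge i _ f hf hfi ⟨x, hxR⟩
          (fun v => ¬ ∃ p, (p.1 : Fin m) ∈ S ∧ f p = v) (by
            rintro a ⟨p, hp, hpa⟩
            have := hf hpa
            rw [this] at hp
            exact hx hp)
        have h5 := Finset.card_filter_add_card_filter_not
          (s := (Finset.univ : Finset (Fin (2*r+1))))
          (fun j => ∃ p, (p.1 : Fin m) ∈ S ∧ f p = i x j)
        simp only [Finset.card_univ, Fintype.card_fin] at h5
        simp only at this
        omega
      · have h1 : x ∉ S' := fun h => hxR (Finset.mem_union_left _ h)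
        have h2 : x ∉ T := fun h => hxR (Finset.mem_union_right _ h)
        simp only [hT, Finset.mem_filter, Finset.mem_sdiff, Finset.mem_univ, true_and, h1,
          not_false_eq_true, not_le] at h2
        refine Nat.lt_succ_iff.1 (lt_of_le_of_lt (Finset.card_le_card ?_) h2)
        intro j hj
        simp only [Finset.mem_filter, Finset.mem_univ, true_and] at hj ⊢
        obtain ⟨p, hp, hpj⟩ := hj
        obtain ⟨j', hj'⟩ := hfi p
        exact (probeNbr_mem _ _ _).2 ⟨p.1, hSS' hp, j', hj'.trans hpj⟩
    omega
  · intro hx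
    have := probe_card_ge i _ f hf hfi ⟨x, Finset.mem_union_left _ (hSS' hx)⟩
      (fun v => ∃ p, (p.1 : Fin m) ∈ S ∧ f p = v) (fun a => ⟨_, hx, rfl⟩)
    simp only at this
    omega

/-- Placements for which some `k`-set has its probes inside some `c`-set. -/
def probeBad (m t s k c : ℕ) : Finset (Fin m → Fin t → Fin s) :=
  (Finset.powersetCard k Finset.univ ×ˢ Finset.powersetCard c Finset.univ).biUnion
    (fun p : Finset (Fin m) × Finset (Fin s) => Fintype.piFinset (fun x => Fintype.piFinset
      (fun _ => if x ∈ p.1 then p.2 else Finset.univ)))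

lemma probeBad_mem {m t s k c : ℕ} (i : Fin m → Fin t → Fin s) (W : Finset (Fin m))
    (hW : W.card = k) (hc : (probeNbr i W).card ≤ c) (hcs : c ≤ s) : i ∈ probeBad m t s k c := by
  classical
  obtain ⟨L, hL, -, hLc⟩ := Finset.exists_subsuperset_card_eq
    (Finset.subset_univ (probeNbr i W)) hc (by simpa using hcs)
  refine Finset.mem_biUnion.2 ⟨(W, L), by simp [hW, hLc], ?_⟩
  simp only [Fintype.mem_piFinset]
  intro x j
  split_ifs with h
  · exact hL ((probeNbr_mem _ _ _).2 ⟨x, h, j, rfl⟩)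
  · simp

lemma probeBad_card (m t s k c : ℕ) (hs : 0 < s) :
    ((probeBad m t s k c).card : ℝ) ≤
      (m.choose k : ℝ) * (s.choose c) * ((c : ℝ) / s) ^ (t * k) * ((s : ℝ) ^ t) ^ m := by
  classical
  have h1 : (probeBad m t s k c).card ≤
      (Finset.powersetCard k (Finset.univ : Finset (Fin m)) ×ˢ
       Finset.powersetCard c (Finset.univ : Finset (Fin s))).card *
      ((c ^ t) ^ k * (s ^ t) ^ (m - k)) := by
    refine Finset.card_biUnion_le_card_mul _ _ _ ?_
    rintro ⟨W, L⟩ hp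
    simp only [Finset.mem_product, Finset.mem_powersetCard, Finset.subset_univ, true_and] at hp
    refine le_of_eq ?_
    rw [Fintype.card_piFinset]
    have : ∀ x : Fin m, (Fintype.piFinset
        (fun _ : Fin t => if x ∈ W then L else Finset.univ)).card
        = if x ∈ W then c ^ t else s ^ t := by
      intro x
      split_ifs <;> simp [hp.2]
    simp only [this]
    rw [Finset.prod_ite]
    simp only [Finset.prod_const]
    have e1 : (Finset.univ.filter (fun x => x ∈ W)) = W := by ext; simp
    have e2 : (Finset.univ.filter (fun x => x ∉ W)) = Wᶜ := by ext; simp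
    rw [e1, e2, Finset.card_compl, hp.1, Fintype.card_fin]
  simp only [Finset.card_product, Finset.card_powersetCard, Finset.card_univ,
    Fintype.card_fin] at h1
  by_cases hkm : k ≤ m
  · have h2 : ((probeBad m t s k c).card : ℝ) ≤
      (m.choose k : ℝ) * (s.choose c) * (((c:ℝ) ^ t) ^ k * ((s:ℝ) ^ t) ^ (m - k)) := by
      exact_mod_cast h1
    refine h2.trans (le_of_eq ?_)
    rw [mul_assoc _ (((c : ℝ) / s) ^ (t * k)) _]
    congr 1
    have hs' : (s : ℝ) ≠ 0 := by positivity
    obtain ⟨d, rfl⟩ := Nat.exists_eq_add_of_le hkm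
    rw [Nat.add_sub_cancel_left, pow_add, div_pow, pow_mul, pow_mul]
    field_simp
  · have : m.choose k = 0 := Nat.choose_eq_zero_of_lt (by omega)
    rw [this] at h1 ⊢
    simp at h1 ⊢
    rw [h1]

lemma choose_three (a k : ℕ) : (a.choose k : ℝ) * (k : ℝ) ^ k ≤ (3 * (a : ℝ)) ^ k := by
  have h1 : (a.choose k : ℝ) ≤ (a : ℝ) ^ k / (k.factorial : ℝ) := Nat.choose_le_pow_div k a
  have h2 : (k : ℝ) ^ k / (k.factorial : ℝ) ≤ Real.exp k :=
    Real.pow_div_factorial_le_exp k (by positivity) k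
  have h3 : Real.exp k ≤ 3 ^ k := by
    rw [← mul_one (k : ℝ), Real.exp_nat_mul]
    have := Real.exp_one_lt_d9
    gcongr
    linarith
  calc (a.choose k : ℝ) * (k : ℝ) ^ k ≤ (a : ℝ) ^ k / (k.factorial : ℝ) * (k : ℝ) ^ k := by gcongr
    _ = (a : ℝ) ^ k * ((k : ℝ) ^ k / (k.factorial : ℝ)) := by ring
    _ ≤ (a : ℝ) ^ k * 3 ^ k := by gcongr; exact h2.trans h3
    _ = _ := by rw [mul_pow]; ring

lemma choose_three_div (a k : ℕ) (hk : 0 < k) :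
    (a.choose k : ℝ) ≤ (3 * (a : ℝ) / k) ^ k := by
  rw [div_pow, le_div_iff₀ (by positivity)]
  exact choose_three a k

lemma choose_ratio (s c d : ℕ) (hs : 0 < s) :
    (s.choose c : ℝ) * ((c : ℝ) / s) ^ (c + d) ≤ 3 ^ c * ((c : ℝ) / s) ^ d := by
  rw [pow_add, ← mul_assoc]
  gcongr
  rw [div_pow, ← mul_div_assoc, div_le_iff₀ (by positivity), ← mul_pow]
  exact choose_three s c

lemma bound_one (m s r n p k : ℕ) (u : ℝ) (hr : 2 ≤ r) (hn : 1 ≤ n) (hp : 1 ≤ p) (hu : 1 ≤ u)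
    (hm : (m : ℝ) = n * u ^ r) (hs : 30 * (2 * r + 1) * n * u * p ≤ (s : ℝ)) (hk : 1 ≤ k)
    (hk3 : k ≤ 3 * n * p) :
    (m.choose k : ℝ) * (s.choose ((r + 1) * k)) *
      ((((r + 1) * k : ℕ) : ℝ) / s) ^ ((2 * r + 1) * k) ≤ (1 / 4) ^ k := by
  have hn0 : (0 : ℝ) < n := by exact_mod_cast hn
  have hp0 : (0 : ℝ) < p := by exact_mod_cast hp
  have hp1 : (1 : ℝ) ≤ p := by exact_mod_cast hp
  have hk0 : (0 : ℝ) < k := by exact_mod_cast hk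
  have hr2 : (2 : ℝ) ≤ r := by exact_mod_cast hr
  have hu0 : 0 < u := by linarith
  have hs0 : (0 : ℝ) < s := lt_of_lt_of_le (by positivity) hs
  have hs0' : 0 < s := by exact_mod_cast hs0
  have e : (2 * r + 1) * k = (r + 1) * k + r * k := by ring
  have h1 := choose_ratio s ((r + 1) * k) (r * k) hs0'
  have h2 := choose_three_div m k hk
  set y : ℝ := (((r + 1) * k : ℕ) : ℝ) / s with hy
  have hy0 : 0 ≤ y := by positivity
  set a : ℝ := (k : ℝ) / (n * p) with ha
  have ha0 : 0 < a := by positivity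
  have ha3 : a ≤ 3 := by
    rw [ha, div_le_iff₀ (by positivity)]
    have : (k : ℝ) ≤ 3 * n * p := by exact_mod_cast hk3
    linarith
  have hya : y ≤ a / (50 * u) := by
    rw [hy, ha, div_div, div_le_div_iff₀ hs0 (by positivity)]
    push_cast
    have h5 : 50 * ((r : ℝ) + 1) ≤ 30 * (2 * r + 1) := by linarith
    calc ((r : ℝ) + 1) * k * (n * p * (50 * u)) = (50 * ((r : ℝ) + 1)) * (k * n * u * p) := by ring
      _ ≤ (30 * (2 * r + 1)) * (k * n * u * p) := by gcongr
      _ = k * (30 * (2 * r + 1) * n * u * p) := by ring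
      _ ≤ k * s := by gcongr
  have hbase : (3 * (m : ℝ) / k) * 3 ^ (r + 1) * y ^ r ≤ 1 / 4 := by
    obtain ⟨b, rfl⟩ : ∃ b, r = b + 2 := ⟨r - 2, by omega⟩
    have hka : (k : ℝ) = a * (n * p) := by rw [ha]; field_simp
    calc (3 * (m : ℝ) / k) * 3 ^ (b + 2 + 1) * y ^ (b + 2)
        ≤ (3 * (m : ℝ) / k) * 3 ^ (b + 2 + 1) * (a / (50 * u)) ^ (b + 2) := by gcongr
      _ = 81 / 2500 * (a / p) * (3 * a / 50) ^ b := by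
          rw [hm, hka]
          simp only [div_pow, mul_pow, pow_succ]
          field_simp
          ring
      _ ≤ 81 / 2500 * (3 / 1) * 1 ^ b := by
          gcongr
          linarith
      _ ≤ 1 / 4 := by norm_num
  rw [e]
  calc (m.choose k : ℝ) * (s.choose ((r + 1) * k)) * y ^ ((r + 1) * k + r * k)
      = (m.choose k : ℝ) * ((s.choose ((r + 1) * k)) * y ^ ((r + 1) * k + r * k)) := by ring
    _ ≤ (3 * (m : ℝ) / k) ^ k * (3 ^ ((r + 1) * k) * y ^ (r * k)) := by gcongr
    _ = ((3 * (m : ℝ) / k) * 3 ^ (r + 1) * y ^ r) ^ k := by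
        rw [pow_mul, pow_mul, ← mul_pow, ← mul_pow]; ring
    _ ≤ (1 / 4) ^ k := by gcongr

lemma bound_two (m s r n p : ℕ) (u : ℝ) (hr : 2 ≤ r) (hn : 1 ≤ n) (hp : 1 ≤ p) (hu : 1 ≤ u)
    (hm : (m : ℝ) = n * u ^ r) (hs : 30 * (2 * r + 1) * n * u * p ≤ (s : ℝ))
    (hup : u ^ r ≤ 2 ^ p) :
    (m.choose (n + 2 * n * p) : ℝ) * (s.choose ((2 * r + 1) * n + r * (2 * n * p))) *
      ((((2 * r + 1) * n + r * (2 * n * p) : ℕ) : ℝ) / s) ^ ((2 * r + 1) * (n + 2 * n * p))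
        ≤ 1 / 4 := by
  have hn0 : (0 : ℝ) < n := by exact_mod_cast hn
  have hp0 : (0 : ℝ) < p := by exact_mod_cast hp
  have hp1 : (1 : ℝ) ≤ p := by exact_mod_cast hp
  have hr2 : (2 : ℝ) ≤ r := by exact_mod_cast hr
  have hu0 : 0 < u := by linarith
  have hs0 : (0 : ℝ) < s := lt_of_lt_of_le (by positivity) hs
  have hs0' : 0 < s := by exact_mod_cast hs0
  set k := n + 2 * n * p with hk
  set c := (2 * r + 1) * n + r * (2 * n * p) with hc
  set d := 2 * (r + 1) * (p * n) with hd
  have e : (2 * r + 1) * k = c + d := by rw [hk, hc, hd]; ring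
  have h1 := choose_ratio s c d hs0'
  have hk0 : 0 < k := by omega
  have h2 := choose_three_div m k hk0
  have h3 : 3 * (m : ℝ) / k ≤ 3 * u ^ r := by
    rw [div_le_iff₀ (by positivity), hm]
    have : (n : ℝ) ≤ k := by
      have : n ≤ k := by omega
      exact_mod_cast this
    have := mul_le_mul_of_nonneg_left this (by positivity : 0 ≤ 3 * u ^ r)
    linarith
  have h4 : (c : ℝ) / s ≤ 1 / (15 * u) := by
    rw [div_le_div_iff₀ hs0 (by positivity)]
    refine le_trans ?_ (by linarith : 30 * (2 * r + 1) * n * u * p ≤ 1 * (s : ℝ))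
    have : (c : ℝ) ≤ (2 * r + 1) * n * (2 * p) := by
      rw [hc]; push_cast
      have : 0 ≤ ((2 * r + 1) * n : ℝ) * (p - 1) := mul_nonneg (by positivity) (by linarith)
      nlinarith [mul_pos hn0 hp0]
    calc (c : ℝ) * (15 * u) ≤ ((2 * r + 1) * n * (2 * p)) * (15 * u) := by gcongr
      _ = _ := by ring
  have hkc : k + c ≤ 2 * d := by
    rw [hk, hc, hd]
    have : n ≤ p * n := Nat.le_mul_of_pos_left _ hp
    have : 2 * r * n ≤ 2 * r * (p * n) := Nat.mul_le_mul_left _ this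
    nlinarith
  have hrk : r * k ≤ d + r * n := by
    rw [hk, hd]
    nlinarith [Nat.zero_le (p * n)]
  rw [e]
  have h06 : (2 : ℝ) * (3 / 5) ^ (2 * (r + 1)) ≤ 1 / 4 := by
    have : ((3 : ℝ) / 5) ^ (2 * (r + 1)) ≤ (3 / 5) ^ 6 :=
      pow_le_pow_of_le_one (by norm_num) (by norm_num) (by omega)
    norm_num at this ⊢
    linarith
  calc (m.choose k : ℝ) * (s.choose c) * ((c : ℝ) / s) ^ (c + d)
      = (m.choose k : ℝ) * ((s.choose c) * ((c : ℝ) / s) ^ (c + d)) := by ring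
    _ ≤ (3 * (m : ℝ) / k) ^ k * (3 ^ c * ((c : ℝ) / s) ^ d) := by gcongr
    _ ≤ (3 * u ^ r) ^ k * (3 ^ c * (1 / (15 * u)) ^ d) := by gcongr
    _ = 3 ^ (k + c) * u ^ (r * k) * (1 / (15 * u)) ^ d := by
        rw [mul_pow, pow_add, pow_mul]; ring
    _ ≤ 3 ^ (2 * d) * u ^ (d + r * n) * (1 / (15 * u)) ^ d := by
        gcongr
        norm_num
    _ = (3 / 5) ^ d * (u ^ r) ^ n := by
        rw [pow_mul 3 2 d, pow_add, pow_mul u r n]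
        have : (3 ^ 2 : ℝ) ^ d * (u ^ d * (u ^ r) ^ n) * (1 / (15 * u)) ^ d
          = (3 ^ 2 * u * (1 / (15 * u))) ^ d * (u ^ r) ^ n := by
          rw [mul_pow, mul_pow]; ring
        rw [this]
        congr 2
        field_simp
        norm_num
    _ ≤ (3 / 5) ^ d * (2 ^ p) ^ n := by gcongr
    _ = (2 * (3 / 5) ^ (2 * (r + 1))) ^ (p * n) := by
        rw [hd, pow_mul, mul_pow, pow_mul 2 p n]; ring
    _ ≤ (1 / 4) ^ (p * n) := by gcongr
    _ ≤ 1 / 4 := by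
        apply pow_le_of_le_one (by norm_num) (by norm_num)
        positivity

lemma exists_probe (m s r n p : ℕ) (u : ℝ) (hr : 2 ≤ r) (hn : 1 ≤ n) (hp : 1 ≤ p) (hu : 1 ≤ u)
    (hm : (m : ℝ) = n * u ^ r) (hs : 30 * (2 * r + 1) * n * u * p ≤ (s : ℝ))
    (hup : u ^ r ≤ 2 ^ p) :
    ∃ i : Fin m → Fin (2 * r + 1) → Fin s,
    (∀ W : Finset (Fin m), W.card < n + 2 * n * p → (r + 1) * W.card ≤ (probeNbr i W).card) ∧
    (∀ W : Finset (Fin m), W.card = n + 2 * n * p →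
      (2 * r + 1) * n + r * (2 * n * p) < (probeNbr i W).card) := by
  classical
  have hn0 : (0 : ℝ) < n := by exact_mod_cast hn
  have hp0 : (0 : ℝ) < p := by exact_mod_cast hp
  have hu0 : 0 < u := by linarith
  have hs0 : (0 : ℝ) < s := lt_of_lt_of_le (by positivity) hs
  have hs0' : 0 < s := by exact_mod_cast hs0
  have hs2 : 30 * (2 * r + 1) * (n * p) ≤ s := by
    have : (30 * (2 * r + 1) * (n * p) : ℝ) ≤ s := by
      refine le_trans ?_ hs
      calc (30 * (2 * r + 1) * (n * p) : ℝ) = 30 * (2 * r + 1) * n * 1 * p := by ring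
        _ ≤ _ := by gcongr
    exact_mod_cast this
  have hnp : n ≤ n * p := Nat.le_mul_of_pos_right _ hp
  set K := n + 2 * n * p with hK
  have hK3 : K ≤ 3 * n * p := by rw [hK]; nlinarith
  by_contra hcon
  push Not at hcon
  set B := (Finset.Ico 1 K).biUnion (fun k => probeBad m (2 * r + 1) s k ((r + 1) * k)) ∪
    probeBad m (2 * r + 1) s K ((2 * r + 1) * n + r * (2 * n * p)) with hB
  have hall : (Finset.univ : Finset (Fin m → Fin (2 * r + 1) → Fin s)) ⊆ B := by
    intro i _
    by_cases h1 : ∀ W : Finset (Fin m), W.card < K → (r + 1) * W.card ≤ (probeNbr i W).card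
    · obtain ⟨W, hW, hW2⟩ := hcon i h1
      refine Finset.mem_union_right _ (probeBad_mem i W hW hW2 ?_)
      nlinarith
    · push Not at h1
      obtain ⟨W, hW, hW2⟩ := h1
      refine Finset.mem_union_left _ (Finset.mem_biUnion.2 ⟨W.card, ?_, ?_⟩)
      · rw [Finset.mem_Ico]
        refine ⟨?_, hW⟩
        by_contra h0
        have : W.card = 0 := by omega
        rw [this] at hW2
        omega
      · refine probeBad_mem i W rfl hW2.le ?_
        have : W.card ≤ 3 * (n * p) := by nlinarith
        calc (r + 1) * W.card ≤ (r + 1) * (3 * (n * p)) := Nat.mul_le_mul_left _ this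
          _ ≤ 30 * (2 * r + 1) * (n * p) := by nlinarith [Nat.zero_le (r * (n * p))]
          _ ≤ s := hs2
  have hcard := Finset.card_le_card hall
  rw [Finset.card_univ] at hcard
  simp only [Fintype.card_fun, Fintype.card_fin] at hcard
  have hcardR : ((s : ℝ) ^ (2 * r + 1)) ^ m ≤ (B.card : ℝ) := by exact_mod_cast hcard
  set N : ℝ := ((s : ℝ) ^ (2 * r + 1)) ^ m with hN
  have hN0 : 0 < N := by positivity
  have hgeo : ∀ M : ℕ, ∑ k ∈ Finset.Ico 1 M, ((1 : ℝ) / 4) ^ k ≤ 1 / 3 := by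
    intro M
    have h1 : ∑ k ∈ Finset.Ico 1 (M + 1), ((1 : ℝ) / 4) ^ k = 1 / 3 - 1 / 3 * (1 / 4) ^ M := by
      induction M with
      | zero => simp
      | succ M ih => rw [Finset.sum_Ico_succ_top (by omega), ih]; ring
    have h2 : ∑ k ∈ Finset.Ico 1 M, ((1 : ℝ) / 4) ^ k
        ≤ ∑ k ∈ Finset.Ico 1 (M + 1), ((1 : ℝ) / 4) ^ k :=
      Finset.sum_le_sum_of_subset_of_nonneg (Finset.Ico_subset_Ico_right (by omega))
        (fun _ _ _ => by positivity)
    have : (0 : ℝ) ≤ 1 / 3 * (1 / 4) ^ M := by positivity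
    linarith
  have hBc : (B.card : ℝ) ≤ (∑ k ∈ Finset.Ico 1 K, ((1 : ℝ) / 4) ^ k) * N + 1 / 4 * N := by
    have h1 : (B.card : ℝ) ≤ ∑ k ∈ Finset.Ico 1 K,
        ((probeBad m (2 * r + 1) s k ((r + 1) * k)).card : ℝ) +
        ((probeBad m (2 * r + 1) s K ((2 * r + 1) * n + r * (2 * n * p))).card : ℝ) := by
      have := (Finset.card_union_le _ _).trans (Nat.add_le_add_right
        (Finset.card_biUnion_le (s := Finset.Ico 1 K)
          (t := fun k => probeBad m (2 * r + 1) s k ((r + 1) * k)))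
        (probeBad m (2 * r + 1) s K ((2 * r + 1) * n + r * (2 * n * p))).card)
      exact_mod_cast this
    refine h1.trans (add_le_add ?_ ?_)
    · rw [Finset.sum_mul]
      refine Finset.sum_le_sum fun k hk => ?_
      rw [Finset.mem_Ico] at hk
      refine (probeBad_card _ _ _ _ _ hs0').trans ?_
      exact mul_le_mul_of_nonneg_right
        (bound_one m s r n p k u hr hn hp hu hm hs hk.1 (by omega)) hN0.le
    · refine (probeBad_card _ _ _ _ _ hs0').trans ?_
      exact mul_le_mul_of_nonneg_right
        (bound_two m s r n p u hr hn hp hu hm hs hup) hN0.le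
  have := mul_le_mul_of_nonneg_right (hgeo K) hN0.le
  linarith

/-- For every odd integer `t ≥ 5` there exists `m₀` such that for all
`m ≥ m₀` and all `n` with `1 ≤ n ≤ m`, there is a non-adaptive `(m,n,s,t)`-scheme
using the MAJORITY-on-`t`-bits query function for every element, with
`s = t·⌈60·m^(2/(t-1))·n^(1-2/(t-1))·lg(2m/n)⌉`. -/
theorem nonadaptive_majority_upper_bound :
    ∀ t : ℕ, Odd t → 5 ≤ t →
    ∃ m₀ : ℕ, ∀ m : ℕ, m₀ ≤ m → ∀ n : ℕ, 1 ≤ n → n ≤ m →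
    ∃ s : ℕ,
      s = t * ⌈(60 : ℝ) * (m : ℝ) ^ ((2 : ℝ) / ((t : ℝ) - 1)) *
              (n : ℝ) ^ ((1 : ℝ) - (2 : ℝ) / ((t : ℝ) - 1)) *
              Real.logb 2 ((2 * (m : ℝ)) / (n : ℝ))⌉₊ ∧
      ∃ (i : Fin m → Fin t → Fin s) (φ : Finset (Fin m) → Fin s → Bool),
        ∀ S : Finset (Fin m), S.card ≤ n → ∀ x : Fin m,
          (t < 2 * (Finset.univ.filter (fun j : Fin t => φ S (i x j) = true)).card
            ↔ x ∈ S) := by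
  intro t ht ht5
  refine ⟨1, fun m hm1 n hn hnm => ⟨_, rfl, ?_⟩⟩
  obtain ⟨r, rfl⟩ := ht
  have hr : 2 ≤ r := by omega
  have hn0 : (0 : ℝ) < n := by exact_mod_cast hn
  have hm0 : (0 : ℝ) < m := by exact_mod_cast hm1
  have hr0 : (r : ℝ) ≠ 0 := by positivity
  have hnm' : (n : ℝ) ≤ m := by exact_mod_cast hnm
  have hmn : (1 : ℝ) ≤ m / n := by rwa [le_div_iff₀ hn0, one_mul]
  have he : (2 : ℝ) / (((2 * r + 1 : ℕ) : ℝ) - 1) = 1 / r := by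
    push_cast
    field_simp
    ring
  rw [he]
  set l : ℝ := Real.logb 2 ((2 * (m : ℝ)) / (n : ℝ)) with hl
  set u : ℝ := ((m : ℝ) / n) ^ ((1 : ℝ) / r) with hu
  have hu1 : 1 ≤ u := Real.one_le_rpow hmn (by positivity)
  have hur : u ^ r = m / n := by
    rw [hu, one_div, Real.rpow_inv_natCast_pow (by positivity) (by omega)]
  have hl1 : 1 ≤ l := by
    rw [hl, Real.le_logb_iff_rpow_le (by norm_num) (by positivity), Real.rpow_one,
      mul_div_assoc]
    linarith
  have hX : (60 : ℝ) * (m : ℝ) ^ ((1 : ℝ) / r) * (n : ℝ) ^ ((1 : ℝ) - 1 / r) * l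
      = 60 * n * u * l := by
    rw [hu, Real.div_rpow hm0.le hn0.le, Real.rpow_sub hn0, Real.rpow_one]
    ring
  rw [hX]
  set b := ⌈60 * n * u * l⌉₊ with hb
  have hb1 : 60 * n * u * l ≤ (b : ℝ) := Nat.le_ceil _
  set p := ⌈l⌉₊ with hp
  have hlp : l ≤ p := Nat.le_ceil _
  have hpl : (p : ℝ) < l + 1 := Nat.ceil_lt_add_one (by linarith)
  have hp1 : 1 ≤ p := by
    have : (1 : ℝ) ≤ p := hl1.trans hlp
    exact_mod_cast this
  have hup : u ^ r ≤ 2 ^ p := by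
    rw [hur]
    have h1 : (2 * (m : ℝ)) / n = 2 ^ l := by
      rw [hl, Real.rpow_logb (by norm_num) (by norm_num) (by positivity)]
    have h2 : (2 : ℝ) ^ l ≤ 2 ^ p := by
      rw [← Real.rpow_natCast]
      exact Real.rpow_le_rpow_of_exponent_le (by norm_num) hlp
    rw [← h1, mul_div_assoc] at h2
    linarith
  have hs : 30 * (2 * r + 1) * n * u * p ≤ (((2 * r + 1) * b : ℕ) : ℝ) := by
    push_cast
    calc 30 * (2 * (r : ℝ) + 1) * n * u * p ≤ 30 * (2 * (r : ℝ) + 1) * n * u * (2 * l) := by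
          gcongr
          linarith
      _ = (2 * (r : ℝ) + 1) * (60 * n * u * l) := by ring
      _ ≤ _ := by gcongr
  obtain ⟨i, P1, P2⟩ := exists_probe m ((2 * r + 1) * b) r n p u hr hn hp1 hu1
    (by rw [hur]; field_simp) hs hup
  have key : ∀ S : Finset (Fin m), ∃ φ : Fin ((2 * r + 1) * b) → Bool, S.card ≤ n → ∀ x,
      (2 * r + 1 < 2 * (Finset.univ.filter (fun j => φ (i x j) = true)).card ↔ x ∈ S) := by
    intro S
    by_cases hS : S.card ≤ n
    · obtain ⟨φ, hφ⟩ := probe_scheme i hnm P1 P2 S hS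
      exact ⟨φ, fun _ => hφ⟩
    · exact ⟨fun _ => false, fun h => absurd h hS⟩
  choose φ hφ using key
  exact ⟨i, φ, hφ⟩
end

section
/- Let t be an odd positive integer, let m, n, s be positive integers with n ≤ m, let K = ⌈2n·lg(2m/n)⌉, and let Γ : [m] × [t] → [s]. For R ⊆ [m] write N(R) = {(i, Γ(x,i)) : x ∈ R, i ∈ [t]} ⊆ [t] × [s]. Suppose (P1): for every R ⊆ [m] with |R| ≤ n + K one has |N(R)| ≥ ((t+1)/2)·|R|; and (P2): for every S ⊆ [m] with |S| = n, the set T_S = {y ∈ [m] \ S : |N({y}) ∩ N(S)| ≥ (t+1)/2} satisfies |T_S| ≤ K. Then for every S ⊆ [m] with |S| ≤ n there exists an assignment L : [t] × [s] → {0,1} such that for every x ∈ [m]: |{i ∈ [t] : L(i, Γ(x,i)) = 1}| ≥ (t+1)/2 if and only if x ∈ S. -/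
/-- If a non-adaptive `(m,s,t)`-graph `Γ` (with `t` odd) satisfies the
expansion property (P1) and the bounded-survivor property (P2), then for every set
`S` of size at most `n` there is a memory assignment such that the MAJORITY-based
query scheme answers all membership queries correctly.  Here
`N(R) = {(i, Γ(x,i)) : x ∈ R, i ∈ [t]}` and `K = ⌈2n·lg(2m/n)⌉`; the condition
`|N(R)| ≥ ((t+1)/2)·|R|` is expressed as `(t+1)·|R| ≤ 2·|N(R)|`, and
"at least `(t+1)/2` ones among the `t` probed bits" (MAJORITY, `t` odd) is
expressed as `t+1 ≤ 2·(number of ones)`. -/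
theorem admissible_graph_implies_satisfiable
    (t m n s : ℕ) (ht : Odd t) (ht0 : 0 < t) (hm : 0 < m) (hn : 0 < n) (hs : 0 < s)
    (hnm : n ≤ m)
    (K : ℕ) (hK : K = ⌈(2 * (n : ℝ)) * Real.logb 2 ((2 * (m : ℝ)) / (n : ℝ))⌉₊)
    (Γ : Fin m → Fin t → Fin s)
    (N : Finset (Fin m) → Finset (Fin t × Fin s))
    (hN : ∀ R : Finset (Fin m),
      N R = R.biUnion (fun x => Finset.univ.image (fun i : Fin t => (i, Γ x i))))
    (hP1 : ∀ R : Finset (Fin m), R.card ≤ n + K → (t + 1) * R.card ≤ 2 * (N R).card)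
    (hP2 : ∀ S : Finset (Fin m), S.card = n →
      ((Finset.univ \ S).filter
        (fun y : Fin m => t + 1 ≤ 2 * ((N {y}) ∩ (N S)).card)).card ≤ K) :
    ∀ S : Finset (Fin m), S.card ≤ n →
      ∃ L : Fin t → Fin s → Bool,
        ∀ x : Fin m,
          (t + 1 ≤ 2 * (Finset.univ.filter (fun i : Fin t => L i (Γ x i) = true)).card
            ↔ x ∈ S) := by
  obtain ⟨k, rfl⟩ := ht
  intro S hS
  obtain ⟨S', hSS', hS'⟩ : ∃ S' : Finset (Fin m), S ⊆ S' ∧ S'.card = n :=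
    Finset.exists_superset_card_eq hS (by simpa using hnm)
  set T := (Finset.univ \ S').filter
        (fun y : Fin m => 2 * k + 1 + 1 ≤ 2 * ((N {y}) ∩ (N S')).card) with hT
  have hTK : T.card ≤ K := hP2 S' hS'
  set W := S' ∪ T with hW
  have hWc : W.card ≤ n + K := (Finset.card_union_le _ _).trans (by omega)
  have memN : ∀ (R : Finset (Fin m)) (p : Fin (2 * k + 1) × Fin s),
      p ∈ N R ↔ ∃ x ∈ R, ∃ i, (i, Γ x i) = p := by
    intro R p
    rw [hN]
    simp
  obtain ⟨f, hf, hfN⟩ := (Finset.all_card_le_biUnion_card_iff_exists_injective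
    (fun q : {x // x ∈ W} × Fin (k + 1) => N {q.1.1})).1 (by
      intro s'
      have h1 : s'.card ≤ (s'.image (fun q => q.1.1)).card * (k + 1) := by
        have hinj : s'.card ≤ ((s'.image (fun q => q.1.1)) ×ˢ
            (Finset.univ : Finset (Fin (k + 1)))).card := by
          apply Finset.card_le_card_of_injOn (fun q => (q.1.1, q.2))
          · intro q hq
            have hq' : q ∈ s' := hq
            simp only [Finset.coe_product, Set.mem_prod, Finset.mem_coe, Finset.mem_univ,
              and_true]
            exact Finset.mem_image_of_mem _ hq'
          · rintro ⟨⟨a, ha⟩, b⟩ _ ⟨⟨c, hc⟩, d⟩ _ h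
            simpa using h
        simpa [Finset.card_product] using hinj
      have h2 : (s'.image (fun q => q.1.1)) ⊆ W := by
        intro x hx
        obtain ⟨q, _, rfl⟩ := Finset.mem_image.1 hx
        exact q.1.2
      have h3 := hP1 _ ((Finset.card_le_card h2).trans hWc)
      have h4 : N (s'.image (fun q => q.1.1)) ⊆ s'.biUnion (fun q => N {q.1.1}) := by
        intro p hp
        obtain ⟨x, hx, i, hi⟩ := (memN _ _).1 hp
        obtain ⟨q, hq, rfl⟩ := Finset.mem_image.1 hx
        exact Finset.mem_biUnion.2 ⟨q, hq, (memN _ _).2 ⟨_, Finset.mem_singleton_self _, i, hi⟩⟩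
      have h5 := Finset.card_le_card h4
      nlinarith)
  have hc : ∀ q : {x // x ∈ W} × Fin (k + 1), ∃ i, (i, Γ q.1.1 i) = f q := by
    intro q
    obtain ⟨x, hx, i, hi⟩ := (memN _ _).1 (hfN q)
    rw [Finset.mem_singleton] at hx
    subst hx
    exact ⟨i, hi⟩
  choose c hc using hc
  have cinj : ∀ x : {x // x ∈ W}, Function.Injective (fun j => c (x, j)) := by
    intro x j j' h
    have h' : c (x, j) = c (x, j') := h
    have h2 : f (x, j) = f (x, j') := by
      rw [← hc, ← hc, h']
    simpa using hf h2
  have ccard : ∀ x : {x // x ∈ W}, (Finset.univ.image (fun j => c (x, j))).card = k + 1 := by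
    intro x
    rw [Finset.card_image_of_injective _ (cinj x)]
    simp
  classical
  refine ⟨fun i v => decide (∃ q, q.1.1 ∈ S ∧ f q = (i, v)), ?_⟩
  intro x
  simp only [decide_eq_true_eq]
  constructor
  · intro hx
    by_contra hxS
    by_cases hxW : x ∈ W
    · have hdis : Disjoint (Finset.univ.filter
          (fun i => ∃ q : {x // x ∈ W} × Fin (k + 1), q.1.1 ∈ S ∧ f q = (i, Γ x i)))
          (Finset.univ.image (fun j => c (⟨x, hxW⟩, j))) := by
        rw [Finset.disjoint_left]
        intro i hi hi'
        obtain ⟨q, hqS, hq⟩ := (Finset.mem_filter.1 hi).2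
        obtain ⟨j, _, rfl⟩ := Finset.mem_image.1 hi'
        have h6 := hf (hq.trans (hc (⟨x, hxW⟩, j)))
        subst h6
        exact hxS hqS
      have h7 := Finset.card_le_univ (Finset.disjUnion _ _ hdis)
      rw [Finset.card_disjUnion, ccard, Fintype.card_fin] at h7
      omega
    · apply hxW
      rw [hW, Finset.mem_union]
      by_cases hxS' : x ∈ S'
      · exact Or.inl hxS'
      right
      rw [hT, Finset.mem_filter]
      refine ⟨by simpa using hxS', hx.trans (Nat.mul_le_mul_left 2 ?_)⟩
      apply Finset.card_le_card_of_injOn (fun i => (i, Γ x i))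
      · intro i hi
        obtain ⟨q, hqS, hq⟩ := (Finset.mem_filter.1 (Finset.mem_coe.1 hi)).2
        refine Finset.mem_coe.2 (Finset.mem_inter.2 ⟨(memN _ _).2 ⟨x, by simp, i, rfl⟩, ?_⟩)
        exact (memN _ _).2 ⟨q.1.1, hSS' hqS, c q, (hc q).trans hq⟩
      · intro i _ j _ h
        exact (Prod.ext_iff.1 h).1
  · intro hx
    have hxW : x ∈ W := Finset.mem_union_left _ (hSS' hx)
    have h8 : Finset.univ.image (fun j => c (⟨x, hxW⟩, j)) ⊆ Finset.univ.filter
          (fun i => ∃ q : {x // x ∈ W} × Fin (k + 1), q.1.1 ∈ S ∧ f q = (i, Γ x i)) := by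
      intro i hi
      obtain ⟨j, _, rfl⟩ := Finset.mem_image.1 hi
      exact Finset.mem_filter.2 ⟨Finset.mem_univ _, (⟨x, hxW⟩, j), hx, (hc (⟨x, hxW⟩, j)).symm⟩
    have h9 := Finset.card_le_card h8
    rw [ccard] at h9
    omega
end

section
/- For every odd integer t ≥ 5 there exists m₀ such that for all m ≥ m₀ and all n with 1 ≤ n ≤ m, setting s = ⌈60·m^{2/(t-1)}·n^{1-2/(t-1)}·lg(2m/n)⌉ and K = ⌈2n·lg(2m/n)⌉, there exists a map Γ : [m] × [t] → [s] such that, writing N(R) = {(i, Γ(x,i)) : x ∈ R, i ∈ [t]}: (P1) for every R ⊆ [m] with |R| ≤ n + K one has |N(R)| ≥ ((t+1)/2)·|R|, and (P2) for every S ⊆ [m] with |S| = n, |{y ∈ [m] \ S : |N({y}) ∩ N(S)| ≥ (t+1)/2}| ≤ K. -/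
def NBad {m t s : ℕ} (U W : Finset (Fin m)) (ρ : Fin m → ℕ) (k : ℕ) (Γ : Fin m → Fin t → Fin s) : Prop :=
  ∃ A : Finset (Fin m × Fin t), A ⊆ U ×ˢ Finset.univ ∧ A.card = k ∧
    ∀ e ∈ A, ∃ x ∈ W, ρ x < ρ e.1 ∧ Γ x e.2 = Γ e.1 e.2

open Classical in
theorem fixed_count {m t s : ℕ} (A : Finset (Fin m × Fin t)) (ρ : Fin m → ℕ)
    (w : A → Fin m) (hw : ∀ e, ρ (w e) < ρ e.1.1) :
    (Finset.univ.filter (fun Γ : Fin m → Fin t → Fin s =>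
      ∀ e : A, Γ (w e) e.1.2 = Γ e.1.1 e.1.2)).card * s ^ A.card ≤ s ^ (m * t) := by
  have h1 : (Finset.univ.filter (fun Γ : Fin m → Fin t → Fin s =>
      ∀ e : A, Γ (w e) e.1.2 = Γ e.1.1 e.1.2)).card ≤
      (Finset.univ : Finset ({e : Fin m × Fin t // e ∉ A} → Fin s)).card := by
    apply Finset.card_le_card_of_injOn (fun Γ e => Γ e.1.1 e.1.2) (by simp)
    intro Γ hΓ Γ' hΓ' h
    simp only [Finset.coe_filter, Finset.mem_univ, true_and, Set.mem_ofPred_eq] at hΓ hΓ'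
    have key : ∀ N : ℕ, ∀ x i, ρ x = N → Γ x i = Γ' x i := by
      intro N
      induction N using Nat.strong_induction_on with
      | _ N ih =>
        intro x i hx
        by_cases hA : (x, i) ∈ A
        · have a1 := hΓ ⟨(x, i), hA⟩
          have a2 := hΓ' ⟨(x, i), hA⟩
          have a3 := hw ⟨(x, i), hA⟩
          simp only at a1 a2 a3
          rw [← a1, ← a2]
          exact ih _ (hx ▸ a3) _ _ rfl
        · exact congrFun h ⟨(x, i), hA⟩
    funext x i
    exact key _ x i rfl
  have h2 : (Finset.univ : Finset ({e : Fin m × Fin t // e ∉ A} → Fin s)).card * s ^ A.card = s ^ (m * t) := by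
    have hle : A.card ≤ m * t := by
      have := Finset.card_le_univ A
      simpa using this
    rw [Finset.card_univ, Fintype.card_fun, Fintype.card_subtype_compl]
    simp only [Fintype.card_fin, Fintype.card_prod, Fintype.card_coe]
    rw [← pow_add, Nat.sub_add_cancel hle]
  calc _ ≤ _ := Nat.mul_le_mul_right _ h1
    _ = _ := h2

open Classical in
theorem bad_count {m t s : ℕ} (U W : Finset (Fin m)) (ρ : Fin m → ℕ) (k : ℕ) :
    (Finset.univ.filter (fun Γ : Fin m → Fin t → Fin s => NBad U W ρ k Γ)).card * s ^ k ≤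
      2 ^ (t * U.card) * W.card ^ k * s ^ (m * t) := by
  set F : (A : Finset (Fin m × Fin t)) → (A → W) → Finset (Fin m → Fin t → Fin s) := fun A w =>
    Finset.univ.filter (fun Γ => (∀ e : A, ρ (w e) < ρ e.1.1) ∧ ∀ e : A, Γ (w e) e.1.2 = Γ e.1.1 e.1.2)
    with hF
  have hsub : (Finset.univ.filter (fun Γ : Fin m → Fin t → Fin s => NBad U W ρ k Γ)) ⊆
      (Finset.powersetCard k (U ×ˢ Finset.univ)).biUnion
        (fun A => (Finset.univ : Finset (A → W)).biUnion (F A)) := by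
    intro Γ hΓ
    simp only [Finset.mem_filter, Finset.mem_univ, true_and] at hΓ
    obtain ⟨A, hA, hk, hw⟩ := hΓ
    choose w hw1 hw2 hw3 using hw
    simp only [Finset.mem_biUnion, Finset.mem_powersetCard]
    refine ⟨A, ⟨hA, hk⟩, fun e => ⟨w e.1 e.2, hw1 _ _⟩, Finset.mem_univ _, ?_⟩
    simp only [hF, Finset.mem_filter, Finset.mem_univ, true_and]
    exact ⟨fun e => hw2 _ _, fun e => hw3 _ _⟩
  have hFc : ∀ A ∈ Finset.powersetCard k (U ×ˢ (Finset.univ : Finset (Fin t))), ∀ w, (F A w).card * s ^ k ≤ s ^ (m * t) := by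
    intro A hA w
    have hk := (Finset.mem_powersetCard.1 hA).2
    by_cases h : ∀ e : A, ρ (w e) < ρ e.1.1
    · have := fixed_count (s := s) A ρ (fun e => (w e).1) h
      rw [hk] at this
      refine le_trans (Nat.mul_le_mul_right _ (Finset.card_le_card ?_)) this
      intro Γ hΓ
      simp only [hF, Finset.mem_filter, Finset.mem_univ, true_and] at hΓ ⊢
      exact hΓ.2
    · have : F A w = ∅ := by
        simp only [hF]
        apply Finset.filter_false_of_mem
        intro x _ hx
        exact h hx.1
      simp [this]
  have hA2 : ∀ A ∈ Finset.powersetCard k (U ×ˢ (Finset.univ : Finset (Fin t))),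
      ((Finset.univ : Finset (A → W)).biUnion (F A)).card * s ^ k ≤ W.card ^ k * s ^ (m * t) := by
    intro A hA
    have hk := (Finset.mem_powersetCard.1 hA).2
    calc _ ≤ (∑ w : A → W, (F A w).card) * s ^ k := Nat.mul_le_mul_right _ Finset.card_biUnion_le
      _ = ∑ w : A → W, (F A w).card * s ^ k := Finset.sum_mul _ _ _
      _ ≤ ∑ w : A → W, s ^ (m * t) := Finset.sum_le_sum (fun w _ => hFc A hA w)
      _ = _ := by simp [hk]
  calc _ ≤ (∑ A ∈ Finset.powersetCard k (U ×ˢ (Finset.univ : Finset (Fin t))),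
        ((Finset.univ : Finset (A → W)).biUnion (F A)).card) * s ^ k :=
        Nat.mul_le_mul_right _ ((Finset.card_le_card hsub).trans Finset.card_biUnion_le)
    _ = _ := Finset.sum_mul _ _ _
    _ ≤ ∑ A ∈ Finset.powersetCard k (U ×ˢ (Finset.univ : Finset (Fin t))), W.card ^ k * s ^ (m * t) :=
        Finset.sum_le_sum hA2
    _ = (Nat.choose (U.card * t) k) * (W.card ^ k * s ^ (m * t)) := by simp
    _ ≤ 2 ^ (t * U.card) * (W.card ^ k * s ^ (m * t)) := by
        apply Nat.mul_le_mul_right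
        rw [mul_comm t]
        exact Nat.choose_le_two_pow _ _
    _ = _ := by ring

/-- failing P1 gives NBad -/
theorem p1_bad {m a s : ℕ} (Γ : Fin m → Fin (2*a+1) → Fin s) (R : Finset (Fin m))
    (h : ¬ (2*a+1 + 1) * R.card ≤
            2 * (R.biUnion (fun x => Finset.univ.image (fun i : Fin (2*a+1) => (i, Γ x i)))).card) :
    NBad R R (fun x => x.1) (a * R.card) Γ := by
  classical
  set A := (R ×ˢ (Finset.univ : Finset (Fin (2*a+1)))).filter
    (fun e => ∃ x ∈ R, x.1 < e.1.1 ∧ Γ x e.2 = Γ e.1 e.2) with hA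
  set B := (R ×ˢ (Finset.univ : Finset (Fin (2*a+1)))).filter
    (fun e => ¬ ∃ x ∈ R, x.1 < e.1.1 ∧ Γ x e.2 = Γ e.1 e.2) with hB
  have hAB : A.card + B.card = R.card * (2*a+1) := by
    rw [hA, hB, Finset.card_filter_add_card_filter_not]; simp
  have hBc : B.card ≤ (R.biUnion (fun x => Finset.univ.image (fun i : Fin (2*a+1) => (i, Γ x i)))).card := by
    apply Finset.card_le_card_of_injOn (fun e => (e.2, Γ e.1 e.2))
    · intro e he
      simp only [hB, Finset.coe_filter, Set.mem_ofPred_eq, Finset.mem_product] at he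
      simp only [Finset.coe_biUnion, Set.mem_iUnion]
      exact ⟨e.1, he.1.1, by simp⟩
    · rintro ⟨x, i⟩ he ⟨y, j⟩ hf hef
      simp only [hB, Finset.coe_filter, Set.mem_ofPred_eq, Finset.mem_product] at he hf
      simp only [Prod.mk.injEq] at hef
      obtain ⟨rfl, h2⟩ := hef
      rcases lt_trichotomy x.1 y.1 with h | h | h
      · exact absurd ⟨x, he.1.1, h, h2⟩ hf.2
      · rw [Fin.ext h]
      · exact absurd ⟨y, hf.1.1, h, h2.symm⟩ he.2
  have hc : a * R.card ≤ A.card := by nlinarith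
  obtain ⟨A', hA', hk⟩ := Finset.exists_subset_card_eq hc
  refine ⟨A', hA'.trans (Finset.filter_subset _ _), hk, fun e he => ?_⟩
  exact (Finset.mem_filter.1 (hA' he)).2

open Classical in
theorem p2_bad {m a s K : ℕ} (Γ : Fin m → Fin (2*a+1) → Fin s) (S : Finset (Fin m))
    (h : ¬ ((Finset.univ \ S).filter (fun y : Fin m =>
              2*a+1 + 1 ≤ 2 *
                (((({y} : Finset (Fin m)).biUnion
                      (fun x => Finset.univ.image (fun i : Fin (2*a+1) => (i, Γ x i)))) ∩
                  (S.biUnion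
                      (fun x => Finset.univ.image (fun i : Fin (2*a+1) => (i, Γ x i))))).card))).card
            ≤ K) :
    ∃ Y : Finset (Fin m), Y.card = K + 1 ∧
      NBad Y S (fun x => if x ∈ S then 0 else 1) (a * (K+1)) Γ := by
  obtain ⟨Y, hY, hk⟩ := Finset.exists_subset_card_eq (not_le.1 h)
  refine ⟨Y, hk, ?_⟩
  set T : Fin m → Finset (Fin (2*a+1)) := fun y => Finset.univ.filter (fun i => ∃ x ∈ S, Γ x i = Γ y i) with hT
  have hTc : ∀ y ∈ Y, a ≤ (T y).card := by
    intro y hy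
    have h1 := (Finset.mem_filter.1 (hY hy)).2
    have h2 : ((({y} : Finset (Fin m)).biUnion
                      (fun x => Finset.univ.image (fun i : Fin (2*a+1) => (i, Γ x i)))) ∩
                  (S.biUnion
                      (fun x => Finset.univ.image (fun i : Fin (2*a+1) => (i, Γ x i))))) ⊆
                (T y).image (fun i => (i, Γ y i)) := by
      rintro ⟨i, g⟩ hg
      simp only [Finset.mem_inter, Finset.mem_biUnion, Finset.mem_singleton, Finset.mem_image,
        Finset.mem_univ, true_and, Prod.mk.injEq] at hg
      obtain ⟨⟨_, rfl, _, rfl, rfl⟩, x, hx, _, rfl, hh⟩ := hg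
      simp only [Finset.mem_image, hT, Finset.mem_filter, Finset.mem_univ, true_and]
      exact ⟨_, ⟨x, hx, hh⟩, rfl⟩
    have h3 := (Finset.card_le_card h2).trans Finset.card_image_le
    omega
  have hex : ∀ y, ∃ T' : Finset (Fin (2*a+1)), y ∈ Y → T' ⊆ T y ∧ T'.card = a := by
    intro y
    by_cases hy : y ∈ Y
    · obtain ⟨T', h1, h2⟩ := Finset.exists_subset_card_eq (hTc y hy)
      exact ⟨T', fun _ => ⟨h1, h2⟩⟩
    · exact ⟨∅, fun h => absurd h hy⟩
  choose T' hT' using hex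
  refine ⟨(Y.sigma T').map (Equiv.sigmaEquivProd _ _).toEmbedding, ?_, ?_, ?_⟩
  · rintro ⟨y, i⟩ he
    simp at he
    simp [he.1]
  · rw [Finset.card_map, Finset.card_sigma, Finset.sum_congr rfl (fun y hy => (hT' y hy).2)]
    simp [hk, mul_comm]
  · rintro ⟨y, i⟩ he
    simp at he
    have h1 := (hT' y he.1).1 he.2
    simp only [hT, Finset.mem_filter, Finset.mem_univ, true_and] at h1
    obtain ⟨x, hx, hh⟩ := h1
    have hyS : y ∉ S := by
      have := (Finset.mem_filter.1 (hY he.1)).1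
      simpa using this
    exact ⟨x, hx, by simp [hx, hyS], hh⟩

theorem choose_bd (m r : ℕ) (hr : 1 ≤ r) : (m.choose r : ℝ) ≤ (3 * m / r) ^ r := by
  have h1 : (m.choose r : ℝ) ≤ (m:ℝ) ^ r / r.factorial := Nat.choose_le_pow_div r m
  have h2 : (r:ℝ) ^ r / r.factorial ≤ Real.exp r := Real.pow_div_factorial_le_exp r (by positivity) r
  have h3 : Real.exp r ≤ 3 ^ r := by
    rw [← Real.exp_one_pow]
    gcongr
    exact Real.exp_one_lt_three.le
  have h4 : (0:ℝ) < r.factorial := by positivity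
  have hr' : (0:ℝ) < r := by positivity
  have h5 : (r:ℝ)^r ≤ 3 ^ r * r.factorial := (div_le_iff₀ h4).1 (h2.trans h3)
  refine h1.trans ?_
  rw [div_pow, mul_pow, div_le_div_iff₀ h4 (by positivity)]
  nlinarith [mul_le_mul_of_nonneg_left h5 (by positivity : (0:ℝ) ≤ (m:ℝ)^r)]

/-- Main numeric inequality from the choice of `s`. -/
theorem s_bd (a m n s : ℕ) (L : ℝ) (ha : 2 ≤ a) (hm : 1 ≤ m) (hn : 1 ≤ n) (hL : 1 ≤ L)
    (hs : (60 : ℝ) * (m : ℝ) ^ ((2 : ℝ) / (((2*a+1 : ℕ) : ℝ) - 1)) *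
            (n : ℝ) ^ ((1 : ℝ) - (2 : ℝ) / (((2*a+1 : ℕ) : ℝ) - 1)) * L ≤ s) :
    (m:ℝ) * (15 * n * L) ^ a * 4 ^ a ≤ n * (s:ℝ) ^ a := by
  have ha0 : (a:ℝ) ≠ 0 := by positivity
  have e : (2 : ℝ) / (((2*a+1 : ℕ) : ℝ) - 1) = 1 / a := by push_cast; field_simp; ring
  rw [e] at hs
  have hm' : (0:ℝ) < m := by positivity
  have hn' : (0:ℝ) < n := by positivity
  have h1 := pow_le_pow_left₀ (by positivity) hs a
  have h2 : ((m:ℝ) ^ (1 / (a:ℝ))) ^ a = m := by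
    rw [← Real.rpow_natCast, ← Real.rpow_mul hm'.le]; field_simp; simp
  have h3 : n * ((n:ℝ) ^ (1 - 1 / (a:ℝ))) ^ a = (n:ℝ) ^ a := by
    rw [← Real.rpow_natCast, ← Real.rpow_mul hn'.le]
    nth_rewrite 1 [← Real.rpow_one (n:ℝ)]
    rw [← Real.rpow_add hn', ← Real.rpow_natCast]
    congr 1
    field_simp; ring
  rw [mul_pow, mul_pow, mul_pow, h2] at h1
  calc (m:ℝ) * (15 * n * L) ^ a * 4 ^ a = (60 ^ a * m * L ^ a) * (n:ℝ)^a := by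
        rw [show (60:ℝ) = 15 * 4 by norm_num]; simp only [mul_pow]; ring
    _ = n * (60 ^ a * m * ((n:ℝ) ^ (1 - 1 / (a:ℝ))) ^ a * L ^ a) := by rw [← h3]; ring
    _ ≤ _ := by gcongr

/-- base bound for P1 -/
theorem q1_bd (a m n s r : ℕ) (L : ℝ) (ha : 2 ≤ a) (hm : 1 ≤ m) (hn : 1 ≤ n) (hL : 1 ≤ L) (hs0 : 1 ≤ s)
    (H : (m:ℝ) * (15 * n * L) ^ a * 4 ^ a ≤ n * (s:ℝ) ^ a) (hr : 1 ≤ r) (hr4 : (r:ℝ) ≤ 4 * n * L) :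
    (3 * m / r) * 2 ^ (2*a+1) * ((r:ℝ) / s) ^ a ≤ 1 / 4 := by
  have hm' : (0:ℝ) < m := by positivity
  have hn' : (0:ℝ) < n := by positivity
  have hs' : (0:ℝ) < s := by positivity
  have hr' : (0:ℝ) < r := by positivity
  have hL' : (0:ℝ) < L := by linarith
  obtain ⟨b, rfl⟩ : ∃ b, a = b + 2 := ⟨a - 2, by omega⟩
  set x : ℝ := r / (15 * n * L) with hx
  have hx0 : 0 ≤ x := by positivity
  have hx1 : x ≤ 4 / 15 := by rw [hx, div_le_iff₀ (by positivity)]; nlinarith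
  have hrx : (r:ℝ) = x * (15 * n * L) := by rw [hx]; field_simp
  have hxb : x ^ b ≤ 1 := pow_le_one₀ hx0 (by linarith)
  have hxb1 : x ^ (b+1) ≤ 4 / 15 := by rw [pow_succ]; nlinarith [pow_nonneg hx0 b]
  have key : (m:ℝ) * (4 * r) ^ (b+2) ≤ x ^ (b+2) * n * s ^ (b+2) := by
    calc _ = x ^ (b+2) * ((m:ℝ) * (15 * n * L) ^ (b+2) * 4 ^ (b+2)) := by rw [hrx]; simp only [mul_pow]; ring
      _ ≤ x ^ (b+2) * (n * (s:ℝ) ^ (b+2)) := by gcongr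
      _ = _ := by ring
  have h2 : x ^ (b+2) * n ≤ r * (4 / 225) := by
    have h0 : x * n = r / (15 * L) := by rw [hx]; field_simp
    have h1 : (r:ℝ) / (15 * L) ≤ r / 15 := by gcongr; linarith
    calc x ^ (b+2) * n = x ^ (b+1) * (x * n) := by ring
      _ ≤ (4/15) * (r / 15) := by rw [h0]; gcongr
      _ = _ := by ring
  have h5 : (m:ℝ) * (4 * r) ^ (b+2) ≤ r * (4/225) * s ^ (b+2) := key.trans (by gcongr)
  have e2 : (2:ℝ) ^ (2*(b+2)+1) = 2 * 4 ^ (b+2) := by rw [pow_succ, pow_mul]; norm_num; ring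
  calc _ = 6 * ((m:ℝ) * (4 * r) ^ (b+2)) / (r * s ^ (b+2)) := by
        rw [e2, div_pow, mul_pow]; field_simp; ring
    _ ≤ 6 * (r * (4/225) * s ^ (b+2)) / (r * s ^ (b+2)) := by gcongr
    _ = 24 / 225 := by field_simp; norm_num
    _ ≤ _ := by norm_num

theorem q2_bd (a m n s k : ℕ) (L : ℝ) (ha : 2 ≤ a) (hm : 1 ≤ m) (hn : 1 ≤ n) (hL : 1 ≤ L) (hs0 : 1 ≤ s)
    (H : (m:ℝ) * (15 * n * L) ^ a * 4 ^ a ≤ n * (s:ℝ) ^ a) (hk : 2 * (n:ℝ) ≤ k) :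
    (3 * m / k) * 2 ^ (2*a+1) * ((n:ℝ) / s) ^ a ≤ 1 / 8 := by
  have hm' : (0:ℝ) < m := by positivity
  have hn' : (0:ℝ) < n := by positivity
  have hs' : (0:ℝ) < s := by positivity
  have hk' : (0:ℝ) < k := by linarith
  have h15 : (225:ℝ) ≤ (15 * L) ^ a := by
    calc (225:ℝ) = 15 ^ 2 := by norm_num
      _ ≤ 15 ^ a := pow_le_pow_right₀ (by norm_num) ha
      _ ≤ _ := by gcongr; linarith
  have key : 225 * ((m:ℝ) * (4 * n) ^ a) ≤ n * s ^ a := by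
    calc _ ≤ (15 * L) ^ a * ((m:ℝ) * (4 * n) ^ a) := by gcongr
      _ = (m:ℝ) * (15 * n * L) ^ a * 4 ^ a := by simp only [mul_pow]; ring
      _ ≤ _ := H
  have e2 : (2:ℝ) ^ (2*a+1) = 2 * 4 ^ a := by rw [pow_succ, pow_mul]; norm_num; ring
  calc _ = 6 * ((m:ℝ) * (4 * n) ^ a) / (k * s ^ a) := by
        rw [e2, div_pow, mul_pow]; field_simp; ring
    _ ≤ 6 * (n * s ^ a / 225) / ((2 * n) * s ^ a) := by gcongr; linarith
    _ = 3 / 225 := by field_simp; norm_num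
    _ ≤ _ := by norm_num

open Classical in
theorem bad_count_real {m t s : ℕ} (hs : 1 ≤ s) (U W : Finset (Fin m)) (ρ : Fin m → ℕ) (a u v : ℕ)
    (hu : U.card = u) (hv : W.card = v) :
    ((Finset.univ.filter (fun Γ : Fin m → Fin t → Fin s => NBad U W ρ (a * u) Γ)).card : ℝ) ≤
      (2 ^ t * ((v:ℝ) / s) ^ a) ^ u * (s:ℝ) ^ (m * t) := by
  have hs' : (0:ℝ) < s := by positivity
  have h := bad_count (s := s) (t := t) U W ρ (a * u)
  rw [hu, hv] at h
  have h' : ((Finset.univ.filter (fun Γ : Fin m → Fin t → Fin s => NBad U W ρ (a * u) Γ)).card : ℝ) *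
      (s:ℝ) ^ (a * u) ≤ 2 ^ (t * u) * (v:ℝ) ^ (a * u) * (s:ℝ) ^ (m * t) := by exact_mod_cast h
  rw [← le_div_iff₀ (by positivity)] at h'
  refine h'.trans (le_of_eq ?_)
  rw [mul_pow, ← pow_mul, ← pow_mul, div_pow]
  ring

theorem geom_bd (N : ℕ) : ∑ r ∈ Finset.Icc 1 N, (1/4 : ℝ) ^ r ≤ 1 / 3 := by
  have : ∑ r ∈ Finset.Icc 1 N, (1/4 : ℝ) ^ r = (1 - (1/4)^N) / 3 := by
    induction N with
    | zero => simp
    | succ k ih => rw [Finset.sum_Icc_succ_top (by omega), ih]; ring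
  rw [this]
  have : (0:ℝ) ≤ (1/4)^N := by positivity
  linarith

theorem exists_good (a m n s K : ℕ) (L : ℝ) (ha : 2 ≤ a) (hm : 1 ≤ m) (hn : 1 ≤ n) (hnm : n ≤ m)
    (hL : 1 ≤ L) (hs0 : 1 ≤ s) (hLe : L = Real.logb 2 (2 * m / n))
    (H : (m:ℝ) * (15 * n * L) ^ a * 4 ^ a ≤ n * (s:ℝ) ^ a)
    (hK1 : 2 * n * L ≤ K) (hK2 : (K:ℝ) ≤ 2 * n * L + 1) :
    ∃ Γ : Fin m → Fin (2*a+1) → Fin s,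
      (∀ R : Finset (Fin m), 1 ≤ R.card → R.card ≤ n + K →
        ¬ NBad R R (fun x => x.1) (a * R.card) Γ) ∧
      (∀ S Y : Finset (Fin m), S.card = n → Y.card = K + 1 →
        ¬ NBad Y S (fun x => if x ∈ S then 0 else 1) (a * (K+1)) Γ) := by
  classical
  have hm' : (0:ℝ) < m := by positivity
  have hn' : (0:ℝ) < n := by positivity
  have hn1 : (1:ℝ) ≤ n := by exact_mod_cast hn
  have hs' : (0:ℝ) < s := by positivity
  by_contra hcon
  push Not at hcon
  set T : ℝ := (s:ℝ) ^ (m * (2*a+1)) with hT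
  have hT0 : 0 < T := by positivity
  set B1 : Finset (Fin m → Fin (2*a+1) → Fin s) :=
    (Finset.Icc 1 (n+K)).biUnion (fun r => (Finset.powersetCard r Finset.univ).biUnion (fun R =>
      Finset.univ.filter (fun Γ => NBad R R (fun x => x.1) (a * r) Γ))) with hB1
  set B2 : Finset (Fin m → Fin (2*a+1) → Fin s) :=
    (Finset.powersetCard n Finset.univ).biUnion (fun S =>
     (Finset.powersetCard (K+1) Finset.univ).biUnion (fun Y =>
      Finset.univ.filter (fun Γ => NBad Y S (fun x => if x ∈ S then 0 else 1) (a * (K+1)) Γ))) with hB2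
  have hcov : (Finset.univ : Finset (Fin m → Fin (2*a+1) → Fin s)) ⊆ B1 ∪ B2 := by
    intro Γ _
    rw [Finset.mem_union]
    by_cases h1 : ∀ R : Finset (Fin m), 1 ≤ R.card → R.card ≤ n + K →
        ¬ NBad R R (fun x => x.1) (a * R.card) Γ
    · right
      obtain ⟨S, Y, hS, hY, hb⟩ := hcon Γ h1
      simp only [hB2, Finset.mem_biUnion, Finset.mem_powersetCard, Finset.mem_filter,
        Finset.mem_univ, true_and]
      refine ⟨S, ⟨Finset.subset_univ _, hS⟩, Y, ⟨Finset.subset_univ _, hY⟩, ?_⟩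
      convert hb
    · left
      push Not at h1
      obtain ⟨R, h1, h2, hb⟩ := h1
      simp only [hB1, Finset.mem_biUnion, Finset.mem_powersetCard, Finset.mem_filter,
        Finset.mem_univ, true_and, Finset.mem_Icc]
      exact ⟨R.card, ⟨h1, h2⟩, R, ⟨Finset.subset_univ _, rfl⟩, hb⟩
  have hcard : T ≤ (B1.card : ℝ) + B2.card := by
    have := (Finset.card_le_card hcov).trans (Finset.card_union_le _ _)
    have h2 : (Finset.univ : Finset (Fin m → Fin (2*a+1) → Fin s)).card = s ^ (m * (2*a+1)) := by
      simp [← pow_mul, mul_comm]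
    rw [h2] at this
    rw [hT]
    exact_mod_cast this
  have hb1 : (B1.card : ℝ) ≤ 1 / 3 * T := by
    have step : (B1.card : ℝ) ≤ ∑ r ∈ Finset.Icc 1 (n+K),
        ∑ R ∈ Finset.powersetCard r (Finset.univ : Finset (Fin m)),
        ((Finset.univ.filter (fun Γ : Fin m → Fin (2*a+1) → Fin s => NBad R R (fun x => x.1) (a * r) Γ)).card : ℝ) := by
      have : B1.card ≤ ∑ r ∈ Finset.Icc 1 (n+K),
        ∑ R ∈ Finset.powersetCard r (Finset.univ : Finset (Fin m)),
        (Finset.univ.filter (fun Γ : Fin m → Fin (2*a+1) → Fin s => NBad R R (fun x => x.1) (a * r) Γ)).card :=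
        Finset.card_biUnion_le.trans (Finset.sum_le_sum fun r _ => Finset.card_biUnion_le)
      exact_mod_cast this
    refine step.trans ?_
    calc _ ≤ ∑ r ∈ Finset.Icc 1 (n+K), (1/4:ℝ) ^ r * T := by
          apply Finset.sum_le_sum
          intro r hr
          rw [Finset.mem_Icc] at hr
          have hr4 : (r:ℝ) ≤ 4 * n * L := by
            have : (r:ℝ) ≤ n + K := by exact_mod_cast hr.2
            nlinarith
          have q := q1_bd a m n s r L ha hm hn hL hs0 H hr.1 hr4
          calc _ ≤ ∑ R ∈ Finset.powersetCard r (Finset.univ : Finset (Fin m)),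
                (2 ^ (2*a+1) * ((r:ℝ) / s) ^ a) ^ r * T := by
                apply Finset.sum_le_sum
                intro R hR
                have hc := (Finset.mem_powersetCard.1 hR).2
                exact bad_count_real hs0 R R _ a r r hc hc
            _ = (m.choose r : ℝ) * ((2 ^ (2*a+1) * ((r:ℝ) / s) ^ a) ^ r * T) := by simp
            _ ≤ (3 * m / r) ^ r * ((2 ^ (2*a+1) * ((r:ℝ) / s) ^ a) ^ r * T) := by
                gcongr
                exact choose_bd m r hr.1
            _ = ((3 * m / r) * 2 ^ (2*a+1) * ((r:ℝ) / s) ^ a) ^ r * T := by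
                rw [← mul_assoc, ← mul_pow, mul_assoc]
            _ ≤ _ := by gcongr
      _ = (∑ r ∈ Finset.Icc 1 (n+K), (1/4:ℝ) ^ r) * T := by rw [Finset.sum_mul]
      _ ≤ _ := by gcongr; exact geom_bd _
  have hb2 : (B2.card : ℝ) ≤ 1 / 8 * T := by
    have step : (B2.card : ℝ) ≤ ∑ S ∈ Finset.powersetCard n (Finset.univ : Finset (Fin m)),
        ∑ Y ∈ Finset.powersetCard (K+1) (Finset.univ : Finset (Fin m)),
        ((Finset.univ.filter (fun Γ : Fin m → Fin (2*a+1) → Fin s => NBad Y S (fun x => if x ∈ S then 0 else 1) (a * (K+1)) Γ)).card : ℝ) := by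
      have : B2.card ≤ ∑ S ∈ Finset.powersetCard n (Finset.univ : Finset (Fin m)),
        ∑ Y ∈ Finset.powersetCard (K+1) (Finset.univ : Finset (Fin m)),
        (Finset.univ.filter (fun Γ : Fin m → Fin (2*a+1) → Fin s => NBad Y S (fun x => if x ∈ S then 0 else 1) (a * (K+1)) Γ)).card :=
        Finset.card_biUnion_le.trans (Finset.sum_le_sum fun r _ => Finset.card_biUnion_le)
      exact_mod_cast this
    refine step.trans ?_
    have hk : 2 * (n:ℝ) ≤ ((K+1 : ℕ) : ℝ) := by push_cast; nlinarith
    have q := q2_bd a m n s (K+1) L ha hm hn hL hs0 H hk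
    have hcn : (m.choose n : ℝ) ≤ 2 ^ K := by
      have hmn : (1:ℝ) ≤ m / n := by rw [le_div_iff₀ hn']; simpa using (by exact_mod_cast hnm : (n:ℝ) ≤ m)
      calc (m.choose n : ℝ) ≤ (3 * m / n) ^ n := choose_bd m n hn
        _ ≤ ((2 * m / n) ^ 2) ^ n := by
            gcongr
            rw [mul_div_assoc, mul_div_assoc]
            nlinarith
        _ = (2:ℝ) ^ (2 * n * L) := by
            have : (2 * m / n : ℝ) = (2:ℝ) ^ L := by
              rw [hLe, Real.rpow_logb (by norm_num) (by norm_num) (by positivity)]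
            rw [this, ← pow_mul, ← Real.rpow_natCast, ← Real.rpow_mul (by norm_num)]
            congr 1
            push_cast; ring
        _ ≤ (2:ℝ) ^ (K:ℝ) := Real.rpow_le_rpow_of_exponent_le (by norm_num) hK1
        _ = _ := Real.rpow_natCast _ _
    calc _ ≤ ∑ S ∈ Finset.powersetCard n (Finset.univ : Finset (Fin m)),
        ∑ Y ∈ Finset.powersetCard (K+1) (Finset.univ : Finset (Fin m)),
          (2 ^ (2*a+1) * ((n:ℝ) / s) ^ a) ^ (K+1) * T := by
          apply Finset.sum_le_sum
          intro S hS
          apply Finset.sum_le_sum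
          intro Y hY
          exact bad_count_real hs0 Y S _ a (K+1) n (Finset.mem_powersetCard.1 hY).2 (Finset.mem_powersetCard.1 hS).2
      _ = (m.choose n : ℝ) * ((m.choose (K+1) : ℝ) * ((2 ^ (2*a+1) * ((n:ℝ) / s) ^ a) ^ (K+1) * T)) := by simp
      _ ≤ 2 ^ K * ((3 * m / (K+1 : ℕ)) ^ (K+1) * ((2 ^ (2*a+1) * ((n:ℝ) / s) ^ a) ^ (K+1) * T)) := by
          gcongr
          exact choose_bd m (K+1) (by omega)
      _ = 2 ^ K * ((3 * m / (K+1 : ℕ)) * 2 ^ (2*a+1) * ((n:ℝ) / s) ^ a) ^ (K+1) * T := by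
          simp only [mul_pow]; ring
      _ ≤ 2 ^ K * (1 / 8) ^ (K+1) * T := by gcongr
      _ = (1 / 4) ^ K * (1 / 8) * T := by
          rw [pow_succ, ← mul_assoc, ← mul_pow]; norm_num
      _ ≤ 1 * (1 / 8) * T := by
          gcongr
          exact pow_le_one₀ (by norm_num) (by norm_num)
      _ = _ := by ring
  linarith


/-- For every odd `t ≥ 5` there is `m₀` such that for all `m ≥ m₀` and
`1 ≤ n ≤ m`, with `s = ⌈60·m^(2/(t-1))·n^(1-2/(t-1))·lg(2m/n)⌉` and
`K = ⌈2n·lg(2m/n)⌉`, there exists `Γ : [m] × [t] → [s]` satisfying the expansion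
property (P1) and the bounded-survivor property (P2), where
`N(R) = {(i, Γ(x,i)) : x ∈ R, i ∈ [t]}`.  The inequality `|N(R)| ≥ ((t+1)/2)·|R|`
is written as `(t+1)·|R| ≤ 2·|N(R)|`, and `|N({y}) ∩ N(S)| ≥ (t+1)/2` as
`t+1 ≤ 2·|N({y}) ∩ N(S)|`. -/
theorem admissible_graph_exists :
    ∀ t : ℕ, Odd t → 5 ≤ t →
    ∃ m₀ : ℕ, ∀ m : ℕ, m₀ ≤ m → ∀ n : ℕ, 1 ≤ n → n ≤ m →
    ∀ s K : ℕ,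
      s = ⌈(60 : ℝ) * (m : ℝ) ^ ((2 : ℝ) / ((t : ℝ) - 1)) *
            (n : ℝ) ^ ((1 : ℝ) - (2 : ℝ) / ((t : ℝ) - 1)) *
            Real.logb 2 ((2 * (m : ℝ)) / (n : ℝ))⌉₊ →
      K = ⌈(2 * (n : ℝ)) * Real.logb 2 ((2 * (m : ℝ)) / (n : ℝ))⌉₊ →
      ∃ Γ : Fin m → Fin t → Fin s,
        (∀ R : Finset (Fin m), R.card ≤ n + K →
          (t + 1) * R.card ≤
            2 * (R.biUnion (fun x => Finset.univ.image (fun i : Fin t => (i, Γ x i)))).card) ∧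
        (∀ S : Finset (Fin m), S.card = n →
          ((Finset.univ \ S).filter (fun y : Fin m =>
              t + 1 ≤ 2 *
                (((({y} : Finset (Fin m)).biUnion
                      (fun x => Finset.univ.image (fun i : Fin t => (i, Γ x i)))) ∩
                  (S.biUnion
                      (fun x => Finset.univ.image (fun i : Fin t => (i, Γ x i))))).card))).card
            ≤ K) := by
  intro t ht ht5
  obtain ⟨a, rfl⟩ := ht
  refine ⟨0, fun m _ n hn hnm s K hs hK => ?_⟩
  have hn' : (0:ℝ) < n := by positivity
  have hm : 1 ≤ m := hn.trans hnm
  have hm' : (0:ℝ) < m := by positivity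
  have ha : 2 ≤ a := by omega
  set L := Real.logb 2 ((2 * (m : ℝ)) / (n : ℝ)) with hLe
  have hL : 1 ≤ L := by
    rw [hLe, Real.le_logb_iff_rpow_le (by norm_num) (by positivity), Real.rpow_one,
      le_div_iff₀ hn']
    have : (n:ℝ) ≤ m := by exact_mod_cast hnm
    linarith
  have hs1 := Nat.le_ceil ((60 : ℝ) * (m : ℝ) ^ ((2 : ℝ) / (((2*a+1 : ℕ) : ℝ) - 1)) *
            (n : ℝ) ^ ((1 : ℝ) - (2 : ℝ) / (((2*a+1 : ℕ) : ℝ) - 1)) * L)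
  have hs0 : 1 ≤ s := by
    rw [hs]
    apply Nat.ceil_pos.2
    have : 0 < L := by linarith
    positivity
  rw [← hs] at hs1
  have hK1 := Nat.le_ceil ((2 * (n : ℝ)) * L)
  have hK2 := (Nat.ceil_lt_add_one (by positivity : 0 ≤ (2 * (n : ℝ)) * L)).le
  rw [← hK] at hK1 hK2
  obtain ⟨Γ, h1, h2⟩ := exists_good a m n s K L ha hm hn hnm hL hs0 hLe
    (s_bd a m n s L ha hm hn hL hs1) hK1 hK2
  refine ⟨Γ, fun R hR => ?_, fun S hS => ?_⟩
  · by_contra hc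
    have hR1 : 1 ≤ R.card := by
      by_contra h0
      have : R.card = 0 := by omega
      rw [this] at hc
      simp at hc
    exact h1 R hR1 hR (p1_bad Γ R hc)
  · by_contra hc
    obtain ⟨Y, hY, hb⟩ := p2_bad Γ S (by convert hc)
    exact h2 S Y hS hY (by convert hb)
end

section
/- For every ε ∈ (0,1) there exist C > 0 and m₀ such that for all m ≥ m₀, every odd integer t with 3 ≤ t ≤ (1/10)·lg lg m, and every n with 1 ≤ n ≤ m^{1-ε}, there exists an adaptive (m,n,s,t)-scheme with s ≤ C·exp(e^{2t})·m^{2/(t+1)}·n^{1-2/(t+1)}·lg m; that is, s(m,n,t) = O(exp(e^{2t})·m^{2/(t+1)}·n^{1-2/(t+1)}·lg m). -/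
/-- The sequence of bits read by an adaptive probe strategy: given memory
`M : Fin s → Bool` and a probe map `p : List Bool → Fin s` (giving the next
location to probe after having read a given sequence of bits), `readBits M p k`
is the list of the first `k` bits read. -/
def readBits {s : ℕ} (M : Fin s → Bool) (p : List Bool → Fin s) : ℕ → List Bool
  | 0 => []
  | k + 1 => readBits M p k ++ [M (p (readBits M p k))]


/-- Abstract adaptive reading. -/
def rbits (B : List Bool → Bool) : ℕ → List Bool
  | 0 => []
  | k + 1 => rbits B k ++ [B (rbits B k)]

theorem readBits_eq_rbits {s : ℕ} (M : Fin s → Bool) (p : List Bool → Fin s) (k : ℕ) :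
    readBits M p k = rbits (fun l => M (p l)) k := by
  induction k with
  | zero => rfl
  | succ k ih => simp [readBits, rbits, ih]

theorem rbits_length (B : List Bool → Bool) (k : ℕ) : (rbits B k).length = k := by
  induction k with
  | zero => rfl
  | succ k ih => simp [rbits, ih]

theorem rbits_add (B : List Bool → Bool) (q d : ℕ) :
    rbits B (q + d) = rbits B q ++ rbits (fun l => B (rbits B q ++ l)) d := by
  induction d with
  | zero => simp [rbits]
  | succ d ih =>
    rw [← Nat.add_assoc]
    simp only [rbits, ih, List.append_assoc]

theorem rbits_cons (B : List Bool → Bool) (d : ℕ) :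
    rbits B (d + 1) = B [] :: rbits (fun l => B (B [] :: l)) d := by
  rw [Nat.add_comm, rbits_add]
  simp [rbits]

theorem rbits_mem_iff (B : List Bool → Bool) (F : ℕ → Bool) (q : ℕ)
    (hB : ∀ l : List Bool, l.length < q → B l = F l.length) :
    rbits B q = (List.range q).map F := by
  induction q with
  | zero => rfl
  | succ q ih =>
    simp only [rbits]
    rw [ih (fun l hl => hB l (by omega)), List.range_succ, List.map_append]
    congr 1
    rw [hB _ (by simp)]
    simp

/-- The game lemma: if fewer than `d` nodes of a depth-`d` tree are lost, a player owning the
others can force the last bit. -/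
theorem game (d : ℕ) (hd : 1 ≤ d) : ∀ (Lost : Finset (List Bool)), Lost.card < d → ∀ v : Bool,
    ∃ σ : List Bool → Bool, (∀ l, l.length + 1 = d → σ l = v) ∧
      ∀ B : List Bool → Bool, (∀ l, l.length < d → l ∉ Lost → B l = σ l) →
        (rbits B d).getLast? = some v := by
  classical
  induction d, hd using Nat.le_induction with
  | base =>
    intro Lost hL v
    have : Lost = ∅ := by
      rw [← Finset.card_eq_zero]; omega
    subst this
    refine ⟨fun _ => v, fun _ _ => rfl, fun B hB => ?_⟩
    simp [rbits, hB [] (by simp) (by simp)]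
  | succ d hd ih =>
    intro Lost hL v
    let L : Bool → Finset (List Bool) := fun b =>
      (Lost.filter (fun l => l.head? = some b)).image List.tail
    have hmem : ∀ b l, b :: l ∈ Lost → l ∈ L b := by
      intro b l h
      simp only [L, Finset.mem_image, Finset.mem_filter]
      exact ⟨b :: l, ⟨h, rfl⟩, rfl⟩
    have hLe : ∀ b, (L b).card ≤ (Lost.filter (fun l => l.head? = some b)).card :=
      fun b => Finset.card_image_le
    have hsum : (Lost.filter (fun l => l.head? = some true)).card +
        (Lost.filter (fun l => l.head? = some false)).card +
        (Lost.filter (fun l => l = [])).card ≤ Lost.card := by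
      rw [← Finset.card_union_of_disjoint, ← Finset.card_union_of_disjoint]
      · apply Finset.card_le_card
        intro l hl
        simp only [Finset.mem_union, Finset.mem_filter] at hl
        tauto
      · rw [Finset.disjoint_left]
        intro l hl hl'
        simp only [Finset.mem_union, Finset.mem_filter] at hl hl'
        rw [hl'.2] at hl
        simp at hl
      · rw [Finset.disjoint_left]
        intro l hl hl'
        simp only [Finset.mem_filter] at hl hl'
        rw [hl'.2] at hl
        simp at hl
    -- a strategy on a subtree, good whenever possible
    have hstrat : ∀ b, ∃ σ : List Bool → Bool, (∀ l, l.length + 1 = d → σ l = v) ∧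
        ((L b).card < d → ∀ B : List Bool → Bool, (∀ l, l.length < d → l ∉ L b → B l = σ l) →
          (rbits B d).getLast? = some v) := by
      intro b
      by_cases h : (L b).card < d
      · obtain ⟨σ, h1, h2⟩ := ih (L b) h v
        exact ⟨σ, h1, fun _ => h2⟩
      · exact ⟨fun _ => v, fun _ _ => rfl, fun h' => absurd h' h⟩
    choose τ hτ1 hτ2 using hstrat
    have hlast : ∀ B : List Bool → Bool, ∀ w, (rbits (fun l => B (B [] :: l)) d).getLast? = some w →
        (rbits B (d + 1)).getLast? = some w := by
      intro B w h
      rw [rbits_cons, List.getLast?_cons, h]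
      rfl
    have key : ∃ b0 : Bool, ∀ b, ([] ∉ Lost → b = b0) → (L b).card < d := by
      by_cases hn : [] ∈ Lost
      · refine ⟨true, fun b _ => ?_⟩
        have : 0 < (Lost.filter (fun l => l = [])).card :=
          Finset.card_pos.mpr ⟨[], by simp [hn]⟩
        have h1 := hLe true
        have h2 := hLe false
        cases b <;> omega
      · by_cases h : (L true).card < d
        · exact ⟨true, fun b hb => by rw [hb hn]; exact h⟩
        · refine ⟨false, fun b hb => ?_⟩
          rw [hb hn]
          have h1 := hLe true
          have h2 := hLe false
          omega
    obtain ⟨b0, hb0⟩ := key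
    refine ⟨fun l => match l with | [] => b0 | b :: l => τ b l, ?_, ?_⟩
    · intro l hl
      match l with
      | [] => simp at hl; omega
      | b :: l => exact hτ1 b l (by simpa using hl)
    · intro B hB
      apply hlast
      apply hτ2 (B [])
      · apply hb0
        intro hn
        exact hB [] (by simp) hn
      · intro l hl hlx
        exact hB (B [] :: l) (by simpa using hl) (fun h => hlx (hmem _ _ h))

/-- `y` is hit by `S`: every filter cell and at least one tree cell of `y` is shared with `S`. -/
def Hit {U N : Type} {q s : ℕ} (h : U × (Fin q ⊕ N) → Fin s) (S : Finset U) (y : U) : Prop :=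
  (∀ i : Fin q, ∃ x ∈ S, h (x, Sum.inl i) = h (y, Sum.inl i)) ∧
    ∃ ν : N, ∃ x ∈ S, h (x, Sum.inr ν) = h (y, Sum.inr ν)

open Classical in
/-- The expansion property that makes the scheme work. -/
def Good {U N : Type} [Fintype N] {q s : ℕ} (n k : ℕ) (h : U × (Fin q ⊕ N) → Fin s) : Prop :=
  ∀ S : Finset U, S.card ≤ n → ∀ A : Finset U, (∀ y ∈ A, Hit h S y) →
    (Fintype.card N - k) * A.card ≤
      ((A ×ˢ (Finset.univ : Finset N)).image (fun z => (z.2, h (z.1, Sum.inr z.2)))).card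

/-- Tree nodes. -/
abbrev Nd (k : ℕ) : Type := {l : List Bool // l.length ≤ k}

noncomputable instance instFintypeNd (k : ℕ) : Fintype (Nd k) := by
  have : Finite (Nd k) := (List.finite_length_le Bool k).to_subtype
  exact Fintype.ofFinite _

theorem card_Nd_le (k : ℕ) : Fintype.card (Nd k) ≤ 3 ^ k := by
  have : Fintype.card (Nd k) ≤ Fintype.card (Fin k → Option Bool) := by
    apply Fintype.card_le_of_injective (fun (l : Nd k) (i : Fin k) => l.1[(i : ℕ)]?)
    intro l l' hll
    apply Subtype.ext
    apply List.ext_getElem?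
    intro i
    by_cases hi : i < k
    · exact congrFun hll ⟨i, hi⟩
    · rw [List.getElem?_eq_none (by have := l.2; omega),
        List.getElem?_eq_none (by have := l'.2; omega)]
  simpa using this

open Classical in
theorem exists_memory {U : Type} [Fintype U] {q k s n : ℕ}
    (h : U × (Fin q ⊕ Nd k) → Fin s) (hg : Good n k h) (S : Finset U) (hS : S.card ≤ n) :
    ∃ M : (Fin q ⊕ Nd k) × Fin s → Bool,
      (∀ i c, M (Sum.inl i, c) = true ↔ ∃ x ∈ S, h (x, Sum.inl i) = c) ∧
      (∀ x, Hit h S x → ∀ B : List Bool → Bool,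
        (∀ l (hl : l.length ≤ k), B l = M (Sum.inr ⟨l, hl⟩, h (x, Sum.inr ⟨l, hl⟩))) →
          (rbits B (k + 1)).getLast? = some (decide (x ∈ S))) ∧
      (∀ (l : Nd k) c, l.1.length = k → M (Sum.inr l, c) = true →
        ∃ x ∈ S, h (x, Sum.inr l) = c) := by
  set D := Fintype.card (Nd k) with hD
  let A : Finset U := Finset.univ.filter (fun y => Hit h S y)
  let tt : A × Fin (D - k) → Finset (Nd k × Fin s) := fun z =>
    (Finset.univ : Finset (Nd k)).image (fun ν => (ν, h (z.1.1, Sum.inr ν)))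
  have hall : ∀ R : Finset (A × Fin (D - k)), R.card ≤ (R.biUnion tt).card := by
    intro R
    let A' : Finset U := R.image (fun z => z.1.1)
    have h1 := hg S hS A' (by
      intro y hy
      simp only [A', Finset.mem_image] at hy
      obtain ⟨z, _, rfl⟩ := hy
      have := z.1.2
      simp only [A, Finset.mem_filter] at this
      exact this.2)
    have h2 : R.card ≤ (D - k) * A'.card := by
      have : R ⊆ (R.image Prod.fst) ×ˢ (Finset.univ : Finset (Fin (D - k))) := by
        intro z hz
        simp only [Finset.mem_product, Finset.mem_univ, and_true]
        exact Finset.mem_image_of_mem _ hz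
      have h3 := Finset.card_le_card this
      rw [Finset.card_product, Finset.card_univ, Fintype.card_fin] at h3
      have h4 : A'.card = (R.image Prod.fst).card := by
        rw [← Finset.card_image_of_injective (R.image Prod.fst) Subtype.val_injective,
          Finset.image_image]
        rfl
      rw [h4, mul_comm]
      exact h3
    refine h2.trans (h1.trans (Finset.card_le_card ?_))
    intro c hc
    simp only [Finset.mem_image, Finset.mem_product, A'] at hc
    obtain ⟨⟨y, ν⟩, ⟨⟨z, hz, hzy⟩, _⟩, rfl⟩ := hc
    rw [Finset.mem_biUnion]
    refine ⟨z, hz, ?_⟩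
    simp only [tt, Finset.mem_image]
    exact ⟨ν, Finset.mem_univ _, by simp only at hzy; rw [hzy]⟩
  obtain ⟨f, hinj, hf⟩ := (Finset.all_card_le_biUnion_card_iff_exists_injective tt).1 hall
  -- lost nodes
  let own : A → Finset (Nd k) := fun y => (Finset.univ : Finset (Fin (D - k))).image
    (fun j => (f (y, j)).1)
  have hfe : ∀ y j, f (y, j) = ((f (y, j)).1, h (y.1, Sum.inr (f (y, j)).1)) := by
    intro y j
    have := hf (y, j)
    simp only [tt, Finset.mem_image] at this
    obtain ⟨ν, _, hν⟩ := this
    rw [← hν]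
  have hown : ∀ y, (own y).card = D - k := by
    intro y
    simp only [own]
    rw [Finset.card_image_of_injective, Finset.card_univ, Fintype.card_fin]
    intro j j' hjj
    simp only at hjj
    have : f (y, j) = f (y, j') := by
      rw [hfe y j, hfe y j', hjj]
    simpa using hinj this
  let Lost : A → Finset (List Bool) := fun y => ((own y)ᶜ).image Subtype.val
  have hLost : ∀ y, (Lost y).card < k + 1 := by
    intro y
    have : (Lost y).card ≤ ((own y)ᶜ).card := Finset.card_image_le
    rw [Finset.card_compl, hown] at this
    omega
  have hgame := fun y : A => game (k + 1) (by omega) (Lost y) (hLost y) (decide (y.1 ∈ S))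
  choose σ hσ1 hσ2 using hgame
  let M : (Fin q ⊕ Nd k) × Fin s → Bool := fun z =>
    match z with
    | (Sum.inl i, c) => decide (∃ x ∈ S, h (x, Sum.inl i) = c)
    | (Sum.inr ν, c) => decide (∃ y : A, ∃ j, f (y, j) = (ν, c) ∧ σ y ν.1 = true)
  refine ⟨M, ?_, ?_, ?_⟩
  · intro i c
    simp [M]
  · intro x hx B hB
    have hxA : x ∈ A := by simp [A, hx]
    apply hσ2 ⟨x, hxA⟩
    intro l hl hlL
    have hl' : l.length ≤ k := by omega
    rw [hB l hl']
    have hmo : (⟨l, hl'⟩ : Nd k) ∈ own ⟨x, hxA⟩ := by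
      by_contra hno
      apply hlL
      simp only [Lost, Finset.mem_image]
      exact ⟨⟨l, hl'⟩, by simpa using hno, rfl⟩
    simp only [own, Finset.mem_image] at hmo
    obtain ⟨j, _, hj⟩ := hmo
    have hfj := hfe ⟨x, hxA⟩ j
    rw [hj] at hfj
    simp only [M]
    rw [Bool.eq_iff_iff, decide_eq_true_iff]
    constructor
    · rintro ⟨y, j', h1, h2⟩
      have := hinj (h1.trans hfj.symm)
      have hy : y = ⟨x, hxA⟩ := congrArg Prod.fst this
      rw [hy] at h2
      exact h2
    · intro h2
      exact ⟨⟨x, hxA⟩, j, hfj, h2⟩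
  · intro l c hl hM
    simp only [M, decide_eq_true_iff] at hM
    obtain ⟨y, j, h1, h2⟩ := hM
    rw [hσ1 y l.1 (by omega)] at h2
    refine ⟨y.1, by simpa using h2, ?_⟩
    have := hfe y j
    rw [h1] at this
    exact (congrArg Prod.snd this).symm

open Classical in
theorem scheme_of_good {m q k s n : ℕ} (hs : 0 < s)
    (h : Fin m × (Fin q ⊕ Nd k) → Fin s) (hg : Good n k h) :
    ∃ (p : Fin m → List Bool → Fin ((q + Fintype.card (Nd k)) * s)) (a : Fin m → List Bool → Bool)
        (φ : Finset (Fin m) → Fin ((q + Fintype.card (Nd k)) * s) → Bool),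
        ∀ S : Finset (Fin m), S.card ≤ n → ∀ x : Fin m,
          (a x (readBits (φ S) (p x) (q + (k + 1))) = true ↔ x ∈ S) := by
  have hcard : Fintype.card ((Fin q ⊕ Nd k) × Fin s) = (q + Fintype.card (Nd k)) * s := by simp
  let e : (Fin q ⊕ Nd k) × Fin s ≃ Fin ((q + Fintype.card (Nd k)) * s) :=
    Fintype.equivFinOfCardEq hcard
  have hmem := fun S : {S : Finset (Fin m) // S.card ≤ n} => exists_memory h hg S.1 S.2
  choose M hM1 hM2 hM3 using hmem
  let p0 : Fin m → List Bool → (Fin q ⊕ Nd k) × Fin s := fun x l =>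
    if hl : l.length < q then (Sum.inl ⟨l.length, hl⟩, h (x, Sum.inl ⟨l.length, hl⟩))
    else if hl' : (l.drop q).length ≤ k then
      (Sum.inr ⟨l.drop q, hl'⟩, h (x, Sum.inr ⟨l.drop q, hl'⟩))
    else (Sum.inr ⟨[], by simp⟩, ⟨0, hs⟩)
  refine ⟨fun x l => e (p0 x l),
    fun _ l => decide ((∀ b ∈ l.take q, b = true) ∧ l.getLast? = some true),
    fun S c => if hS : S.card ≤ n then M ⟨S, hS⟩ (e.symm c) else false, ?_⟩
  intro S hS x
  rw [readBits_eq_rbits]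
  simp only [hS, dif_pos, Equiv.symm_apply_apply, decide_eq_true_iff]
  set SS : {S : Finset (Fin m) // S.card ≤ n} := ⟨S, hS⟩
  set B : List Bool → Bool := fun l => M SS (p0 x l) with hBdef
  let F : ℕ → Bool := fun i => if hi : i < q then
    M SS (Sum.inl ⟨i, hi⟩, h (x, Sum.inl ⟨i, hi⟩)) else true
  have hF : rbits B q = (List.range q).map F := by
    apply rbits_mem_iff
    intro l hl
    simp [B, p0, F, hl]
  have hlenq : (rbits B q).length = q := rbits_length _ _
  set B' : List Bool → Bool := fun l => B (rbits B q ++ l) with hB'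
  have hB'eq : ∀ l (hl : l.length ≤ k),
      B' l = M SS (Sum.inr ⟨l, hl⟩, h (x, Sum.inr ⟨l, hl⟩)) := by
    intro l hl
    have h1 : ¬ (rbits B q ++ l).length < q := by simp [hlenq]
    have h2 : (rbits B q ++ l).drop q = l := by
      rw [List.drop_append_of_le_length (by omega), List.drop_of_length_le (by omega)]; simp
    simp only [B', B, p0]
    rw [dif_neg h1]
    have h3 : ((rbits B q ++ l).drop q).length ≤ k := by rw [h2]; exact hl
    rw [dif_pos h3]
    have h4 : (⟨(rbits B q ++ l).drop q, h3⟩ : Nd k) = ⟨l, hl⟩ := Subtype.ext h2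
    rw [h4]
  have hsplit : rbits B (q + (k + 1)) = rbits B q ++ rbits B' (k + 1) := rbits_add _ _ _
  have htake : (rbits B (q + (k + 1))).take q = rbits B q := by
    rw [hsplit, List.take_append_of_le_length (by omega), List.take_of_length_le (by omega)]
  have hlast : (rbits B (q + (k + 1))).getLast? = (rbits B' (k + 1)).getLast? := by
    rw [hsplit, List.getLast?_append_of_ne_nil]
    intro h0
    have := rbits_length B' (k + 1)
    rw [h0] at this
    simp at this
  rw [htake, hlast]
  have hfil : (∀ b ∈ rbits B q, b = true) ↔
      ∀ i : Fin q, ∃ z ∈ S, h (z, Sum.inl i) = h (x, Sum.inl i) := by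
    rw [hF]
    simp only [List.mem_map, List.mem_range]
    constructor
    · intro H i
      have := H (F i) ⟨i, i.2, rfl⟩
      simp only [F, i.2, dif_pos] at this
      exact (hM1 SS i _).1 this
    · rintro H b ⟨i, hi, rfl⟩
      simp only [F, hi, dif_pos]
      exact (hM1 SS ⟨i, hi⟩ _).2 (H ⟨i, hi⟩)
  rw [hfil]
  constructor
  · rintro ⟨H1, H2⟩
    by_cases hhit : Hit h S x
    · rw [hM2 SS x hhit B' hB'eq] at H2
      simpa using H2
    · exfalso
      have H3 : B' (rbits B' k) = true := by
        simpa [rbits] using H2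
      have hlk := rbits_length B' k
      rw [hB'eq _ hlk.le] at H3
      obtain ⟨z, hz, hz'⟩ := hM3 SS _ _ hlk H3
      exact hhit ⟨H1, _, z, hz, hz'⟩
  · intro hxS
    have hhit : Hit h S x :=
      ⟨fun i => ⟨x, hxS, rfl⟩, ⟨[], by simp⟩, x, hxS, rfl⟩
    refine ⟨hhit.1, ?_⟩
    rw [hM2 SS x hhit B' hB'eq]
    simpa [SS] using hxS

/-- Counting functions with prescribed coincidences. -/
theorem count_fixed {I : Type} [Fintype I] [DecidableEq I] {s : ℕ} (H : Finset I) (w : I → I)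
    (hw : ∀ i ∈ H, w i ∉ H) :
    (Finset.univ.filter (fun h : I → Fin s => ∀ i ∈ H, h i = h (w i))).card * s ^ H.card
      ≤ s ^ Fintype.card I := by
  classical
  have h1 : (Finset.univ.filter (fun h : I → Fin s => ∀ i ∈ H, h i = h (w i))).card
      ≤ (Finset.univ : Finset ({i // i ∉ H} → Fin s)).card := by
    apply Finset.card_le_card_of_injOn (fun h i => h i.1)
    · intro h _
      simp
    · intro h hh h' hh' he
      simp only [Finset.coe_filter, Finset.mem_univ, true_and, Set.mem_ofPred_eq] at hh hh'
      have key : ∀ i, i ∉ H → h i = h' i := fun i hi => congrFun he ⟨i, hi⟩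
      funext i
      by_cases hi : i ∈ H
      · rw [hh i hi, hh' i hi]
        exact key _ (hw i hi)
      · exact key i hi
  have h2 : (Finset.univ : Finset ({i // i ∉ H} → Fin s)).card = s ^ (Fintype.card I - H.card) := by
    rw [Finset.card_univ, Fintype.card_fun, Fintype.card_fin]
    congr 1
    rw [Fintype.card_subtype_compl]
    simp
  rw [h2] at h1
  calc _ ≤ s ^ (Fintype.card I - H.card) * s ^ H.card := Nat.mul_le_mul_right _ h1
    _ = s ^ Fintype.card I := by
      rw [← pow_add, Nat.sub_add_cancel (Finset.card_le_univ H)]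

open Classical in
/-- Union bound over coincidence patterns. -/
theorem count_patterns {I α : Type} [Fintype I] [DecidableEq I] {s : ℕ} (J : Finset α)
    (H : α → Finset I) (W : α → I → Finset I) (r K : ℕ)
    (hr : ∀ j ∈ J, (H j).card = r) (hK : ∀ j ∈ J, ∏ i ∈ H j, (W j i).card ≤ K) :
    (Finset.univ.filter (fun h : I → Fin s => ∃ j ∈ J, ∃ w : I → I,
      ∀ i ∈ H j, w i ∈ W j i ∧ w i ∉ H j ∧ h i = h (w i))).card * s ^ r
      ≤ J.card * K * s ^ Fintype.card I := by
  have h1 : (Finset.univ.filter (fun h : I → Fin s => ∃ j ∈ J, ∃ w : I → I,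
      ∀ i ∈ H j, w i ∈ W j i ∧ w i ∉ H j ∧ h i = h (w i))) ⊆
      J.biUnion (fun j => ((H j).pi (W j)).biUnion (fun v =>
        Finset.univ.filter (fun h : I → Fin s =>
          ∀ i (hi : i ∈ H j), v i hi ∉ H j ∧ h i = h (v i hi)))) := by
    intro h hh
    simp only [Finset.mem_filter, Finset.mem_univ, true_and] at hh
    obtain ⟨j, hj, w, hw⟩ := hh
    simp only [Finset.mem_biUnion, Finset.mem_filter, Finset.mem_univ, true_and, Finset.mem_pi]
    exact ⟨j, hj, fun i _ => w i, fun i hi => (hw i hi).1, fun i hi => (hw i hi).2⟩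
  have h2 : ∀ j ∈ J, ∀ v ∈ (H j).pi (W j), (Finset.univ.filter (fun h : I → Fin s =>
          ∀ i (hi : i ∈ H j), v i hi ∉ H j ∧ h i = h (v i hi))).card * s ^ r
          ≤ s ^ Fintype.card I := by
    intro j hj v _
    by_cases hv : ∀ i (hi : i ∈ H j), v i hi ∉ H j
    · have := count_fixed (s := s) (H j) (fun i => if hi : i ∈ H j then v i hi else i) (by
        intro i hi
        simp only [hi, dif_pos]
        exact hv i hi)
      rw [hr j hj] at this
      refine le_trans (Nat.mul_le_mul_right _ (Finset.card_le_card ?_)) this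
      intro h hh
      simp only [Finset.mem_filter, Finset.mem_univ, true_and] at hh ⊢
      intro i hi
      simp only [hi, dif_pos]
      exact (hh i hi).2
    · have : (Finset.univ.filter (fun h : I → Fin s =>
          ∀ i (hi : i ∈ H j), v i hi ∉ H j ∧ h i = h (v i hi))) = ∅ := by
        apply Finset.filter_eq_empty_iff.2
        intro h _ hc
        exact hv fun i hi => (hc i hi).1
      rw [this]
      simp
  calc _ ≤ (∑ j ∈ J, ∑ v ∈ (H j).pi (W j), (Finset.univ.filter (fun h : I → Fin s =>
          ∀ i (hi : i ∈ H j), v i hi ∉ H j ∧ h i = h (v i hi))).card) * s ^ r := by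
        apply Nat.mul_le_mul_right
        refine le_trans (Finset.card_le_card h1) (le_trans Finset.card_biUnion_le ?_)
        exact Finset.sum_le_sum fun j _ => Finset.card_biUnion_le
    _ = ∑ j ∈ J, ∑ v ∈ (H j).pi (W j), (Finset.univ.filter (fun h : I → Fin s =>
          ∀ i (hi : i ∈ H j), v i hi ∉ H j ∧ h i = h (v i hi))).card * s ^ r := by
        rw [Finset.sum_mul]
        exact Finset.sum_congr rfl fun j _ => Finset.sum_mul _ _ _
    _ ≤ ∑ j ∈ J, ∑ v ∈ (H j).pi (W j), s ^ Fintype.card I :=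
        Finset.sum_le_sum fun j hj => Finset.sum_le_sum fun v hv => h2 j hj v hv
    _ ≤ ∑ j ∈ J, K * s ^ Fintype.card I := by
        apply Finset.sum_le_sum
        intro j hj
        rw [Finset.sum_const, smul_eq_mul, Finset.card_pi]
        exact Nat.mul_le_mul_right _ (hK j hj)
    _ = _ := by rw [Finset.sum_const, smul_eq_mul, mul_assoc]

/-- Representatives for coincidences. -/
theorem exists_reps {I β : Type} [DecidableEq I] [DecidableEq β] (P Q : Finset I) (hPQ : P ⊆ Q)
    (Φ : I → β) : ∃ H ⊆ Q, ∃ w : I → I, H.card + (Q.image Φ).card = Q.card ∧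
      (∀ i ∈ H, w i ∈ Q ∧ w i ∉ H ∧ Φ (w i) = Φ i) ∧
      (∀ i ∈ Q, i ∉ P → Φ i ∈ P.image Φ → i ∈ H ∧ w i ∈ P) := by
  classical
  rcases Q.eq_empty_or_nonempty with rfl | ⟨i₀, hi₀⟩
  · exact ⟨∅, by simp, id, by simp, by simp, by simp⟩
  have hex : ∀ v : β, ∃ j : I, v ∈ Q.image Φ → (j ∈ Q ∧ Φ j = v ∧ (v ∈ P.image Φ → j ∈ P)) := by
    intro v
    by_cases hP : v ∈ P.image Φ
    · obtain ⟨j, hj, hji⟩ := Finset.mem_image.1 hP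
      exact ⟨j, fun _ => ⟨hPQ hj, hji, fun _ => hj⟩⟩
    · by_cases hv : v ∈ Q.image Φ
      · obtain ⟨i, hi, hiv⟩ := Finset.mem_image.1 hv
        exact ⟨i, fun _ => ⟨hi, hiv, fun h => absurd h hP⟩⟩
      · exact ⟨i₀, fun h => absurd h hv⟩
  choose r hr using hex
  have hsub : (Q.image Φ).image r ⊆ Q := by
    intro i hi
    obtain ⟨v, hv, rfl⟩ := Finset.mem_image.1 hi
    exact (hr v hv).1
  have hcard : ((Q.image Φ).image r).card = (Q.image Φ).card := by
    apply Finset.card_image_of_injOn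
    intro v hv v' hv' he
    rw [← (hr v hv).2.1, ← (hr v' hv').2.1]
    exact congrArg Φ he
  refine ⟨Q \ (Q.image Φ).image r, Finset.sdiff_subset, fun i => r (Φ i), ?_, ?_, ?_⟩
  · rw [← hcard]
    exact Finset.card_sdiff_add_card_eq_card hsub
  · intro i hi
    have hiQ := Finset.mem_image_of_mem Φ (Finset.mem_sdiff.1 hi).1
    refine ⟨(hr _ hiQ).1, ?_, (hr _ hiQ).2.1⟩
    intro hc
    exact (Finset.mem_sdiff.1 hc).2 (Finset.mem_image_of_mem r hiQ)
  · intro i hi hiP hΦ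
    have hiQ := Finset.mem_image_of_mem Φ hi
    refine ⟨Finset.mem_sdiff.2 ⟨hi, ?_⟩, (hr _ hiQ).2.2 hΦ⟩
    intro hc
    obtain ⟨v, hv, hvi⟩ := Finset.mem_image.1 hc
    have h1 := (hr v hv).2.1
    rw [hvi] at h1
    apply hiP
    rw [← hvi]
    exact (hr v hv).2.2 (h1 ▸ hΦ)

open Classical in
/-- Tree slots of a set of elements. -/
noncomputable def TS {U N : Type} [Fintype N] (q : ℕ) (A : Finset U) : Finset (U × (Fin q ⊕ N)) :=
  A ×ˢ (Finset.univ.image Sum.inr)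

theorem mem_TS {U N : Type} [Fintype N] {q : ℕ} {A : Finset U} {i : U × (Fin q ⊕ N)} :
    i ∈ TS q A ↔ i.1 ∈ A ∧ ∃ ν, Sum.inr ν = i.2 := by
  simp [TS]

open Classical in
theorem card_TS {U N : Type} [Fintype N] {q : ℕ} (A : Finset U) :
    (TS (N := N) q A).card = A.card * Fintype.card N := by
  rw [TS, Finset.card_product, Finset.card_image_of_injective _ Sum.inr_injective,
    Finset.card_univ]

open Classical in
theorem gamma_card {U N : Type} [Fintype N] {q s : ℕ} (h : U × (Fin q ⊕ N) → Fin s)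
    (A : Finset U) :
    ((A ×ˢ (Finset.univ : Finset N)).image (fun z => (z.2, h (z.1, Sum.inr z.2)))).card =
      ((TS q A).image (fun i => (i.2, h i))).card := by
  have hinj : Function.Injective
      (fun z : N × Fin s => ((Sum.inr z.1 : Fin q ⊕ N), z.2)) := by
    rintro ⟨a, b⟩ ⟨c, d⟩ h
    simpa using h
  rw [← Finset.card_image_of_injective _ hinj]
  congr 1
  ext ⟨x, c⟩
  simp only [Finset.mem_image, Finset.mem_product, mem_TS, Prod.mk.injEq, Prod.exists,
    Finset.mem_univ, and_true]
  constructor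
  · rintro ⟨ν, c', ⟨u, ν', hu, rfl, rfl⟩, rfl, rfl⟩
    exact ⟨u, Sum.inr ν', ⟨hu, ν', rfl⟩, rfl, rfl⟩
  · rintro ⟨u, i, ⟨hu, ν, rfl⟩, rfl, rfl⟩
    exact ⟨ν, _, ⟨u, ν, hu, rfl, rfl⟩, rfl, rfl⟩

open Classical in
theorem count_small {U N : Type} [Fintype U] [Fintype N] {q s : ℕ} (k a : ℕ) :
    (Finset.univ.filter (fun h : U × (Fin q ⊕ N) → Fin s => ∃ A : Finset U, A.card = a ∧
      k * a + ((TS q A).image (fun i => (i.2, h i))).card ≤ (TS (N := N) q A).card)).card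
        * s ^ (k * a)
      ≤ ((Fintype.card U).choose a * 2 ^ (a * Fintype.card N)) * a ^ (k * a) *
        s ^ Fintype.card (U × (Fin q ⊕ N)) := by
  set J : Finset (Σ _ : Finset U, Finset (U × (Fin q ⊕ N))) :=
    (Finset.powersetCard a Finset.univ).sigma
      (fun A => (TS q A).powerset.filter (fun E => E.card = k * a)) with hJ
  have hJc : J.card ≤ (Fintype.card U).choose a * 2 ^ (a * Fintype.card N) := by
    rw [hJ, Finset.card_sigma]
    calc _ ≤ ∑ A ∈ Finset.powersetCard a (Finset.univ : Finset U), 2 ^ (a * Fintype.card N) := by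
          apply Finset.sum_le_sum
          intro A hA
          refine le_trans (Finset.card_filter_le _ _) ?_
          rw [Finset.card_powerset, card_TS, (Finset.mem_powersetCard.1 hA).2]
      _ = _ := by
          rw [Finset.sum_const, smul_eq_mul, Finset.card_powersetCard, Finset.card_univ]
  have main := count_patterns (s := s) J (fun j => j.2)
    (fun j i => j.1 ×ˢ {i.2}) (k * a) (a ^ (k * a)) (by
      rintro ⟨A, E⟩ hj
      simp only [hJ, Finset.mem_sigma, Finset.mem_filter] at hj
      exact hj.2.2) (by
      rintro ⟨A, E⟩ hj
      simp only [hJ, Finset.mem_sigma, Finset.mem_filter, Finset.mem_powersetCard] at hj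
      simp only [Finset.card_product, Finset.card_singleton, mul_one, Finset.prod_const]
      rw [hj.1.2, hj.2.2])
  refine le_trans (Nat.mul_le_mul_right _ (Finset.card_le_card ?_))
    (le_trans main (Nat.mul_le_mul_right _ (Nat.mul_le_mul_right _ hJc)))
  intro h hh
  simp only [Finset.mem_filter, Finset.mem_univ, true_and] at hh ⊢
  obtain ⟨A, hA, hc⟩ := hh
  obtain ⟨H, hHQ, w, hcard, hw, -⟩ := exists_reps ∅ (TS q A) (by simp) (fun i => (i.2, h i))
  obtain ⟨E, hEH, hE⟩ := Finset.exists_subset_card_eq (show k * a ≤ H.card by omega)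
  refine ⟨⟨A, E⟩, ?_, w, ?_⟩
  · simp only [hJ, Finset.mem_sigma, Finset.mem_filter, Finset.mem_powersetCard,
      Finset.mem_powerset, Finset.subset_univ, true_and]
    exact ⟨hA, hEH.trans hHQ, hE⟩
  · intro i hi
    obtain ⟨h1, h2, h3⟩ := hw i (hEH hi)
    simp only [Prod.mk.injEq] at h3
    refine ⟨?_, fun hc => h2 (hEH hc), h3.2.symm⟩
    simp only [Finset.mem_product, Finset.mem_singleton]
    exact ⟨(mem_TS.1 h1).1, h3.1⟩

open Classical in
theorem count_large {U N : Type} [Fintype U] [Fintype N] {q s : ℕ} (n b : ℕ) (hnb : n ≤ b) :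
    (Finset.univ.filter (fun h : U × (Fin q ⊕ N) → Fin s => ∃ f : Fin n → U, ∃ T : Finset U,
      T.card = b ∧ Disjoint T (Finset.univ.image f) ∧
      (∀ y ∈ T, Hit h (Finset.univ.image f) y) ∧
      2 * b + ((TS q (Finset.univ.image f ∪ T)).image (fun i => (i.2, h i))).card
        ≤ (TS (N := N) q (Finset.univ.image f ∪ T)).card)).card
        * s ^ ((q + 2) * b)
      ≤ ((Fintype.card U ^ n * (Fintype.card U).choose b) * (4 ^ (2 * b * Fintype.card N))) *
        ((2 * b) ^ b * n ^ ((q + 1) * b)) *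
        s ^ Fintype.card (U × (Fin q ⊕ N)) := by
  set J : Finset (Σ _ : (Fin n → U) × Finset U,
      Finset (U × (Fin q ⊕ N)) × Finset (U × (Fin q ⊕ N))) :=
    (Finset.univ ×ˢ Finset.powersetCard b Finset.univ).sigma
      (fun p => ((TS q (Finset.univ.image p.1 ∪ p.2)).powerset ×ˢ
        (TS q (Finset.univ.image p.1 ∪ p.2)).powerset).filter
        (fun z => z.1.card = b ∧ z.2.card = b ∧ Disjoint z.1 z.2)) with hJ
  have hSc : ∀ f : Fin n → U, (Finset.univ.image f).card ≤ n := fun f =>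
    le_trans Finset.card_image_le (by simp)
  have hJc : J.card ≤
      (Fintype.card U ^ n * (Fintype.card U).choose b) * (4 ^ (2 * b * Fintype.card N)) := by
    rw [hJ, Finset.card_sigma]
    calc _ ≤ ∑ A ∈ (Finset.univ : Finset (Fin n → U)) ×ˢ
            Finset.powersetCard b (Finset.univ : Finset U), 4 ^ (2 * b * Fintype.card N) := by
          apply Finset.sum_le_sum
          rintro ⟨f, T⟩ hA
          refine le_trans (Finset.card_filter_le _ _) ?_
          rw [Finset.card_product, Finset.card_powerset, card_TS, ← mul_pow]
          apply Nat.pow_le_pow_right (by norm_num)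
          apply Nat.mul_le_mul_right
          have h1 := Finset.card_union_le (Finset.univ.image f) T
          have h2 := (Finset.mem_powersetCard.1 (Finset.mem_product.1 hA).2).2
          have h3 := hSc f
          simp only at h2 ⊢
          omega
      _ = _ := by
          rw [Finset.sum_const, smul_eq_mul, Finset.card_product, Finset.card_powersetCard,
            Finset.card_univ, Finset.card_univ]
          simp
  set F : Finset U → Finset (U × (Fin q ⊕ N)) := fun T => T ×ˢ (Finset.univ.image Sum.inl) with hF
  have hFc : ∀ T, (F T).card = T.card * q := by
    intro T
    rw [hF]
    simp only
    rw [Finset.card_product, Finset.card_image_of_injective _ Sum.inl_injective]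
    simp
  have hdisjF : ∀ (T A : Finset U), Disjoint (F T) (TS q A) := by
    intro T A
    rw [Finset.disjoint_left]
    rintro ⟨u, i⟩ h1 h2
    obtain ⟨-, ν, hν⟩ := mem_TS.1 h2
    simp only [hF, Finset.mem_product, Finset.mem_image, Finset.mem_univ, true_and] at h1
    obtain ⟨-, j, hj⟩ := h1
    simp only at hν
    rw [← hν] at hj
    cases hj
  have hdec : ∀ j ∈ J, (Disjoint (F j.1.2 ∪ j.2.1) j.2.2) ∧ Disjoint (F j.1.2) j.2.1 ∧
      j.1.2.card = b ∧ j.2.1.card = b ∧ j.2.2.card = b := by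
    rintro ⟨⟨f, T⟩, ⟨D, E⟩⟩ hj
    simp only [hJ, Finset.mem_sigma, Finset.mem_filter, Finset.mem_powersetCard,
      Finset.mem_powerset, Finset.mem_product] at hj
    obtain ⟨⟨-, -, hT⟩, ⟨hDQ, hEQ⟩, hD, hE, hDE⟩ := hj
    refine ⟨?_, ?_, hT, hD, hE⟩
    · rw [Finset.disjoint_union_left]
      exact ⟨(hdisjF T _).mono_right hEQ, hDE⟩
    · exact (hdisjF T _).mono_right hDQ
  have main := count_patterns (s := s) J (fun j => (F j.1.2 ∪ j.2.1) ∪ j.2.2)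
    (fun j i => (if i ∈ j.2.2 then Finset.univ.image j.1.1 ∪ j.1.2 else
      Finset.univ.image j.1.1) ×ˢ {i.2}) ((q + 2) * b) ((2 * b) ^ b * n ^ ((q + 1) * b)) (by
      intro j hj
      obtain ⟨h1, h2, h3, h4, h5⟩ := hdec j hj
      rw [Finset.card_union_of_disjoint h1, Finset.card_union_of_disjoint h2, hFc, h3, h4, h5]
      ring) (by
      intro j hj
      obtain ⟨h1, h2, h3, h4, h5⟩ := hdec j hj
      rw [Finset.prod_union h1, mul_comm]
      apply Nat.mul_le_mul
      · calc _ ≤ ∏ i ∈ j.2.2, (2 * b) := by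
              apply Finset.prod_le_prod'
              intro i hi
              rw [if_pos hi, Finset.card_product, Finset.card_singleton, mul_one]
              have := Finset.card_union_le (Finset.univ.image j.1.1) j.1.2
              have := hSc j.1.1
              omega
          _ = _ := by rw [Finset.prod_const, h5]
      · calc _ ≤ ∏ i ∈ F j.1.2 ∪ j.2.1, n := by
              apply Finset.prod_le_prod'
              intro i hi
              rw [if_neg (Finset.disjoint_left.1 h1 hi), Finset.card_product,
                Finset.card_singleton, mul_one]
              exact hSc j.1.1
          _ = _ := by
              rw [Finset.prod_const, Finset.card_union_of_disjoint h2, hFc, h3, h4]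
              congr 1
              ring)
  refine le_trans (Nat.mul_le_mul_right _ (Finset.card_le_card ?_))
    (le_trans main (Nat.mul_le_mul_right _ (Nat.mul_le_mul_right _ hJc)))
  intro h hh
  simp only [Finset.mem_filter, Finset.mem_univ, true_and] at hh ⊢
  obtain ⟨f, T, hT, hdisj, hhit, hc⟩ := hh
  set S := Finset.univ.image f with hS
  obtain ⟨H, hHQ, w, hcard, hw, hw2⟩ := exists_reps (TS q S) (TS q (S ∪ T)) (by
    intro i hi
    rw [mem_TS] at hi ⊢
    exact ⟨Finset.mem_union_left _ hi.1, hi.2⟩) (fun i => (i.2, h i))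
  have hν : ∀ y ∈ T, ∃ ν : N, ∃ x ∈ S, h (x, Sum.inr ν) = h (y, Sum.inr ν) :=
    fun y hy => (hhit y hy).2
  choose ν hν using hν
  set D := T.attach.image (fun y => ((y.1, Sum.inr (ν y.1 y.2)) : U × (Fin q ⊕ N))) with hD
  have hDc : D.card = b := by
    rw [hD, Finset.card_image_of_injective, Finset.card_attach, hT]
    intro y y' hy
    exact Subtype.ext (congrArg Prod.fst hy)
  have hDH : ∀ i ∈ D, i ∈ H ∧ w i ∈ TS q S := by
    intro i hi
    obtain ⟨⟨y, hy⟩, -, rfl⟩ := Finset.mem_image.1 hi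
    apply hw2
    · rw [mem_TS]
      exact ⟨Finset.mem_union_right _ hy, _, rfl⟩
    · rw [mem_TS]
      intro hc
      exact Finset.disjoint_left.1 hdisj hy hc.1
    · obtain ⟨x, hx, hxy⟩ := hν y hy
      rw [Finset.mem_image]
      refine ⟨(x, Sum.inr (ν y hy)), mem_TS.2 ⟨hx, _, rfl⟩, ?_⟩
      simp only [hxy]
  have hHD : b ≤ (H \ D).card := by
    have := Finset.card_sdiff_add_card_eq_card (fun i hi => (hDH i hi).1 : D ⊆ H)
    omega
  obtain ⟨E, hEH, hE⟩ := Finset.exists_subset_card_eq hHD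
  have hEH' : E ⊆ H := hEH.trans Finset.sdiff_subset
  have hDE : Disjoint D E := by
    rw [Finset.disjoint_left]
    intro i hi hc
    exact (Finset.mem_sdiff.1 (hEH hc)).2 hi
  have hnot : ∀ i ∈ TS q (S ∪ T), i ∉ H → i ∉ F T ∪ D ∪ E := by
    intro i hi hiH hc
    rw [Finset.mem_union, Finset.mem_union] at hc
    rcases hc with (hc | hc) | hc
    · exact Finset.disjoint_left.1 (hdisjF T _) hc hi
    · exact hiH (hDH i hc).1
    · exact hiH (hEH' hc)
  have hex : ∀ i ∈ F T ∪ D ∪ E, ∃ i', i' ∈ (if i ∈ E then S ∪ T else S) ×ˢ {i.2} ∧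
      i' ∉ F T ∪ D ∪ E ∧ h i = h i' := by
    intro i hi
    by_cases hiE : i ∈ E
    · obtain ⟨h1, h2, h3⟩ := hw i (hEH' hiE)
      simp only [Prod.mk.injEq] at h3
      refine ⟨w i, ?_, hnot _ h1 h2, h3.2.symm⟩
      rw [if_pos hiE, Finset.mem_product, Finset.mem_singleton]
      exact ⟨(mem_TS.1 h1).1, h3.1⟩
    · rw [if_neg hiE]
      rw [Finset.mem_union, Finset.mem_union] at hi
      rcases hi with (hi | hi) | hi
      · obtain ⟨y, c⟩ := i
        simp only [hF, Finset.mem_product, Finset.mem_image, Finset.mem_univ, true_and] at hi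
        obtain ⟨hy, c, rfl⟩ := hi
        obtain ⟨x, hx, hxy⟩ := (hhit y hy).1 c
        refine ⟨(x, Sum.inl c), ?_, ?_, hxy.symm⟩
        · simp [hx]
        · intro hc
          rw [Finset.mem_union, Finset.mem_union] at hc
          rcases hc with (hc | hc) | hc
          · rw [hF] at hc
            exact Finset.disjoint_left.1 hdisj (Finset.mem_product.1 hc).1 hx
          · obtain ⟨-, ν', hν'⟩ := mem_TS.1 (hHQ (hDH _ hc).1)
            cases hν'
          · obtain ⟨-, ν', hν'⟩ := mem_TS.1 (hHQ (hEH' hc))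
            cases hν'
      · obtain ⟨h1, h2, h3⟩ := hw i (hDH i hi).1
        simp only [Prod.mk.injEq] at h3
        refine ⟨w i, ?_, hnot _ h1 h2, h3.2.symm⟩
        rw [Finset.mem_product, Finset.mem_singleton]
        exact ⟨(mem_TS.1 (hDH i hi).2).1, h3.1⟩
      · exact absurd hi hiE
  choose v hv using hex
  refine ⟨⟨(f, T), (D, E)⟩, ?_, fun i => if hi : i ∈ F T ∪ D ∪ E then v i hi else i, ?_⟩
  · simp only [hJ, Finset.mem_sigma, Finset.mem_filter, Finset.mem_powersetCard,
      Finset.mem_powerset, Finset.mem_product, Finset.subset_univ, Finset.mem_univ, true_and]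
    exact ⟨hT, ⟨fun i hi => hHQ (hDH i hi).1, hEH'.trans hHQ⟩, hDc, hE, hDE⟩
  · intro i hi
    simp only at hi
    simp only [hi, dif_pos]
    exact hv i hi

theorem choose_mul_pow_le (m a : ℕ) :
    ((m.choose a : ℕ) : ℝ) * (a : ℝ) ^ a ≤ (Real.exp 1 * m) ^ a := by
  have h1 : ((m.choose a : ℕ) : ℝ) ≤ (m : ℝ) ^ a / (a.factorial : ℝ) := Nat.choose_le_pow_div a m
  have h2 : (a : ℝ) ^ a / (a.factorial : ℝ) ≤ Real.exp a :=
    Real.pow_div_factorial_le_exp _ (Nat.cast_nonneg a) a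
  have hf : (0 : ℝ) < a.factorial := by exact_mod_cast a.factorial_pos
  calc ((m.choose a : ℕ) : ℝ) * (a : ℝ) ^ a ≤ (m : ℝ) ^ a / (a.factorial : ℝ) * (a : ℝ) ^ a := by
        gcongr
    _ = (m : ℝ) ^ a * ((a : ℝ) ^ a / (a.factorial : ℝ)) := by field_simp
    _ ≤ (m : ℝ) ^ a * Real.exp a := by gcongr
    _ = (Real.exp 1 * m) ^ a := by
        rw [mul_pow, ← Real.exp_nat_mul, mul_one, mul_comm]

open Classical in
/-- What failure of `Good` yields. -/
theorem bad_cases {U N : Type} [Fintype U] [Fintype N] {q s : ℕ} (n L : ℕ) (hnL : n ≤ L)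
    (h : U × (Fin q ⊕ N) → Fin s) (hg : ¬ Good n (q + 2) h) :
    (∃ a ∈ Finset.range (Fintype.card U), a + 1 ≤ 2 * L ∧ ∃ A : Finset U, A.card = a + 1 ∧
      (q + 2) * (a + 1) + ((TS q A).image (fun i => (i.2, h i))).card ≤ (TS (N := N) q A).card) ∨
    (∃ b ∈ Finset.range (Fintype.card U), L < b + 1 ∧ ∃ f : Fin n → U, ∃ T : Finset U,
      T.card = b + 1 ∧ Disjoint T (Finset.univ.image f) ∧
      (∀ y ∈ T, Hit h (Finset.univ.image f) y) ∧
      2 * (b + 1) + ((TS q (Finset.univ.image f ∪ T)).image (fun i => (i.2, h i))).card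
        ≤ (TS (N := N) q (Finset.univ.image f ∪ T)).card) := by
  unfold Good at hg
  push Not at hg
  obtain ⟨S, hS, A, hA, hlt⟩ := hg
  rw [gamma_card] at hlt
  have hApos : 0 < A.card := by
    rcases Nat.eq_zero_or_pos A.card with h0 | h0
    · rw [h0] at hlt
      simp at hlt
    · exact h0
  have hAU : A.card ≤ Fintype.card U := Finset.card_le_univ A
  have hD : q + 2 ≤ Fintype.card N := by
    by_contra hc
    rw [Nat.sub_eq_zero_of_le (by omega)] at hlt
    simp at hlt
  have hcol : (q + 2) * A.card + ((TS q A).image (fun i => (i.2, h i))).card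
      ≤ (TS (N := N) q A).card := by
    rw [card_TS]
    have : (Fintype.card N - (q + 2)) * A.card + (q + 2) * A.card = A.card * Fintype.card N := by
      rw [← Nat.add_mul, Nat.sub_add_cancel hD, mul_comm]
    omega
  by_cases hsm : A.card ≤ 2 * L
  · left
    refine ⟨A.card - 1, Finset.mem_range.2 (by omega), by omega, A, by omega, ?_⟩
    rw [Nat.sub_add_cancel hApos]
    exact hcol
  · right
    push Not at hsm
    obtain ⟨y₀, hy₀⟩ := Finset.card_pos.1 hApos
    obtain ⟨ν₀, x₀, hx₀, hν₀⟩ := (hA y₀ hy₀).2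
    have hcS : Fintype.card S ≤ Fintype.card (Fin n) := by simpa using hS
    obtain ⟨e⟩ := Function.Embedding.nonempty_of_card_le hcS
    have : Nonempty S := ⟨⟨x₀, hx₀⟩⟩
    have hsurj := Function.invFun_surjective e.injective
    set f : Fin n → U := fun i => (Function.invFun e i).1 with hf
    have hfS : Finset.univ.image f = S := by
      ext x
      simp only [Finset.mem_image, Finset.mem_univ, true_and]
      constructor
      · rintro ⟨i, rfl⟩
        exact (Function.invFun e i).2
      · intro hx
        obtain ⟨i, hi⟩ := hsurj ⟨x, hx⟩
        exact ⟨i, by simp only [hf, hi]⟩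
    have hT1 := Finset.le_card_sdiff S A
    have hT2 : (A \ S).card ≤ A.card := Finset.card_le_card Finset.sdiff_subset
    have hT3 : (A \ S).card - 1 + 1 = (A \ S).card := by omega
    refine ⟨(A \ S).card - 1, Finset.mem_range.2 (by omega), by omega, f, A \ S, hT3.symm, ?_⟩
    rw [hfS, hT3]
    refine ⟨Finset.sdiff_disjoint, fun y hy => hA y (Finset.mem_sdiff.1 hy).1, ?_⟩
    have hsub : TS (N := N) q A ⊆ TS q (S ∪ A \ S) := by
      intro i hi
      rw [mem_TS] at hi ⊢
      refine ⟨?_, hi.2⟩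
      rw [Finset.union_sdiff_self_eq_union]
      exact Finset.mem_union_right _ hi.1
    have h1 := Finset.card_sdiff_add_card_eq_card hsub
    have h2 : ((TS q (S ∪ A \ S)).image (fun i => (i.2, h i))).card ≤
        ((TS q A).image (fun i => (i.2, h i))).card + (TS (N := N) q (S ∪ A \ S) \ TS q A).card := by
      calc _ = (((TS q A) ∪ (TS q (S ∪ A \ S) \ TS q A)).image (fun i => (i.2, h i))).card := by
            rw [Finset.union_sdiff_of_subset hsub]
        _ ≤ _ := by
            rw [Finset.image_union]
            refine le_trans (Finset.card_union_le _ _) ?_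
            exact Nat.add_le_add_left Finset.card_image_le _
    have h3 : 2 * (A \ S).card ≤ (q + 2) * A.card := Nat.mul_le_mul (by omega) hT2
    omega

theorem geom_quarter (M : ℕ) : ∑ a ∈ Finset.range M, (1 / 4 : ℝ) ^ (a + 1) ≤ 1 / 3 := by
  have : ∑ a ∈ Finset.range M, (1 / 4 : ℝ) ^ (a + 1) = (1 - (1 / 4) ^ M) / 3 := by
    induction M with
    | zero => simp
    | succ M ih => rw [Finset.sum_range_succ, ih]; ring
  rw [this]
  have : (0 : ℝ) ≤ (1 / 4) ^ M := by positivity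
  linarith

theorem geom_half (M : ℕ) : ∑ a ∈ Finset.range M, (1 / 2 : ℝ) ^ (a + 2) ≤ 1 / 2 := by
  have : ∑ a ∈ Finset.range M, (1 / 2 : ℝ) ^ (a + 2) = (1 - (1 / 2) ^ M) / 2 := by
    induction M with
    | zero => simp
    | succ M ih => rw [Finset.sum_range_succ, ih]; ring
  rw [this]
  have : (0 : ℝ) ≤ (1 / 2) ^ M := by positivity
  linarith

theorem exists_good_s3 {U N : Type} [Fintype U] [Fintype N] {q s : ℕ} (n l : ℕ) (hl : 1 ≤ l)
    (hn : 1 ≤ n) (hm : Fintype.card U ≤ 2 ^ l) (hs0 : 0 < s)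
    (hs : 8 * Real.exp 1 * 16 ^ Fintype.card N * (Fintype.card U : ℝ) *
      (2 * n * l : ℝ) ^ (q + 1) ≤ (s : ℝ) ^ (q + 2)) :
    ∃ h : U × (Fin q ⊕ N) → Fin s, Good n (q + 2) h := by
  classical
  by_contra hcon
  push Not at hcon
  set m := Fintype.card U with hmdef
  set D := Fintype.card N with hDdef
  set V : ℕ := s ^ Fintype.card (U × (Fin q ⊕ N)) with hV
  have hs0' : (0 : ℝ) < s := by exact_mod_cast hs0
  have hVpos : (0 : ℝ) < V := by
    rw [hV]; push_cast; positivity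
  have he : (0 : ℝ) < Real.exp 1 := Real.exp_pos 1
  have hnl : n ≤ n * l := Nat.le_mul_of_pos_right n hl
  let Sm : ℕ → Finset (U × (Fin q ⊕ N) → Fin s) := fun a => Finset.univ.filter
    (fun h : U × (Fin q ⊕ N) → Fin s => ∃ A : Finset U, A.card = a ∧
      (q + 2) * a + ((TS q A).image (fun i => (i.2, h i))).card ≤ (TS (N := N) q A).card)
  let La : ℕ → Finset (U × (Fin q ⊕ N) → Fin s) := fun b => Finset.univ.filter
    (fun h : U × (Fin q ⊕ N) → Fin s => ∃ f : Fin n → U, ∃ T : Finset U,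
      T.card = b ∧ Disjoint T (Finset.univ.image f) ∧
      (∀ y ∈ T, Hit h (Finset.univ.image f) y) ∧
      2 * b + ((TS q (Finset.univ.image f ∪ T)).image (fun i => (i.2, h i))).card
        ≤ (TS (N := N) q (Finset.univ.image f ∪ T)).card)
  have hSm : ∀ a, a ≤ 2 * (n * l) → ((Sm a).card : ℝ) ≤ (1 / 4) ^ a * V := by
    intro a ha
    have h0 := count_small (U := U) (N := N) (q := q) (s := s) (q + 2) a
    have h1 : ((Sm a).card : ℝ) * (s : ℝ) ^ ((q + 2) * a) ≤
        ((m.choose a : ℕ) : ℝ) * 2 ^ (a * D) * (a : ℝ) ^ ((q + 2) * a) * V := by exact_mod_cast h0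
    have ha' : (a : ℝ) ≤ 2 * n * l := by
      have : ((a : ℕ) : ℝ) ≤ ((2 * (n * l) : ℕ) : ℝ) := by exact_mod_cast ha
      push_cast at this
      linarith
    have h2 : ((m.choose a : ℕ) : ℝ) * 2 ^ (a * D) * (a : ℝ) ^ ((q + 2) * a) ≤
        (1 / 4) ^ a * (s : ℝ) ^ ((q + 2) * a) := by
      calc ((m.choose a : ℕ) : ℝ) * 2 ^ (a * D) * (a : ℝ) ^ ((q + 2) * a)
          = (((m.choose a : ℕ) : ℝ) * (a : ℝ) ^ a) * (2 ^ D * (a : ℝ) ^ (q + 1)) ^ a := by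
            rw [mul_pow, ← pow_mul, ← pow_mul, mul_comm D a,
              show (q + 2) * a = a + (q + 1) * a by ring, pow_add]
            ring
        _ ≤ (Real.exp 1 * m) ^ a * (2 ^ D * (a : ℝ) ^ (q + 1)) ^ a := by
            gcongr
            exact choose_mul_pow_le m a
        _ = (Real.exp 1 * m * (2 ^ D * (a : ℝ) ^ (q + 1))) ^ a := by rw [← mul_pow]
        _ ≤ (1 / 4 * (s : ℝ) ^ (q + 2)) ^ a := by
            apply pow_le_pow_left₀ (by positivity)
            calc Real.exp 1 * m * (2 ^ D * (a : ℝ) ^ (q + 1))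
                ≤ Real.exp 1 * m * (16 ^ D * (2 * n * l : ℝ) ^ (q + 1)) := by
                  gcongr
                  norm_num
              _ ≤ 2 * (Real.exp 1 * m * (16 ^ D * (2 * n * l : ℝ) ^ (q + 1))) := by
                  have : 0 ≤ Real.exp 1 * m * (16 ^ D * (2 * n * l : ℝ) ^ (q + 1)) := by positivity
                  linarith
              _ ≤ 1 / 4 * (s : ℝ) ^ (q + 2) := by linarith
        _ = _ := by rw [mul_pow, ← pow_mul]
    have hpos : (0 : ℝ) < (s : ℝ) ^ ((q + 2) * a) := by positivity
    refine le_of_mul_le_mul_right (h1.trans ?_) hpos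
    calc _ ≤ (1 / 4) ^ a * (s : ℝ) ^ ((q + 2) * a) * V := by gcongr
      _ = _ := by ring
  have hLa : ∀ b, n * l < b + 1 → ((La (b + 1)).card : ℝ) ≤ (1 / 2) ^ (b + 2) * V := by
    intro b hb
    have h0 := count_large (U := U) (N := N) (q := q) (s := s) n (b + 1) (by omega)
    have h1 : ((La (b + 1)).card : ℝ) * (s : ℝ) ^ ((q + 2) * (b + 1)) ≤
        (((m : ℝ) ^ n * ((m.choose (b + 1) : ℕ) : ℝ)) * 4 ^ (2 * (b + 1) * D)) *
        ((2 * ((b + 1 : ℕ) : ℝ)) ^ (b + 1) * (n : ℝ) ^ ((q + 1) * (b + 1))) * V := by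
      exact_mod_cast h0
    have hmn : (m : ℝ) ^ n ≤ 2 ^ b := by
      have : m ^ n ≤ 2 ^ b := by
        calc m ^ n ≤ (2 ^ l) ^ n := Nat.pow_le_pow_left hm n
          _ = 2 ^ (n * l) := by rw [← pow_mul, mul_comm]
          _ ≤ 2 ^ b := Nat.pow_le_pow_right (by norm_num) (by omega)
      exact_mod_cast this
    have hn1 : (1 : ℝ) ≤ l := by exact_mod_cast hl
    have hn0 : (1 : ℝ) ≤ n := by exact_mod_cast hn
    have hnle : (n : ℝ) ≤ 2 * n * l := by nlinarith
    have h2 : ∀ c : ℕ, (((m.choose c : ℕ) : ℝ) * 4 ^ (2 * c * D)) *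
        ((2 * (c : ℝ)) ^ c * (n : ℝ) ^ ((q + 1) * c)) ≤
        (1 / 4) ^ c * (s : ℝ) ^ ((q + 2) * c) := by
      intro c
      calc (((m.choose c : ℕ) : ℝ) * 4 ^ (2 * c * D)) *
            ((2 * (c : ℝ)) ^ c * (n : ℝ) ^ ((q + 1) * c))
          = (((m.choose c : ℕ) : ℝ) * (c : ℝ) ^ c) * (2 * (16 ^ D * (n : ℝ) ^ (q + 1))) ^ c := by
            rw [show (4 : ℝ) ^ (2 * c * D) = (16 ^ D) ^ c by
              rw [← pow_mul, show 2 * c * D = 2 * (D * c) by ring, pow_mul]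
              norm_num]
            rw [mul_pow, mul_pow, mul_pow, ← pow_mul (n : ℝ)]
            ring
        _ ≤ (Real.exp 1 * m) ^ c * (2 * (16 ^ D * (n : ℝ) ^ (q + 1))) ^ c := by
            gcongr
            exact choose_mul_pow_le m c
        _ = (Real.exp 1 * m * (2 * (16 ^ D * (n : ℝ) ^ (q + 1)))) ^ c := by rw [← mul_pow]
        _ ≤ (1 / 4 * (s : ℝ) ^ (q + 2)) ^ c := by
            apply pow_le_pow_left₀ (by positivity)
            calc Real.exp 1 * m * (2 * (16 ^ D * (n : ℝ) ^ (q + 1)))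
                ≤ Real.exp 1 * m * (2 * (16 ^ D * (2 * n * l : ℝ) ^ (q + 1))) := by
                  gcongr
              _ ≤ 1 / 4 * (s : ℝ) ^ (q + 2) := by linarith
        _ = _ := by rw [mul_pow, ← pow_mul]
    have h3 := h2 (b + 1)
    have hpos : (0 : ℝ) < (s : ℝ) ^ ((q + 2) * (b + 1)) := by positivity
    refine le_of_mul_le_mul_right (h1.trans ?_) hpos
    calc _ = (m : ℝ) ^ n * ((((m.choose (b + 1) : ℕ) : ℝ) * 4 ^ (2 * (b + 1) * D)) *
        ((2 * ((b + 1 : ℕ) : ℝ)) ^ (b + 1) * (n : ℝ) ^ ((q + 1) * (b + 1)))) * V := by ring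
      _ ≤ 2 ^ b * ((1 / 4) ^ (b + 1) * (s : ℝ) ^ ((q + 2) * (b + 1))) * V := by gcongr
      _ = (2 ^ b * (1 / 4) ^ (b + 1)) * V * (s : ℝ) ^ ((q + 2) * (b + 1)) := by ring
      _ = _ := by
        congr 2
        rw [show (1 / 4 : ℝ) = 1 / 2 * (1 / 2) by norm_num, mul_pow, pow_succ (1 / 2 : ℝ) b,
          pow_add (1 / 2 : ℝ) b 2]
        have : (2 : ℝ) ^ b * (1 / 2) ^ b = 1 := by rw [← mul_pow]; norm_num
        linear_combination (1 / 2 : ℝ) ^ b * (1 / 4) * this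
  have hcov : (Finset.univ : Finset (U × (Fin q ⊕ N) → Fin s)) ⊆
      ((Finset.range m).filter (fun a => a + 1 ≤ 2 * (n * l))).biUnion (fun a => Sm (a + 1)) ∪
      ((Finset.range m).filter (fun b => n * l < b + 1)).biUnion (fun b => La (b + 1)) := by
    intro h _
    rw [Finset.mem_union, Finset.mem_biUnion, Finset.mem_biUnion]
    rcases bad_cases n (n * l) hnl h (hcon h) with ⟨a, ha, ha2, hA⟩ | ⟨b, hb, hb2, hB⟩
    · left
      exact ⟨a, Finset.mem_filter.2 ⟨ha, ha2⟩, Finset.mem_filter.2 ⟨Finset.mem_univ _, hA⟩⟩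
    · right
      exact ⟨b, Finset.mem_filter.2 ⟨hb, hb2⟩, Finset.mem_filter.2 ⟨Finset.mem_univ _, hB⟩⟩
  have hle : V ≤ ∑ a ∈ (Finset.range m).filter (fun a => a + 1 ≤ 2 * (n * l)), (Sm (a + 1)).card +
      ∑ b ∈ (Finset.range m).filter (fun b => n * l < b + 1), (La (b + 1)).card := by
    have h1 := Finset.card_le_card hcov
    rw [Finset.card_univ, Fintype.card_fun, Fintype.card_fin] at h1
    refine h1.trans ((Finset.card_union_le _ _).trans ?_)
    exact Nat.add_le_add Finset.card_biUnion_le Finset.card_biUnion_le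
  have hleR : (V : ℝ) ≤
      ∑ a ∈ (Finset.range m).filter (fun a => a + 1 ≤ 2 * (n * l)), ((Sm (a + 1)).card : ℝ) +
      ∑ b ∈ (Finset.range m).filter (fun b => n * l < b + 1), ((La (b + 1)).card : ℝ) := by
    exact_mod_cast hle
  have hA : ∑ a ∈ (Finset.range m).filter (fun a => a + 1 ≤ 2 * (n * l)), ((Sm (a + 1)).card : ℝ)
      ≤ 1 / 3 * V := by
    calc _ ≤ ∑ a ∈ (Finset.range m).filter (fun a => a + 1 ≤ 2 * (n * l)),
            (1 / 4 : ℝ) ^ (a + 1) * V :=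
          Finset.sum_le_sum fun a ha => hSm _ (Finset.mem_filter.1 ha).2
      _ ≤ ∑ a ∈ Finset.range m, (1 / 4 : ℝ) ^ (a + 1) * V :=
          Finset.sum_le_sum_of_subset_of_nonneg (Finset.filter_subset _ _)
            fun a _ _ => by positivity
      _ ≤ _ := by
          rw [← Finset.sum_mul]
          gcongr
          exact geom_quarter m
  have hB : ∑ b ∈ (Finset.range m).filter (fun b => n * l < b + 1), ((La (b + 1)).card : ℝ)
      ≤ 1 / 2 * V := by
    calc _ ≤ ∑ b ∈ (Finset.range m).filter (fun b => n * l < b + 1),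
            (1 / 2 : ℝ) ^ (b + 2) * V :=
          Finset.sum_le_sum fun b hb => hLa _ (Finset.mem_filter.1 hb).2
      _ ≤ ∑ b ∈ Finset.range m, (1 / 2 : ℝ) ^ (b + 2) * V :=
          Finset.sum_le_sum_of_subset_of_nonneg (Finset.filter_subset _ _)
            fun a _ _ => by positivity
      _ ≤ _ := by
          rw [← Finset.sum_mul]
          gcongr
          exact geom_half m
  linarith

theorem const_bound (q D : ℕ) (hD : D ≤ 3 ^ (q + 2)) :
    ((q : ℝ) + D) * (64 * Real.exp 1 * 16 ^ D) ≤
      (128 * Real.exp 1) * Real.exp (Real.exp (2 * ((2 * q + 3 : ℕ) : ℝ))) := by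
  set y : ℕ := 3 ^ (q + 2) with hy
  have hq : q ≤ y := by
    have : q + 2 < y := Nat.lt_pow_self (by norm_num)
    omega
  have hq' : (q : ℝ) ≤ y := by exact_mod_cast hq
  have hD' : (D : ℝ) ≤ y := by exact_mod_cast hD
  have he := Real.exp_one_gt_d9
  have he3 : (16 : ℝ) ≤ Real.exp 3 := by
    have : Real.exp 3 = Real.exp 1 ^ 3 := by rw [← Real.exp_nat_mul]; norm_num
    rw [this]
    calc (16 : ℝ) ≤ 2.7 ^ 3 := by norm_num
      _ ≤ Real.exp 1 ^ 3 := by gcongr; linarith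
  have h16 : (16 : ℝ) ^ D ≤ Real.exp (3 * y) := by
    calc (16 : ℝ) ^ D ≤ 16 ^ y := by gcongr; norm_num
      _ ≤ Real.exp 3 ^ y := by gcongr
      _ = _ := by rw [← Real.exp_nat_mul, mul_comm]
  have hyy : (y : ℝ) ≤ Real.exp y := by
    have := Real.add_one_le_exp (y : ℝ)
    linarith
  have hbig : 4 * (y : ℝ) ≤ Real.exp (2 * ((2 * q + 3 : ℕ) : ℝ)) := by
    calc 4 * (y : ℝ) ≤ y * y := by
          have h9 : (9 : ℝ) ≤ y := by
            have : 9 ≤ y := by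
              rw [hy]
              calc 9 = 3 ^ 2 := by norm_num
                _ ≤ 3 ^ (q + 2) := Nat.pow_le_pow_right (by norm_num) (by omega)
            exact_mod_cast this
          nlinarith
      _ = (9 : ℝ) ^ (q + 2) := by
          rw [hy]; push_cast
          rw [← mul_pow]; norm_num
      _ ≤ Real.exp 3 ^ (q + 2) := by gcongr; linarith
      _ = Real.exp (3 * (q + 2)) := by
          rw [← Real.exp_nat_mul]; push_cast; ring_nf
      _ ≤ _ := by
          apply Real.exp_le_exp.2
          push_cast
          have : (0 : ℝ) ≤ q := Nat.cast_nonneg q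
          linarith
  calc ((q : ℝ) + D) * (64 * Real.exp 1 * 16 ^ D)
      ≤ (Real.exp y + Real.exp y) * (64 * Real.exp 1 * Real.exp (3 * y)) := by
        gcongr <;> linarith
    _ = (128 * Real.exp 1) * Real.exp (4 * y) := by
        rw [show (4 : ℝ) * y = y + 3 * y by ring, Real.exp_add]; ring
    _ ≤ _ := by gcongr

theorem root_bound (q D m n l : ℕ) (hm : 2 ≤ m) (hn : 1 ≤ n) (hl : 1 ≤ l)
    (hlm : (l : ℝ) ≤ 2 * Real.logb 2 m) :
    ∃ s : ℕ, 0 < s ∧ 8 * Real.exp 1 * 16 ^ D * (m : ℝ) * (2 * n * l : ℝ) ^ (q + 1)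
        ≤ (s : ℝ) ^ (q + 2) ∧
      (s : ℝ) ≤ 64 * Real.exp 1 * 16 ^ D * ((m : ℝ) ^ ((1 : ℝ) / (q + 2 : ℕ)) *
        (n : ℝ) ^ (1 - (1 : ℝ) / (q + 2 : ℕ)) * Real.logb 2 m) := by
  have hm' : (2 : ℝ) ≤ m := by exact_mod_cast hm
  have hn' : (1 : ℝ) ≤ n := by exact_mod_cast hn
  have hl' : (1 : ℝ) ≤ l := by exact_mod_cast hl
  have he := Real.exp_one_gt_d9
  set B : ℝ := 8 * Real.exp 1 * 16 ^ D with hB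
  have h16 : (1 : ℝ) ≤ 16 ^ D := one_le_pow₀ (by norm_num)
  have hB1 : 1 ≤ B := by nlinarith
  set Y : ℝ := B * (m : ℝ) * (2 * n * l : ℝ) ^ (q + 1) with hY
  have h2nl : (1 : ℝ) ≤ 2 * n * l := by nlinarith
  have hp1 : (1 : ℝ) ≤ (2 * n * l : ℝ) ^ (q + 1) := one_le_pow₀ h2nl
  have hBm : 1 ≤ B * (m : ℝ) := by nlinarith
  have hY1 : 1 ≤ Y := by nlinarith
  set κ : ℝ := (1 : ℝ) / (q + 2 : ℕ) with hκ
  have hκ0 : 0 ≤ κ := by positivity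
  have hκ1 : κ ≤ 1 := by
    rw [hκ, div_le_one (by positivity)]
    push_cast
    have : (0 : ℝ) ≤ q := Nat.cast_nonneg q
    linarith
  have hX1 : 1 ≤ Y ^ κ := Real.one_le_rpow hY1 hκ0
  have hXk : (Y ^ κ) ^ (q + 2) = Y := by
    rw [hκ, one_div]
    exact Real.rpow_inv_natCast_pow (by linarith) (by omega)
  have hpow : ((2 * n * l : ℝ) ^ (q + 1)) ^ κ = (2 * n * l : ℝ) ^ (1 - κ) := by
    rw [← Real.rpow_natCast, ← Real.rpow_mul (by positivity)]
    congr 1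
    rw [hκ]
    push_cast
    field_simp
    ring
  have hXle : Y ^ κ ≤ B * ((m : ℝ) ^ κ * (n : ℝ) ^ (1 - κ) * (4 * Real.logb 2 m)) := by
    have e1 : Y ^ κ = B ^ κ * (m : ℝ) ^ κ * ((2 * l : ℝ) ^ (1 - κ) * (n : ℝ) ^ (1 - κ)) := by
      rw [hY, Real.mul_rpow (by positivity) (by positivity),
        Real.mul_rpow (x := B) (by positivity) (by positivity), hpow,
        show (2 * n * l : ℝ) = 2 * l * n by ring,
        Real.mul_rpow (x := 2 * (l : ℝ)) (by positivity) (by positivity)]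
    have e2 : B ^ κ ≤ B := by
      simpa using Real.rpow_le_rpow_of_exponent_le hB1 hκ1
    have e3 : (2 * l : ℝ) ^ (1 - κ) ≤ 4 * Real.logb 2 m := by
      have : (2 * l : ℝ) ^ (1 - κ) ≤ 2 * l := by
        simpa using Real.rpow_le_rpow_of_exponent_le (show (1 : ℝ) ≤ 2 * l by linarith)
          (show 1 - κ ≤ 1 by linarith)
      linarith
    rw [e1]
    calc B ^ κ * (m : ℝ) ^ κ * ((2 * l : ℝ) ^ (1 - κ) * (n : ℝ) ^ (1 - κ))
        ≤ B * (m : ℝ) ^ κ * ((4 * Real.logb 2 m) * (n : ℝ) ^ (1 - κ)) := by gcongr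
      _ = _ := by ring
  refine ⟨⌈Y ^ κ⌉₊, Nat.ceil_pos.2 (by linarith), ?_, ?_⟩
  · calc Y = (Y ^ κ) ^ (q + 2) := hXk.symm
      _ ≤ _ := by gcongr; exact Nat.le_ceil _
  · have h1 := Nat.ceil_lt_add_one (show 0 ≤ Y ^ κ by linarith)
    calc ((⌈Y ^ κ⌉₊ : ℕ) : ℝ) ≤ 2 * Y ^ κ := by linarith
      _ ≤ 2 * (B * ((m : ℝ) ^ κ * (n : ℝ) ^ (1 - κ) * (4 * Real.logb 2 m))) := by linarith
      _ = _ := by rw [hB]; ring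

/-- For every `ε ∈ (0,1)` there exist `C > 0` and `m₀` such that for
all `m ≥ m₀`, every odd `t` with `3 ≤ t ≤ (1/10)·lg lg m`, and every `n` with
`1 ≤ n ≤ m^(1-ε)`, there exists an adaptive `(m,n,s,t)`-scheme with
`s ≤ C·exp(e^(2t))·m^(2/(t+1))·n^(1-2/(t+1))·lg m`.  An adaptive scheme consists of
probe maps `p x`, answer maps `a x`, and a storage map `φ`; the answer for `x` on
memory `φ S` is `a x` applied to the `t` adaptively read bits. -/
theorem adaptive_upper_bound :
    ∀ ε : ℝ, 0 < ε → ε < 1 →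
    ∃ C : ℝ, 0 < C ∧
    ∃ m₀ : ℕ, ∀ m : ℕ, m₀ ≤ m →
    ∀ t : ℕ, Odd t → 3 ≤ t → (t : ℝ) ≤ (1 / 10) * Real.logb 2 (Real.logb 2 (m : ℝ)) →
    ∀ n : ℕ, 1 ≤ n → (n : ℝ) ≤ (m : ℝ) ^ ((1 : ℝ) - ε) →
    ∃ s : ℕ,
      (s : ℝ) ≤ C * Real.exp (Real.exp (2 * (t : ℝ))) * (m : ℝ) ^ ((2 : ℝ) / ((t : ℝ) + 1)) *
          (n : ℝ) ^ ((1 : ℝ) - (2 : ℝ) / ((t : ℝ) + 1)) * Real.logb 2 (m : ℝ) ∧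
      ∃ (p : Fin m → List Bool → Fin s) (a : Fin m → List Bool → Bool)
        (φ : Finset (Fin m) → Fin s → Bool),
        ∀ S : Finset (Fin m), S.card ≤ n → ∀ x : Fin m,
          (a x (readBits (φ S) (p x) t) = true ↔ x ∈ S) := by
  intro ε _ _
  refine ⟨128 * Real.exp 1, by positivity, 2, ?_⟩
  intro m hm t hodd ht _ n hn _
  obtain ⟨r, rfl⟩ := hodd
  obtain ⟨q, rfl⟩ : ∃ q, r = q + 1 := ⟨r - 1, by omega⟩
  have hlog1 : 1 ≤ Real.logb 2 (m : ℝ) := by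
    rw [Real.le_logb_iff_rpow_le (by norm_num) (by positivity)]
    simpa using (show (2 : ℝ) ≤ m by exact_mod_cast hm)
  obtain ⟨s, hs0, hs1, hs2⟩ := root_bound q (Fintype.card (Nd (q + 2))) m n (Nat.log 2 m + 1)
    hm hn (by omega) (by
      have := Real.natLog_le_logb m 2
      push_cast at this ⊢
      linarith)
  obtain ⟨h, hg⟩ := exists_good_s3 (U := Fin m) (N := Nd (q + 2)) (q := q) (s := s) n
    (Nat.log 2 m + 1) (by omega) hn
    (by simpa using (Nat.lt_pow_succ_log_self (by norm_num) m).le) hs0 (by simpa using hs1)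
  refine ⟨(q + Fintype.card (Nd (q + 2))) * s, ?_, ?_⟩
  · have hc := const_bound q _ (card_Nd_le (q + 2))
    have hκ : (2 : ℝ) / (((2 * (q + 1) + 1 : ℕ) : ℝ) + 1) = (1 : ℝ) / (q + 2 : ℕ) := by
      push_cast
      field_simp
      ring
    rw [hκ]
    set G : ℝ := (m : ℝ) ^ ((1 : ℝ) / (q + 2 : ℕ)) *
        (n : ℝ) ^ (1 - (1 : ℝ) / (q + 2 : ℕ)) * Real.logb 2 m with hG
    have hG0 : 0 ≤ G := by positivity
    calc (((q + Fintype.card (Nd (q + 2))) * s : ℕ) : ℝ)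
        = ((q : ℝ) + Fintype.card (Nd (q + 2))) * s := by push_cast; ring
      _ ≤ ((q : ℝ) + Fintype.card (Nd (q + 2))) *
          (64 * Real.exp 1 * 16 ^ Fintype.card (Nd (q + 2)) * G) := by gcongr
      _ = ((q : ℝ) + Fintype.card (Nd (q + 2))) *
          (64 * Real.exp 1 * 16 ^ Fintype.card (Nd (q + 2))) * G := by ring
      _ ≤ (128 * Real.exp 1) * Real.exp (Real.exp (2 * ((2 * q + 3 : ℕ) : ℝ))) * G := by gcongr
      _ = _ := by
        rw [hG, show 2 * (q + 1) + 1 = 2 * q + 3 by ring]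
        ring
  · have := scheme_of_good hs0 h hg
    rwa [show q + (q + 2 + 1) = 2 * (q + 1) + 1 by ring] at this
end

section
/- For all m and all n ≥ 3, every non-adaptive (m,n,s,3)-scheme in which every query function equals (x,y,z) ↦ x∧y∧z (AND), or in which every query function equals its complement (x,y,z) ↦ ¬(x∧y∧z), satisfies s ≥ m/3. -/
/-- For all `m` and all `n ≥ 3`, every non-adaptive `(m,n,s,3)`-scheme
whose query function is AND `(x,y,z) ↦ x∧y∧z` for every element, or is the
complement `(x,y,z) ↦ ¬(x∧y∧z)` for every element, satisfies `s ≥ m/3`. -/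
theorem and_three_probe_lower_bound :
    ∀ m n s : ℕ, 3 ≤ n →
    ∀ i₁ i₂ i₃ : Fin m → Fin s, ∀ φ : Finset (Fin m) → Fin s → Bool,
      ((∀ S : Finset (Fin m), S.card ≤ n → ∀ x : Fin m,
          ((φ S (i₁ x) && φ S (i₂ x) && φ S (i₃ x)) = true ↔ x ∈ S)) ∨
       (∀ S : Finset (Fin m), S.card ≤ n → ∀ x : Fin m,
          ((!(φ S (i₁ x) && φ S (i₂ x) && φ S (i₃ x))) = true ↔ x ∈ S))) →
      (m : ℝ) / 3 ≤ (s : ℝ) := by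
  intro m n s hn i₁ i₂ i₃ φ h
  -- every element has a private location
  have key : ∀ x : Fin m, ∃ l : Fin s, (l = i₁ x ∨ l = i₂ x ∨ l = i₃ x) ∧
      ∀ y : Fin m, (l = i₁ y ∨ l = i₂ y ∨ l = i₃ y) → y = x := by
    intro x
    rcases h with h | h
    · by_contra hcon
      push Not at hcon
      obtain ⟨a, ha, hax⟩ := hcon (i₁ x) (Or.inl rfl)
      obtain ⟨b, hb, hbx⟩ := hcon (i₂ x) (Or.inr (Or.inl rfl))
      obtain ⟨c, hc, hcx⟩ := hcon (i₃ x) (Or.inr (Or.inr rfl))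
      have hS := h {a, b, c} (Finset.card_le_three.trans hn)
      have h1 := (hS a).2 (by simp)
      have h2 := (hS b).2 (by simp)
      have h3 := (hS c).2 (by simp)
      have hx : x ∈ ({a, b, c} : Finset (Fin m)) := by
        apply (hS x).1
        simp only [Bool.and_eq_true] at h1 h2 h3 ⊢
        refine ⟨⟨?_, ?_⟩, ?_⟩
        · rcases ha with e | e | e <;> rw [e] <;> tauto
        · rcases hb with e | e | e <;> rw [e] <;> tauto
        · rcases hc with e | e | e <;> rw [e] <;> tauto
      simp only [Finset.mem_insert, Finset.mem_singleton] at hx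
      rcases hx with e | e | e
      · exact hax e.symm
      · exact hbx e.symm
      · exact hcx e.symm
    · have hS := h {x} (by simp; omega)
      have hx := (hS x).2 (by simp)
      have hl : ∃ l : Fin s, (l = i₁ x ∨ l = i₂ x ∨ l = i₃ x) ∧ φ {x} l = false := by
        by_contra hcon
        push Not at hcon
        have h1 := hcon (i₁ x) (by simp)
        have h2 := hcon (i₂ x) (by simp)
        have h3 := hcon (i₃ x) (by simp)
        simp only [ne_eq, Bool.not_eq_false] at h1 h2 h3
        simp [h1, h2, h3] at hx
      obtain ⟨l, hlx, hl0⟩ := hl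
      refine ⟨l, hlx, fun y hy => ?_⟩
      have : y ∈ ({x} : Finset (Fin m)) := by
        apply (hS y).1
        rcases hy with e | e | e <;> rw [e] at hl0 <;> simp [hl0]
      simpa using this
  choose g hg hg' using key
  have hinj : Function.Injective g := by
    intro x y hxy
    exact hg' y x (hxy ▸ hg x)
  have hms : m ≤ s := by simpa using Fintype.card_le_of_injective g hinj
  have h1 : (m : ℝ) ≤ s := by exact_mod_cast hms
  have h0 : (0 : ℝ) ≤ m := Nat.cast_nonneg m
  linarith
end

section
/- There exists m₀ such that for all m ≥ m₀ and all n ≥ 2, every non-adaptive (m,n,s,3)-scheme in which every query function equals (x,y,z) ↦ (x⊕y)∧z, or in which every query function equals its complement (x,y,z) ↦ ¬((x⊕y)∧z), satisfies s > (1/4)·m^{1 − 1/⌊n/2⌋}. -/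
open Finset in
lemma xa_sum_symmDiff {E : Type*} [DecidableEq E] (P Q : Finset E) (f : E → ZMod 2) :
    ∑ x ∈ symmDiff P Q, f x = ∑ x ∈ P, f x + ∑ x ∈ Q, f x := by
  have h1 : ∑ x ∈ symmDiff P Q, f x = ∑ x ∈ P \ Q, f x + ∑ x ∈ Q \ P, f x := by
    rw [symmDiff_def]
    exact Finset.sum_union (disjoint_sdiff_sdiff)
  have h2 := Finset.sum_inter_add_sum_sdiff P Q f
  have h3 := Finset.sum_inter_add_sum_sdiff Q P f
  rw [Finset.inter_comm] at h3
  rw [h1, ← h2, ← h3]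
  have := CharTwo.add_self_eq_zero (∑ x ∈ P ∩ Q, f x)
  linear_combination -this

lemma xa_card_symmDiff {E : Type*} [DecidableEq E] (P Q : Finset E) :
    (symmDiff P Q).card ≤ P.card + Q.card := by
  refine le_trans (Finset.card_le_card (t := P ∪ Q) ?_) (Finset.card_union_le _ _)
  intro x hx
  rw [Finset.mem_symmDiff] at hx
  rw [Finset.mem_union]
  tauto

/-- Breadth-first growth in a (multi)graph without short cycles. -/
lemma xa_grow {E V : Type*} [DecidableEq E] [DecidableEq V] (a b : E → V)
    (E0 : Finset E) (N : ℕ)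
    (hind : ∀ C ⊆ E0, C.card ≤ N →
      (∀ g : V → ZMod 2, ∑ x ∈ C, (g (a x) + g (b x)) = 0) → C = ∅)
    (W : Finset V) (v0 : V) (hv0 : v0 ∈ W) (d : ℝ) (hd : 0 ≤ d)
    (hdeg : ∀ v ∈ W,
      d ≤ ((E0.filter (fun x => (a x ∈ W ∧ b x ∈ W) ∧ (a x = v ∨ b x = v))).card : ℝ))
    (k : ℕ) (hk : 2 * k + 1 ≤ N) :
    ∃ R ⊆ W, ∃ T ⊆ E0, T.card ≤ R.card ∧
      (∀ v ∈ R, ∃ P ⊆ T, P.card ≤ k ∧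
        ∀ g : V → ZMod 2, ∑ x ∈ P, (g (a x) + g (b x)) = g v0 + g v) ∧
      (d / 2) ^ k ≤ (R.card : ℝ) := by
  induction k with
  | zero =>
    refine ⟨{v0}, by simpa using hv0, ∅, by simp, by simp, ?_, by simp⟩
    intro v hv
    rw [Finset.mem_singleton] at hv
    subst hv
    exact ⟨∅, by simp, by simp, fun g => by simp [CharTwo.add_self_eq_zero]⟩
  | succ k ih =>
    obtain ⟨R, hRW, T, hTE, hTR, hP, hcard⟩ := ih (by omega)
    let F := E0.filter (fun x => (a x ∈ W ∧ b x ∈ W) ∧ (a x ∈ R ∨ b x ∈ R))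
    have hF : ∀ x, x ∈ F ↔ x ∈ E0 ∧ (a x ∈ W ∧ b x ∈ W) ∧ (a x ∈ R ∨ b x ∈ R) := by
      intro x; simp [F]
    let M := W.filter (fun v => v ∉ R ∧ ∃ x ∈ F, a x = v ∨ b x = v)
    have hM : ∀ v, v ∈ M ↔ v ∈ W ∧ v ∉ R ∧ ∃ x ∈ F, a x = v ∨ b x = v := by
      intro x; simp [M]
    have hex : ∀ v : V, ∃ T1 : Finset E, T1.card ≤ 1 ∧ T1 ⊆ E0 ∧
        (v ∈ M → ∃ x ∈ T1, x ∈ F ∧ (a x = v ∨ b x = v)) := by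
      intro v
      by_cases hv : v ∈ M
      · obtain ⟨_, _, x, hx, hxv⟩ := (hM v).1 hv
        refine ⟨{x}, by simp, ?_, fun _ => ⟨x, by simp, hx, hxv⟩⟩
        simpa using ((hF x).1 hx).1
      · exact ⟨∅, by simp, by simp, fun h => absurd h hv⟩
    choose e he1 he2 he3 using hex
    have hdisj : Disjoint R M := by
      rw [Finset.disjoint_left]
      intro v hv hv'
      exact ((hM v).1 hv').2.1 hv
    have hP' : ∀ v ∈ R ∪ M, ∃ P ⊆ T ∪ M.biUnion e, P.card ≤ k + 1 ∧
        ∀ g : V → ZMod 2, ∑ x ∈ P, (g (a x) + g (b x)) = g v0 + g v := by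
      intro v hv
      rcases Finset.mem_union.1 hv with hv | hv
      · obtain ⟨P, h1, h2, h3⟩ := hP v hv
        exact ⟨P, h1.trans Finset.subset_union_left, by omega, h3⟩
      · obtain ⟨x, hxe, hxF, hxv⟩ := he3 v hv
        have hvR := ((hM v).1 hv).2.1
        have hxF' := (hF x).1 hxF
        have hu : ∃ u ∈ R, ∀ g : V → ZMod 2, g (a x) + g (b x) = g u + g v := by
          rcases hxv with h | h
          · refine ⟨b x, ?_, fun g => by rw [h]; ring⟩
            rcases hxF'.2.2 with h' | h'
            · rw [h] at h'; exact absurd h' hvR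
            · exact h'
          · refine ⟨a x, ?_, fun g => by rw [h]⟩
            rcases hxF'.2.2 with h' | h'
            · exact h'
            · rw [h] at h'; exact absurd h' hvR
        obtain ⟨u, huR, hu⟩ := hu
        obtain ⟨P, h1, h2, h3⟩ := hP u huR
        refine ⟨symmDiff P {x}, ?_, ?_, ?_⟩
        · intro y hy
          rw [Finset.mem_symmDiff] at hy
          rcases hy with hy | hy
          · exact Finset.mem_union_left _ (h1 hy.1)
          · have : y = x := by simpa using hy.1
            subst this
            exact Finset.mem_union_right _ (Finset.mem_biUnion.2 ⟨v, hv, hxe⟩)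
        · have := xa_card_symmDiff P {x}
          simp at this
          omega
        · intro g
          rw [xa_sum_symmDiff, h3, Finset.sum_singleton, hu]
          have := CharTwo.add_self_eq_zero (g u)
          linear_combination this
    have hTE' : T ∪ M.biUnion e ⊆ E0 := by
      refine Finset.union_subset hTE (Finset.biUnion_subset.2 fun v _ => he2 v)
    have hTR' : (T ∪ M.biUnion e).card ≤ (R ∪ M).card := by
      rw [Finset.card_union_of_disjoint hdisj]
      refine (Finset.card_union_le _ _).trans (Nat.add_le_add hTR ?_)
      refine Finset.card_biUnion_le.trans ?_
      calc ∑ v ∈ M, (e v).card ≤ ∑ v ∈ M, 1 := Finset.sum_le_sum fun v _ => he1 v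
        _ = M.card := by simp
    have hFT : F ⊆ T ∪ M.biUnion e := by
      intro x hx
      have hx' := (hF x).1 hx
      have hax : a x ∈ R ∪ M := by
        by_cases h : a x ∈ R
        · exact Finset.mem_union_left _ h
        · exact Finset.mem_union_right _ ((hM _).2 ⟨hx'.2.1.1, h, x, hx, Or.inl rfl⟩)
      have hbx : b x ∈ R ∪ M := by
        by_cases h : b x ∈ R
        · exact Finset.mem_union_left _ h
        · exact Finset.mem_union_right _ ((hM _).2 ⟨hx'.2.1.2, h, x, hx, Or.inr rfl⟩)
      obtain ⟨P, h1, h2, h3⟩ := hP' _ hax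
      obtain ⟨Q, q1, q2, q3⟩ := hP' _ hbx
      have hz : symmDiff (symmDiff P Q) {x} = ∅ := by
        apply hind
        · intro y hy
          simp only [Finset.mem_symmDiff, Finset.mem_singleton] at hy
          by_cases hyP : y ∈ P
          · exact hTE' (h1 hyP)
          by_cases hyQ : y ∈ Q
          · exact hTE' (q1 hyQ)
          have : y = x := by tauto
          rw [this]; exact hx'.1
        · have e1 := xa_card_symmDiff (symmDiff P Q) {x}
          have e2 := xa_card_symmDiff P Q
          simp at e1
          omega
        · intro g
          rw [xa_sum_symmDiff, xa_sum_symmDiff, h3, q3, Finset.sum_singleton]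
          have e1 := CharTwo.add_self_eq_zero (g v0)
          have e2 := CharTwo.add_self_eq_zero (g (a x))
          have e3 := CharTwo.add_self_eq_zero (g (b x))
          linear_combination e1 + e2 + e3
      have hxn : x ∉ symmDiff (symmDiff P Q) {x} := by rw [hz]; simp
      simp only [Finset.mem_symmDiff, Finset.mem_singleton] at hxn
      by_cases hxP : x ∈ P
      · exact h1 hxP
      by_cases hxQ : x ∈ Q
      · exact q1 hxQ
      tauto
    refine ⟨R ∪ M, Finset.union_subset hRW (Finset.filter_subset _ _), T ∪ M.biUnion e,
      hTE', hTR', hP', ?_⟩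
    have hcount : ∑ v ∈ R,
        (E0.filter (fun x => (a x ∈ W ∧ b x ∈ W) ∧ (a x = v ∨ b x = v))).card
        ≤ 2 * F.card := by
      calc _ ≤ ∑ v ∈ R, (F.filter (fun x => a x = v ∨ b x = v)).card := by
            refine Finset.sum_le_sum fun v hv => Finset.card_le_card ?_
            intro x hx
            simp only [Finset.mem_filter] at hx
            rw [Finset.mem_filter, hF]
            refine ⟨⟨hx.1, hx.2.1, ?_⟩, hx.2.2⟩
            rcases hx.2.2 with h | h
            · left; rw [h]; exact hv
            · right; rw [h]; exact hv
        _ = ∑ x ∈ F, (R.filter (fun v => a x = v ∨ b x = v)).card :=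
            Finset.sum_card_bipartiteAbove_eq_sum_card_bipartiteBelow
              (fun v x => a x = v ∨ b x = v)
        _ ≤ ∑ x ∈ F, 2 := by
            refine Finset.sum_le_sum fun x _ => ?_
            refine le_trans (Finset.card_le_card (t := {a x, b x}) ?_) Finset.card_le_two
            intro v hv
            rw [Finset.mem_filter] at hv
            simp only [Finset.mem_insert, Finset.mem_singleton]
            rcases hv.2 with h | h
            · left; exact h.symm
            · right; exact h.symm
        _ = 2 * F.card := by simp [mul_comm]
    have hlow : (R.card : ℝ) * d ≤ 2 * ((R ∪ M).card : ℝ) := by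
      have h1 : (R.card : ℝ) * d ≤ ∑ v ∈ R,
          ((E0.filter (fun x => (a x ∈ W ∧ b x ∈ W) ∧ (a x = v ∨ b x = v))).card : ℝ) := by
        have := Finset.card_nsmul_le_sum R _ d (fun v hv => hdeg v (hRW hv))
        rwa [nsmul_eq_mul] at this
      have h2 : (∑ v ∈ R,
          ((E0.filter (fun x => (a x ∈ W ∧ b x ∈ W) ∧ (a x = v ∨ b x = v))).card : ℝ))
          ≤ 2 * (F.card : ℝ) := by exact_mod_cast hcount
      have h3 : (F.card : ℝ) ≤ ((R ∪ M).card : ℝ) := by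
        exact_mod_cast (Finset.card_le_card hFT).trans hTR'
      linarith
    rw [pow_succ]
    have : (d / 2) ^ k * (d / 2) ≤ R.card * (d / 2) :=
      mul_le_mul_of_nonneg_right hcard (by linarith)
    linarith

/-- A dense graph has a nonempty vertex set inducing large minimum degree. -/
lemma xa_minDeg {E V : Type*} [DecidableEq E] [DecidableEq V] (a b : E → V)
    (E0 : Finset E) (d : ℝ) (U : Finset V) (hU : U.Nonempty)
    (hdense : d * U.card ≤ ((E0.filter (fun x => a x ∈ U ∧ b x ∈ U)).card : ℝ)) :
    ∃ W : Finset V, W.Nonempty ∧ ∀ v ∈ W,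
      d ≤ ((E0.filter (fun x => (a x ∈ W ∧ b x ∈ W) ∧ (a x = v ∨ b x = v))).card : ℝ) := by
  induction U using Finset.strongInduction with
  | H U ih =>
    by_contra hcon
    push Not at hcon
    obtain ⟨v, hv, hlt⟩ := hcon U hU
    have hsplit : (E0.filter (fun x => a x ∈ U ∧ b x ∈ U)).card ≤
        (E0.filter (fun x => (a x ∈ U ∧ b x ∈ U) ∧ (a x = v ∨ b x = v))).card +
        (E0.filter (fun x => a x ∈ U.erase v ∧ b x ∈ U.erase v)).card := by
      refine le_trans (Finset.card_le_card ?_) (Finset.card_union_le _ _)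
      intro x hx
      simp only [Finset.mem_union, Finset.mem_filter, Finset.mem_erase] at hx ⊢
      tauto
    have hsplit' : ((E0.filter (fun x => a x ∈ U ∧ b x ∈ U)).card : ℝ) ≤
        ((E0.filter (fun x => (a x ∈ U ∧ b x ∈ U) ∧ (a x = v ∨ b x = v))).card : ℝ) +
        ((E0.filter (fun x => a x ∈ U.erase v ∧ b x ∈ U.erase v)).card : ℝ) := by
      exact_mod_cast hsplit
    have hc : ((U.erase v).card : ℝ) + 1 = U.card := by
      exact_mod_cast Finset.card_erase_add_one hv
    have hgt : d * (U.erase v).card <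
        ((E0.filter (fun x => a x ∈ U.erase v ∧ b x ∈ U.erase v)).card : ℝ) := by
      rw [← hc] at hdense
      linarith
    rcases (U.erase v).eq_empty_or_nonempty with h0 | hne
    · rw [h0] at hgt
      simp at hgt
    · obtain ⟨W, hW, hW'⟩ := ih (U.erase v) (Finset.erase_ssubset hv) hne hgt.le
      obtain ⟨w, hw, hwlt⟩ := hcon W hW
      exact absurd (hW' w hw) (not_le.2 hwlt)

/-- A bit as an element of `ZMod 2`. -/
def xaBit (c : Bool) : ZMod 2 := if c then 1 else 0

lemma xaBit_add (p q : Bool) : xaBit p + xaBit q = xaBit (xor p q) := by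
  cases p <;> cases q <;> decide

/-- There exists `m₀` such that for all `m ≥ m₀` and all `n ≥ 2`, every
non-adaptive `(m,n,s,3)`-scheme whose query function is `(x,y,z) ↦ (x⊕y)∧z` for
every element, or is the complement `(x,y,z) ↦ ¬((x⊕y)∧z)` for every element,
satisfies `s > (1/4)·m^(1 - 1/⌊n/2⌋)`. -/
theorem xor_and_three_probe_lower_bound :
    ∃ m₀ : ℕ, ∀ m : ℕ, m₀ ≤ m → ∀ n : ℕ, 2 ≤ n →
    ∀ s : ℕ, ∀ i₁ i₂ i₃ : Fin m → Fin s, ∀ φ : Finset (Fin m) → Fin s → Bool,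
      ((∀ S : Finset (Fin m), S.card ≤ n → ∀ x : Fin m,
          (((xor (φ S (i₁ x)) (φ S (i₂ x))) && φ S (i₃ x)) = true ↔ x ∈ S)) ∨
       (∀ S : Finset (Fin m), S.card ≤ n → ∀ x : Fin m,
          ((!((xor (φ S (i₁ x)) (φ S (i₂ x))) && φ S (i₃ x))) = true ↔ x ∈ S))) →
      (1 / 4 : ℝ) * (m : ℝ) ^ ((1 : ℝ) - 1 / ((n / 2 : ℕ) : ℝ)) < (s : ℝ) := by
  refine ⟨1, ?_⟩
  intro m hm n hn s i₁ i₂ i₃ φ hφ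
  let x0 : Fin m := ⟨0, hm⟩
  have : Nonempty (Fin m) := ⟨x0⟩
  let y : Fin s → Fin m := Function.invFun i₃
  have hy : ∀ x, i₃ (y (i₃ x)) = i₃ x := fun x => Function.invFun_eq ⟨x, rfl⟩
  let E0 : Finset (Fin m) := Finset.univ.filter (fun x => y (i₃ x) ≠ x)
  have hE0 : ∀ x, x ∈ E0 ↔ y (i₃ x) ≠ x := by intro x; simp [E0]
  have hyE : ∀ x, y (i₃ x) ∉ E0 := by
    intro x hx
    rw [hE0, hy] at hx
    exact hx rfl
  have hind : ∀ C ⊆ E0, C.card ≤ n →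
      (∀ g : Fin s → ZMod 2, ∑ x ∈ C, (g (i₁ x) + g (i₂ x)) = 0) → C = ∅ := by
    intro C hC hCn hg
    by_contra hne
    obtain ⟨x1, hx1⟩ := Finset.nonempty_iff_ne_empty.2 hne
    rcases hφ with hφ | hφ
    · let S : Finset (Fin m) := insert x1 ((C.erase x1).image (fun x => y (i₃ x)))
      have hS : S.card ≤ n := by
        refine (Finset.card_insert_le _ _).trans ?_
        have h1 := Finset.card_image_le (s := C.erase x1) (f := fun x => y (i₃ x))
        have h2 := Finset.card_erase_add_one hx1
        omega
      have h := hg (fun c => xaBit (φ S c))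
      simp only [xaBit_add] at h
      rw [Finset.sum_eq_single x1] at h
      · have h1 := (hφ S hS x1).2 (Finset.mem_insert_self _ _)
        rw [Bool.and_eq_true] at h1
        rw [h1.1] at h
        exact absurd h (by decide)
      · intro x hx hxx
        have hxS : x ∉ S := by
          intro hmem
          rcases Finset.mem_insert.1 hmem with h' | h'
          · exact hxx h'
          · obtain ⟨z, _, hz⟩ := Finset.mem_image.1 h'
            exact hyE z (by rw [hz]; exact hC hx)
        have hyS : y (i₃ x) ∈ S := Finset.mem_insert_of_mem
          (Finset.mem_image.2 ⟨x, Finset.mem_erase.2 ⟨hxx, hx⟩, rfl⟩)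
        have h1 := (hφ S hS _).2 hyS
        rw [Bool.and_eq_true, hy] at h1
        have h2 := mt (hφ S hS x).1 hxS
        rw [h1.2, Bool.and_true, Bool.not_eq_true] at h2
        rw [h2]; rfl
      · intro h'; exact absurd hx1 h'
    · have key : ∀ S ⊆ C, S.card ≤ n → ((C \ S).card : ZMod 2) = 0 := by
        intro S hSC hS
        have h := hg (fun c => xaBit (φ S c))
        simp only [xaBit_add] at h
        rw [← h, ← Finset.sum_sdiff hSC]
        have hz : ∀ x ∈ C, φ S (i₃ x) = true := by
          intro x hx
          have h1 := mt (hφ S hS (y (i₃ x))).1 (fun h' => hyE x (hC (hSC h')))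
          simp only [Bool.not_eq_true', Bool.not_eq_false, Bool.and_eq_true, hy] at h1
          exact h1.2
        have hs0 : ∑ x ∈ S, xaBit (xor (φ S (i₁ x)) (φ S (i₂ x))) = 0 := by
          refine Finset.sum_eq_zero fun x hx => ?_
          have h1 := (hφ S hS x).2 hx
          rw [hz x (hSC hx), Bool.and_true, Bool.not_eq_true'] at h1
          rw [h1]; rfl
        have hs1 : ∑ x ∈ C \ S, xaBit (xor (φ S (i₁ x)) (φ S (i₂ x))) =
            ∑ x ∈ C \ S, 1 := by
          refine Finset.sum_congr rfl fun x hx => ?_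
          rw [Finset.mem_sdiff] at hx
          have h1 := mt (hφ S hS x).1 hx.2
          rw [hz x hx.1, Bool.and_true, Bool.not_eq_true', Bool.not_eq_false] at h1
          rw [h1]; rfl
        rw [hs0, hs1]; simp
      have k1 := key ∅ (by simp) (by simp)
      have k2 := key {x1} (by simpa using hx1) (by simp; omega)
      rw [Finset.sdiff_empty] at k1
      rw [Finset.sdiff_singleton_eq_erase] at k2
      have h2 := Finset.card_erase_add_one hx1
      rw [← h2] at k1
      push_cast at k1
      rw [k2] at k1
      exact absurd k1 (by decide)
  by_contra hcon
  push Not at hcon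
  obtain ⟨t, ht⟩ : ∃ t, n / 2 = t + 1 := ⟨n / 2 - 1, by omega⟩
  have hm1 : (1 : ℝ) ≤ m := by exact_mod_cast hm
  have hm0 : (0 : ℝ) < m := by linarith
  rw [ht] at hcon
  let c : ℝ := (m : ℝ) ^ ((1 : ℝ) / ((t + 1 : ℕ) : ℝ))
  have hc1 : 1 ≤ c := Real.one_le_rpow hm1 (by positivity)
  have hcm : c ^ (t + 1) = m := by
    simp only [c]
    rw [← Real.rpow_natCast, ← Real.rpow_mul hm0.le, one_div_mul_cancel (by positivity),
      Real.rpow_one]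
  have hpow : (m : ℝ) ^ ((1 : ℝ) - 1 / ((t + 1 : ℕ) : ℝ)) = c ^ t := by
    rw [Real.rpow_sub hm0, Real.rpow_one]
    change (m : ℝ) / c = c ^ t
    rw [← hcm, pow_succ]
    field_simp
  rw [hpow] at hcon
  have hEcard : m ≤ E0.card + s := by
    have h1 : (Finset.univ : Finset (Fin m)) ⊆ E0 ∪ (Finset.univ.image y) := by
      intro x _
      by_cases h : y (i₃ x) = x
      · exact Finset.mem_union_right _ (Finset.mem_image.2 ⟨i₃ x, Finset.mem_univ _, h⟩)
      · exact Finset.mem_union_left _ ((hE0 x).2 h)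
    have h2 := (Finset.card_le_card h1).trans (Finset.card_union_le _ _)
    have h3 := Finset.card_image_le (s := (Finset.univ : Finset (Fin s))) (f := y)
    simp at h2 h3
    omega
  have hEcard' : (m : ℝ) ≤ E0.card + s := by exact_mod_cast hEcard
  have hdense : (2 * c) * ((Finset.univ : Finset (Fin s)).card : ℝ) ≤
      ((E0.filter (fun x => i₁ x ∈ Finset.univ ∧ i₂ x ∈ Finset.univ)).card : ℝ) := by
    simp only [Finset.mem_univ, and_self, Finset.filter_true, Finset.card_univ,
      Fintype.card_fin]
    have h4 : 4 * c * s ≤ m := by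
      rw [← hcm, pow_succ]
      nlinarith
    have hs : (0 : ℝ) ≤ s := Nat.cast_nonneg _
    nlinarith
  obtain ⟨W, ⟨v0, hv0⟩, hW⟩ := xa_minDeg i₁ i₂ E0 (2 * c) Finset.univ
    ⟨i₁ x0, Finset.mem_univ _⟩ hdense
  obtain ⟨R, _, _, _, _, _, hR⟩ := xa_grow i₁ i₂ E0 n hind W v0 hv0 (2 * c) (by linarith) hW t
    (by omega)
  have hRs : (R.card : ℝ) ≤ s := by
    have := Finset.card_le_univ R
    simp at this
    exact_mod_cast this
  rw [mul_div_cancel_left₀ c (by norm_num : (2 : ℝ) ≠ 0)] at hR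
  have : 0 < c ^ t := by positivity
  linarith
end

section
/- For all m and all n ≥ 3, every non-adaptive (m,n,s,3)-scheme in which every query function equals (x,y,z) ↦ (x∨y)∧z, or in which every query function equals its complement (x,y,z) ↦ ¬((x∨y)∧z), satisfies s ≥ m/32. -/
/-- If `m > 4s`, there is an element `v` whose first two probes are touched by elements `y`, `z`
(different from `v`) whose third probes are shared with elements `t`, `u` outside `{y, z}`. -/
lemma exists_config (m s : ℕ) (i₁ i₂ i₃ : Fin m → Fin s) (h : 4 * s < m) :
    ∃ v y z t u : Fin m, y ≠ v ∧ z ≠ v ∧ t ≠ y ∧ t ≠ z ∧ u ≠ y ∧ u ≠ z ∧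
      i₃ t = i₃ y ∧ i₃ u = i₃ z ∧ (i₁ v = i₁ y ∨ i₁ v = i₂ y) ∧ (i₂ v = i₁ z ∨ i₂ v = i₂ z) := by
  classical
  let F : Fin m → Prop := fun x => 3 ≤ (Finset.univ.filter (fun t => i₃ t = i₃ x)).card
  let P : Fin m → Prop := fun x => F x ∧ ∀ y, F y → y ≠ x → ¬ (i₁ x = i₁ y ∨ i₁ x = i₂ y)
  let Q : Fin m → Prop := fun x => F x ∧ ∀ y, F y → y ≠ x → ¬ (i₂ x = i₁ y ∨ i₂ x = i₂ y)
  have hF : (Finset.univ.filter (fun x => ¬ F x)).card ≤ 2 * s := by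
    have := Finset.card_le_mul_card_image_of_maps_to (f := i₃)
      (s := Finset.univ.filter (fun x => ¬ F x)) (t := Finset.univ)
      (fun _ _ => Finset.mem_univ _) 2 (by
        intro b _
        by_contra hc
        push Not at hc
        obtain ⟨x, hx⟩ := Finset.card_pos.mp (lt_trans (by norm_num) hc)
        simp only [Finset.mem_filter, Finset.mem_univ, true_and] at hx
        apply hx.1
        refine le_trans hc (Finset.card_le_card ?_)
        intro t ht
        simp only [Finset.mem_filter, Finset.mem_univ, true_and] at ht ⊢
        rw [ht.2, hx.2])
    simpa using this
  have hP : (Finset.univ.filter P).card ≤ s := by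
    have := Finset.card_le_card_of_injOn (s := Finset.univ.filter P) (t := Finset.univ) i₁
      (fun _ _ => Finset.mem_coe.mpr (Finset.mem_univ _)) (by
        intro x hx y hy hxy
        simp only [Finset.coe_filter, Finset.mem_univ, true_and, Set.mem_setOf_eq] at hx hy
        by_contra hne
        exact hx.2 y hy.1 (Ne.symm hne) (Or.inl hxy))
    simpa using this
  have hQ : (Finset.univ.filter Q).card ≤ s := by
    have := Finset.card_le_card_of_injOn (s := Finset.univ.filter Q) (t := Finset.univ) i₂
      (fun _ _ => Finset.mem_coe.mpr (Finset.mem_univ _)) (by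
        intro x hx y hy hxy
        simp only [Finset.coe_filter, Finset.mem_univ, true_and, Set.mem_setOf_eq] at hx hy
        by_contra hne
        exact hx.2 y hy.1 (Ne.symm hne) (Or.inr hxy))
    simpa using this
  have hv : ∃ v, F v ∧ ¬ P v ∧ ¬ Q v := by
    by_contra hc
    push Not at hc
    have hsub : (Finset.univ : Finset (Fin m)) ⊆ (Finset.univ.filter (fun x => ¬ F x)) ∪
        (Finset.univ.filter P ∪ Finset.univ.filter Q) := by
      intro x _
      simp only [Finset.mem_union, Finset.mem_filter, Finset.mem_univ, true_and]
      have := hc x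
      tauto
    have h1 := Finset.card_le_card hsub
    have h2 := Finset.card_union_le (Finset.univ.filter (fun x => ¬ F x))
      (Finset.univ.filter P ∪ Finset.univ.filter Q)
    have h3 := Finset.card_union_le (Finset.univ.filter P) (Finset.univ.filter Q)
    rw [Finset.card_univ, Fintype.card_fin] at h1
    omega
  obtain ⟨v, hFv, hPv, hQv⟩ := hv
  have hother : ∀ x y z, F x → ∃ t, t ≠ y ∧ t ≠ z ∧ i₃ t = i₃ x := by
    intro x y z hx
    have hlt : ({y, z} : Finset (Fin m)).card <
        (Finset.univ.filter (fun t => i₃ t = i₃ x)).card :=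
      lt_of_le_of_lt Finset.card_le_two hx
    obtain ⟨t, ht, htn⟩ := Finset.exists_mem_notMem_of_card_lt_card hlt
    simp only [Finset.mem_filter, Finset.mem_univ, true_and, Finset.mem_insert,
      Finset.mem_singleton, not_or] at ht htn
    exact ⟨t, htn.1, htn.2, ht⟩
  have hy : ∃ y, F y ∧ y ≠ v ∧ (i₁ v = i₁ y ∨ i₁ v = i₂ y) := by
    by_contra hc
    exact hPv ⟨hFv, fun y h1 h2 h3 => hc ⟨y, h1, h2, h3⟩⟩
  have hz : ∃ y, F y ∧ y ≠ v ∧ (i₂ v = i₁ y ∨ i₂ v = i₂ y) := by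
    by_contra hc
    exact hQv ⟨hFv, fun y h1 h2 h3 => hc ⟨y, h1, h2, h3⟩⟩
  obtain ⟨y, hFy, hyv, hy⟩ := hy
  obtain ⟨z, hFz, hzv, hz⟩ := hz
  obtain ⟨t, ht1, ht2, ht⟩ := hother y y z hFy
  obtain ⟨u, hu1, hu2, hu⟩ := hother z y z hFz
  exact ⟨v, y, z, t, u, hyv, hzv, ht1, ht2, hu1, hu2, ht, hu, hy, hz⟩

/-- For all `m` and all `n ≥ 3`, every non-adaptive `(m,n,s,3)`-scheme
whose query function is `(x,y,z) ↦ (x∨y)∧z` for every element, or is the complement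
`(x,y,z) ↦ ¬((x∨y)∧z)` for every element, satisfies `s ≥ m/32`. -/
theorem or_and_three_probe_lower_bound :
    ∀ m n s : ℕ, 3 ≤ n →
    ∀ i₁ i₂ i₃ : Fin m → Fin s, ∀ φ : Finset (Fin m) → Fin s → Bool,
      ((∀ S : Finset (Fin m), S.card ≤ n → ∀ x : Fin m,
          (((φ S (i₁ x) || φ S (i₂ x)) && φ S (i₃ x)) = true ↔ x ∈ S)) ∨
       (∀ S : Finset (Fin m), S.card ≤ n → ∀ x : Fin m,
          ((!((φ S (i₁ x) || φ S (i₂ x)) && φ S (i₃ x))) = true ↔ x ∈ S))) →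
      (m : ℝ) / 32 ≤ (s : ℝ) := by
  intro m n s hn i₁ i₂ i₃ φ hφ
  suffices h : m ≤ 4 * s by
    have h' : (m : ℝ) ≤ 4 * s := by exact_mod_cast h
    have hs : (0 : ℝ) ≤ s := Nat.cast_nonneg s
    linarith
  by_contra hlt
  obtain ⟨v, y, z, t, u, hyv, hzv, hty, htz, huy, huz, ht, hu, hy, hz⟩ :=
    exists_config m s i₁ i₂ i₃ (not_le.mp hlt)
  rcases hφ with hφ | hφ
  · have H := hφ {v, t, u} (le_trans Finset.card_le_three hn)
    generalize φ {v, t, u} = g at H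
    have Hv := (H v).2 (by simp)
    have Ht := (H t).2 (by simp)
    have Hu := (H u).2 (by simp)
    have Hy := mt (H y).1 (by simp [hyv, hty.symm, huy.symm])
    have Hz := mt (H z).1 (by simp [hzv, htz.symm, huz.symm])
    simp only [Bool.and_eq_true, Bool.or_eq_true, ht, hu] at Hv Ht Hu Hy Hz
    grind
  · have H := hφ {y, z} (le_trans Finset.card_le_two (by omega))
    generalize φ {y, z} = g at H
    have Hv := mt (H v).1 (by simp [hyv.symm, hzv.symm])
    have Ht := mt (H t).1 (by simp [hty, htz])
    have Hu := mt (H u).1 (by simp [huy, huz])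
    have Hy := (H y).2 (by simp)
    have Hz := (H z).2 (by simp)
    simp only [ht, hu] at Hv Ht Hu Hy Hz
    grind
end

section
/- There exists m₀ such that for all m ≥ m₀ and all n ≥ 4, every non-adaptive (m,n,s,3)-scheme in which every query function equals ALL-EQUAL (the function (x,y,z) ↦ 1 iff x = y = z), or in which every query function equals its complement NOT-ALL-EQUAL, satisfies s ≥ (1/600)·m^{1 − 1/(⌊n/4⌋+1)}. -/
/-- `a` and `b` are forced to have equal colour by at most `l` of the edges in `F`. -/
def AEConn {E V : Type} (p q : E → V) (F : Finset E) (l : ℕ) (a b : V) : Prop :=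
  ∃ T : Finset E, T ⊆ F ∧ T.card ≤ l ∧
    ∀ c : V → Bool, (∀ e ∈ T, c (p e) = c (q e)) → c a = c b

theorem AEConn.mono {E V : Type} {p q : E → V} {F F' : Finset E} {l l' : ℕ} {a b : V}
    (h : AEConn p q F l a b) (hF : F ⊆ F') (hl : l ≤ l') : AEConn p q F' l' a b := by
  obtain ⟨T, h1, h2, h3⟩ := h
  exact ⟨T, h1.trans hF, h2.trans hl, h3⟩

theorem AEConn.symm {E V : Type} {p q : E → V} {F : Finset E} {l : ℕ} {a b : V}
    (h : AEConn p q F l a b) : AEConn p q F l b a := by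
  obtain ⟨T, h1, h2, h3⟩ := h
  exact ⟨T, h1, h2, fun c hc => (h3 c hc).symm⟩

theorem AEConn.trans {E V : Type} [DecidableEq E] {p q : E → V} {F : Finset E} {l l' : ℕ}
    {a b d : V} (h : AEConn p q F l a b) (h' : AEConn p q F l' b d) :
    AEConn p q F (l + l') a d := by
  obtain ⟨T, h1, h2, h3⟩ := h
  obtain ⟨T', h1', h2', h3'⟩ := h'
  refine ⟨T ∪ T', Finset.union_subset h1 h1', (Finset.card_union_le _ _).trans (by omega), ?_⟩
  intro c hc
  exact (h3 c fun e he => hc e (Finset.mem_union_left _ he)).trans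
    (h3' c fun e he => hc e (Finset.mem_union_right _ he))

theorem AEConn.edge {E V : Type} {p q : E → V} {F : Finset E} {e : E} (he : e ∈ F) :
    AEConn p q F 1 (p e) (q e) :=
  ⟨{e}, by simpa using he, by simp, fun c hc => hc e (by simp)⟩

/-- One step of breadth-first search. -/
theorem ae_step {E V : Type} [DecidableEq E] [DecidableEq V]
    (p q : E → V) (U : Finset V) (v : V) (j : ℕ)
    (B : Finset V) (F : Finset E) (hBU : B ⊆ U) (hF : F.card ≤ B.card)
    (hc : ∀ w ∈ B, AEConn p q F j v w) :
    ∃ (B' : Finset V) (F' : Finset E), B ⊆ B' ∧ B' ⊆ U ∧ F'.card ≤ B'.card ∧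
      (∀ w ∈ B', AEConn p q F' (j + 1) v w) ∧
      ∀ e, p e ∈ U → q e ∈ U → (p e ∈ B ∨ q e ∈ B) → p e ∈ B' ∧ q e ∈ B' := by
  classical
  let N : Finset V := (U \ B).filter
    (fun w => ∃ e, (p e ∈ B ∧ q e = w) ∨ (q e ∈ B ∧ p e = w))
  have hN : ∀ w : N, ∃ e, (p e ∈ B ∧ q e = w) ∨ (q e ∈ B ∧ p e = w) :=
    fun w => (Finset.mem_filter.1 w.2).2
  choose g hg using hN
  have hNU : N ⊆ U \ B := Finset.filter_subset _ _
  have hdisj : Disjoint B N :=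
    Finset.disjoint_left.2 fun x hx hx' => (Finset.mem_sdiff.1 (hNU hx')).2 hx
  refine ⟨B ∪ N, F ∪ N.attach.image g, Finset.subset_union_left,
    Finset.union_subset hBU (hNU.trans Finset.sdiff_subset), ?_, ?_, ?_⟩
  · rw [Finset.card_union_of_disjoint hdisj]
    have h1 := Finset.card_union_le F (N.attach.image g)
    have h2 : (N.attach.image g).card ≤ N.attach.card := Finset.card_image_le
    rw [Finset.card_attach] at h2
    omega
  · intro w hw
    rcases Finset.mem_union.1 hw with hw | hw
    · exact (hc w hw).mono Finset.subset_union_left (by omega)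
    · have hmem : g ⟨w, hw⟩ ∈ F ∪ N.attach.image g :=
        Finset.mem_union_right _ (Finset.mem_image_of_mem _ (Finset.mem_attach _ _))
      have hE : AEConn p q _ 1 _ _ := AEConn.edge hmem
      rcases hg ⟨w, hw⟩ with ⟨h1, h2⟩ | ⟨h1, h2⟩
      · have := ((hc _ h1).mono (Finset.subset_union_left (s₂ := N.attach.image g)) le_rfl).trans hE
        rw [h2] at this
        exact this
      · have := ((hc _ h1).mono
          (Finset.subset_union_left (s₂ := N.attach.image g)) le_rfl).trans hE.symm
        rw [h2] at this
        exact this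
  · intro e hp hq h
    have key : ∀ w ∈ U, (∃ e, (p e ∈ B ∧ q e = w) ∨ (q e ∈ B ∧ p e = w)) → w ∈ B ∪ N := by
      intro w hw he
      by_cases hwB : w ∈ B
      · exact Finset.mem_union_left _ hwB
      · exact Finset.mem_union_right _
          (Finset.mem_filter.2 ⟨Finset.mem_sdiff.2 ⟨hw, hwB⟩, he⟩)
    rcases h with h | h
    · exact ⟨Finset.mem_union_left _ h, key _ hq ⟨e, Or.inl ⟨h, rfl⟩⟩⟩
    · exact ⟨key _ hp ⟨e, Or.inr ⟨h, rfl⟩⟩, Finset.mem_union_left _ h⟩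

/-- Ball growing: either a slowly growing ball is found, or the ball has size at least `d ^ j`. -/
theorem ae_grow {E V : Type} [DecidableEq E] [DecidableEq V]
    (p q : E → V) (U : Finset V) (v : V) (hv : v ∈ U) (d : ℕ) (j : ℕ) :
    (∃ (B B' : Finset V) (F : Finset E), v ∈ B ∧ B ⊆ U ∧ F.card ≤ d * B.card ∧
      (∀ w ∈ B', AEConn p q F j v w) ∧
      ∀ e, p e ∈ U → q e ∈ U → (p e ∈ B ∨ q e ∈ B) → p e ∈ B' ∧ q e ∈ B') ∨
    (∃ (B : Finset V) (F : Finset E), v ∈ B ∧ B ⊆ U ∧ F.card ≤ B.card ∧ d ^ j ≤ B.card ∧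
      ∀ w ∈ B, AEConn p q F j v w) := by
  induction j with
  | zero =>
    right
    refine ⟨{v}, ∅, by simp, by simpa using hv, by simp, by simp, ?_⟩
    intro w hw
    rw [Finset.mem_singleton.1 hw]
    exact ⟨∅, by simp, by simp, fun _ _ => rfl⟩
  | succ j ih =>
    rcases ih with ⟨B, B', F, h1, h2, h3, h4, h5⟩ | ⟨B, F, h1, h2, h3, h4, h5⟩
    · exact Or.inl ⟨B, B', F, h1, h2, h3,
        fun w hw => (h4 w hw).mono (Finset.Subset.refl _) (by omega), h5⟩
    · obtain ⟨B', F', g1, g2, g3, g4, g5⟩ := ae_step p q U v j B F h2 h3 h5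
      by_cases hcard : B'.card ≤ d * B.card
      · exact Or.inl ⟨B, B', F', h1, h2, g3.trans hcard, g4, g5⟩
      · refine Or.inr ⟨B', F', g1 h1, g2, g3, ?_, g4⟩
        rw [pow_succ, mul_comm]
        exact (Nat.mul_le_mul_left d h4).trans (by omega)

/-- Existence of sparse `2k`-spanners. -/
theorem ae_spanner {E V : Type} [DecidableEq E] [DecidableEq V]
    (p q : E → V) (d k : ℕ) (N : ℕ) : ∀ U : Finset V, U.card ≤ N → U.card < d ^ k →
    ∃ F : Finset E, F.card ≤ d * U.card ∧
      ∀ e, p e ∈ U → q e ∈ U → AEConn p q F (2 * k) (p e) (q e) := by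
  induction N with
  | zero =>
    intro U hU _
    have : U = ∅ := Finset.card_eq_zero.1 (by omega)
    subst this
    exact ⟨∅, by simp, by simp⟩
  | succ N ih =>
    intro U hU hd
    rcases U.eq_empty_or_nonempty with rfl | ⟨v, hv⟩
    · exact ⟨∅, by simp, by simp⟩
    rcases ae_grow p q U v hv d k with ⟨B, B', F, h1, h2, h3, h4, h5⟩ | ⟨B, F, h1, h2, h3, h4, h5⟩
    · have hcard : (U \ B).card + B.card = U.card := Finset.card_sdiff_add_card_eq_card h2
      have hpos : 0 < B.card := Finset.card_pos.2 ⟨v, h1⟩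
      obtain ⟨F₂, f1, f2⟩ := ih (U \ B) (by omega) (by omega)
      refine ⟨F ∪ F₂, ?_, ?_⟩
      · have := Finset.card_union_le F F₂
        rw [← hcard, mul_add]
        omega
      · intro e hp hq
        by_cases hB : p e ∈ B ∨ q e ∈ B
        · obtain ⟨a, b⟩ := h5 e hp hq hB
          exact ((h4 _ a).symm.trans (h4 _ b)).mono Finset.subset_union_left (by omega)
        · push Not at hB
          exact (f2 e (Finset.mem_sdiff.2 ⟨hp, hB.1⟩) (Finset.mem_sdiff.2 ⟨hq, hB.2⟩)).mono
            Finset.subset_union_right le_rfl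
    · have := Finset.card_le_card h2
      omega

/-- The combinatorial bound for the ALL-EQUAL query function. -/
theorem ae_count (m n s d : ℕ) (i₁ i₂ i₃ : Fin m → Fin s) (φ : Finset (Fin m) → Fin s → Bool)
    (h : ∀ S : Finset (Fin m), S.card ≤ n → ∀ x : Fin m,
          ((φ S (i₁ x) = φ S (i₂ x) ∧ φ S (i₂ x) = φ S (i₃ x)) ↔ x ∈ S))
    (hd : s < d ^ (n / 4)) : m ≤ 2 * (d * s) := by
  obtain ⟨F₁, a1, a2⟩ := ae_spanner i₁ i₂ d (n / 4) s Finset.univ (by simp) (by simpa using hd)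
  obtain ⟨F₂, b1, b2⟩ := ae_spanner i₂ i₃ d (n / 4) s Finset.univ (by simp) (by simpa using hd)
  rw [Finset.card_univ, Fintype.card_fin] at a1 b1
  by_contra hm
  have hlt : (F₁ ∪ F₂).card < (Finset.univ : Finset (Fin m)).card := by
    rw [Finset.card_univ, Fintype.card_fin]
    have := Finset.card_union_le F₁ F₂
    omega
  obtain ⟨x, -, hx⟩ := Finset.exists_mem_notMem_of_card_lt_card hlt
  obtain ⟨T₁, t1, t2, t3⟩ := a2 x (Finset.mem_univ _) (Finset.mem_univ _)
  obtain ⟨T₂, u1, u2, u3⟩ := b2 x (Finset.mem_univ _) (Finset.mem_univ _)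
  have hS : (T₁ ∪ T₂).card ≤ n := (Finset.card_union_le _ _).trans (by omega)
  refine hx (Finset.union_subset_union t1 u1 ((h _ hS x).1 ⟨t3 _ ?_, u3 _ ?_⟩))
  · intro e he
    exact ((h _ hS e).2 (Finset.mem_union_left _ he)).1
  · intro e he
    exact ((h _ hS e).2 (Finset.mem_union_right _ he)).2

/-- The linear-algebra bound for the NOT-ALL-EQUAL query function. -/
theorem nae_count (m n s : ℕ) (hn : 1 ≤ n) (i₁ i₂ i₃ : Fin m → Fin s)
    (φ : Finset (Fin m) → Fin s → Bool)
    (h : ∀ S : Finset (Fin m), S.card ≤ n → ∀ x : Fin m,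
          ((¬(φ S (i₁ x) = φ S (i₂ x) ∧ φ S (i₂ x) = φ S (i₃ x))) ↔ x ∈ S)) : m ≤ s := by
  have h1 : ∀ y x : Fin m,
      ((¬(φ {y} (i₁ x) = φ {y} (i₂ x) ∧ φ {y} (i₂ x) = φ {y} (i₃ x))) ↔ x = y) := by
    intro y x
    have := h {y} (by simpa using hn) x
    rwa [Finset.mem_singleton] at this
  have h2 : ∀ x : Fin m, ∃ a b : Fin s, φ {x} a ≠ φ {x} b ∧
      ∀ y, y ≠ x → φ {y} a = φ {y} b := by
    intro x
    have hx := (h1 x x).2 rfl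
    have hy : ∀ y, y ≠ x → (φ {y} (i₁ x) = φ {y} (i₂ x) ∧ φ {y} (i₂ x) = φ {y} (i₃ x)) := by
      intro y hy
      by_contra hc
      exact hy ((h1 y x).1 hc).symm
    by_cases h12 : φ {x} (i₁ x) = φ {x} (i₂ x)
    · exact ⟨i₂ x, i₃ x, fun h23 => hx ⟨h12, h23⟩, fun y hyx => (hy y hyx).2⟩
    · exact ⟨i₁ x, i₂ x, h12, fun y hyx => (hy y hyx).1⟩
  choose a b hne heq using h2
  let w : Fin m → (Fin s → ℚ) := fun y t => if φ {y} t then 1 else 0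
  have hli : LinearIndependent ℚ w := by
    rw [Fintype.linearIndependent_iff]
    intro g hg x
    have ha := congrFun hg (a x)
    have hb := congrFun hg (b x)
    simp only [Finset.sum_apply, Pi.smul_apply, smul_eq_mul, Pi.zero_apply] at ha hb
    have hsub : ∑ y, (g y * w y (a x) - g y * w y (b x)) = 0 := by
      rw [Finset.sum_sub_distrib, ha, hb, sub_zero]
    rw [Finset.sum_eq_single x] at hsub
    · have hx := hne x
      simp only [w] at hsub
      cases h3 : φ {x} (a x) <;> cases h4 : φ {x} (b x) <;> simp_all
    · intro y _ hy
      simp only [w, heq x y hy, sub_self]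
    · simp
  have := hli.fintype_card_le_finrank
  simpa using this


/-- There exists `m₀` such that for all `m ≥ m₀` and all `n ≥ 4`, every
non-adaptive `(m,n,s,3)`-scheme whose query function is ALL-EQUAL for every
element, or is NOT-ALL-EQUAL for every element, satisfies
`s ≥ (1/600)·m^(1 - 1/(⌊n/4⌋+1))`. -/
theorem all_equal_three_probe_lower_bound :
    ∃ m₀ : ℕ, ∀ m : ℕ, m₀ ≤ m → ∀ n : ℕ, 4 ≤ n →
    ∀ s : ℕ, ∀ i₁ i₂ i₃ : Fin m → Fin s, ∀ φ : Finset (Fin m) → Fin s → Bool,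
      ((∀ S : Finset (Fin m), S.card ≤ n → ∀ x : Fin m,
          ((φ S (i₁ x) = φ S (i₂ x) ∧ φ S (i₂ x) = φ S (i₃ x)) ↔ x ∈ S)) ∨
       (∀ S : Finset (Fin m), S.card ≤ n → ∀ x : Fin m,
          ((¬(φ S (i₁ x) = φ S (i₂ x) ∧ φ S (i₂ x) = φ S (i₃ x))) ↔ x ∈ S))) →
      (1 / 600 : ℝ) * (m : ℝ) ^ ((1 : ℝ) - 1 / ((n / 4 + 1 : ℕ) : ℝ)) ≤ (s : ℝ) := by
  refine ⟨1, ?_⟩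
  intro m hm n hn s i₁ i₂ i₃ φ h
  have hm1 : (1 : ℝ) ≤ m := by exact_mod_cast hm
  have hs : 0 < s := Fin.pos (i₁ ⟨0, hm⟩)
  have hs1 : (1 : ℝ) ≤ s := by exact_mod_cast hs
  have hk : 1 ≤ n / 4 := by omega
  generalize hkk : n / 4 = k at hk ⊢
  have hk0 : (0 : ℝ) < k := by exact_mod_cast hk
  rcases h with h | h
  · let r : ℝ := (s : ℝ) ^ (1 / (k : ℝ))
    have hr1 : 1 ≤ r := Real.one_le_rpow hs1 (by positivity)
    have hrk : r ^ k = s := by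
      simp only [r]
      rw [← Real.rpow_natCast, ← Real.rpow_mul (by positivity), one_div_mul_cancel hk0.ne',
        Real.rpow_one]
    have hd : s < (⌊r⌋₊ + 1) ^ k := by
      have h1 : r < ((⌊r⌋₊ + 1 : ℕ) : ℝ) := by
        push_cast
        exact Nat.lt_floor_add_one r
      have h2 : r ^ k < ((⌊r⌋₊ + 1 : ℕ) : ℝ) ^ k :=
        pow_lt_pow_left₀ h1 (by linarith) (by omega)
      rw [hrk] at h2
      exact_mod_cast h2
    have hc := ae_count m n s (⌊r⌋₊ + 1) i₁ i₂ i₃ φ h (by rw [hkk]; exact hd)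
    have hfl : (⌊r⌋₊ : ℝ) ≤ r := Nat.floor_le (by linarith)
    have hc' : (m : ℝ) ≤ 2 * (((⌊r⌋₊ : ℝ) + 1) * s) := by exact_mod_cast hc
    have hm4 : (m : ℝ) ≤ 4 * (r * s) := by nlinarith
    have hexp : (1 : ℝ) - 1 / ((k + 1 : ℕ) : ℝ) = k / (k + 1) := by
      push_cast
      field_simp
      ring
    rw [hexp]
    have hrs : r * s = (s : ℝ) ^ (((k : ℝ) + 1) / k) := by
      simp only [r]
      rw [add_div, div_self hk0.ne', Real.rpow_add (by linarith), Real.rpow_one, mul_comm]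
    have h3 : (m : ℝ) ^ ((k : ℝ) / (k + 1)) ≤ (4 * (r * s)) ^ ((k : ℝ) / (k + 1)) :=
      Real.rpow_le_rpow (by positivity) hm4 (by positivity)
    rw [Real.mul_rpow (by norm_num) (by positivity), hrs, ← Real.rpow_mul (by positivity)] at h3
    have h4 : ((k : ℝ) + 1) / k * (k / (k + 1)) = 1 := by field_simp
    rw [h4, Real.rpow_one] at h3
    have h5 : (4 : ℝ) ^ ((k : ℝ) / (k + 1)) ≤ 4 ^ (1 : ℝ) :=
      Real.rpow_le_rpow_of_exponent_le (by norm_num)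
        (by rw [div_le_one (by positivity)]; linarith)
    rw [Real.rpow_one] at h5
    nlinarith
  · have hc := nae_count m n s (by omega) i₁ i₂ i₃ φ h
    have hc' : (m : ℝ) ≤ s := by exact_mod_cast hc
    have h1 : (m : ℝ) ^ ((1 : ℝ) - 1 / ((k + 1 : ℕ) : ℝ)) ≤ (m : ℝ) ^ (1 : ℝ) :=
      Real.rpow_le_rpow_of_exponent_le hm1 (by
        have : (0 : ℝ) ≤ 1 / ((k + 1 : ℕ) : ℝ) := by positivity
        linarith)
    rw [Real.rpow_one] at h1
    linarith
end
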